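/- Let S be a compact subset of ℝⁿ × ℂᵐ (viewed inside ℂⁿ × ℂᵐ) such that for every set U, open in ℝⁿ × ℂᵐ, containing S, and for each u ∈ π(S), there exist a Stein open set Ω_u ⊆ ℂᵐ with S_u ⊆ Ω_u, the closure of Ω_u compact and contained in the fiber U_u, and a number δ > 0 such that for every u' ∈ π(S) with ‖u − u'‖ ≤ δ one has S_{u'} ⊆ Ω_u and S_{u'} is O(Ω_u)-convex. Then S is a Stein compactum in ℂⁿ × ℂᵐ. -/

import Mathlib

open Set Topology

noncomputable section

/-- The `𝒪(Ω)`-hull of a set `K` inside `Ω`: points of `Ω` where every function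
holomorphic on `Ω` is bounded by its sup over `K`. -/
def hullO {E : Type*} [NormedAddCommGroup E] [NormedSpace ℂ E] (Ω K : Set E) : Set E :=
  {z ∈ Ω | ∀ f : E → ℂ, DifferentiableOn ℂ f Ω → ‖f z‖ ≤ ⨆ w ∈ K, ‖f w‖}

/-- An open set is Stein if the `𝒪(Ω)`-hull of every compact subset is compact. -/
def IsSteinOpen {E : Type*} [NormedAddCommGroup E] [NormedSpace ℂ E] (Ω : Set E) : Prop :=
  IsOpen Ω ∧ ∀ K : Set E, K ⊆ Ω → IsCompact K → IsCompact (hullO Ω K)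

/-- A compact set is a Stein compactum if every open neighborhood contains a
Stein open neighborhood. -/
def IsSteinCompactum {E : Type*} [NormedAddCommGroup E] [NormedSpace ℂ E] (S : Set E) : Prop :=
  ∀ U : Set E, IsOpen U → S ⊆ U → ∃ Ω : Set E, IsSteinOpen Ω ∧ S ⊆ Ω ∧ Ω ⊆ U

/-- `ℝⁿ` viewed as the real subspace of `ℂⁿ`. -/
def realSlice (n : ℕ) : Set (EuclideanSpace ℂ (Fin n)) := {x | ∀ i, (x i).im = 0}

/-- The fiber of a subset of a product over a point of the first factor. -/
def fiberOf {α β : Type*} (S : Set (α × β)) (u : α) : Set β := {z | (u, z) ∈ S}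

/-- A subset of `ℝⁿ × ℂᵐ` that is open in the subspace topology of `ℝⁿ × ℂᵐ ⊆ ℂⁿ × ℂᵐ`. -/
def OpenInSlice {n m : ℕ}
    (U : Set (EuclideanSpace ℂ (Fin n) × EuclideanSpace ℂ (Fin m))) : Prop :=
  ∃ W, IsOpen W ∧ U = W ∩ (realSlice n ×ˢ (univ : Set (EuclideanSpace ℂ (Fin m))))

namespace SC
open MeasureTheory Filter
open scoped ContDiff ComplexConjugate

section Calc
variable {E : Type*} [NormedAddCommGroup E] [NormedSpace ℂ E]

/-- the `∂̄` derivative in direction `v` -/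
def db (v : E) (f : E → ℂ) (x : E) : ℂ :=
  (fderiv ℝ f x v + Complex.I * fderiv ℝ f x (Complex.I • v)) / 2

/-- the `∂` derivative in direction `v` -/
def dd (v : E) (f : E → ℂ) (x : E) : ℂ :=
  (fderiv ℝ f x v - Complex.I * fderiv ℝ f x (Complex.I • v)) / 2

lemma db_add {v : E} {f g : E → ℂ} {x : E} (hf : DifferentiableAt ℝ f x)
    (hg : DifferentiableAt ℝ g x) : db v (fun y => f y + g y) x = db v f x + db v g x := by
  simp only [db, fderiv_fun_add hf hg, add_apply]; ring

lemma dd_add {v : E} {f g : E → ℂ} {x : E} (hf : DifferentiableAt ℝ f x)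
    (hg : DifferentiableAt ℝ g x) : dd v (fun y => f y + g y) x = dd v f x + dd v g x := by
  simp only [dd, fderiv_fun_add hf hg, add_apply]; ring

lemma db_sub {v : E} {f g : E → ℂ} {x : E} (hf : DifferentiableAt ℝ f x)
    (hg : DifferentiableAt ℝ g x) : db v (fun y => f y - g y) x = db v f x - db v g x := by
  simp only [db, fderiv_fun_sub hf hg, sub_apply]; ring

lemma dd_sub {v : E} {f g : E → ℂ} {x : E} (hf : DifferentiableAt ℝ f x)
    (hg : DifferentiableAt ℝ g x) : dd v (fun y => f y - g y) x = dd v f x - dd v g x := by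
  simp only [dd, fderiv_fun_sub hf hg, sub_apply]; ring

lemma db_mul {v : E} {f g : E → ℂ} {x : E} (hf : DifferentiableAt ℝ f x)
    (hg : DifferentiableAt ℝ g x) :
    db v (fun y => f y * g y) x = f x * db v g x + db v f x * g x := by
  simp only [db, fderiv_fun_mul hf hg, add_apply,
    smul_apply, smul_eq_mul]; ring

lemma dd_mul {v : E} {f g : E → ℂ} {x : E} (hf : DifferentiableAt ℝ f x)
    (hg : DifferentiableAt ℝ g x) :
    dd v (fun y => f y * g y) x = f x * dd v g x + dd v f x * g x := by
  simp only [dd, fderiv_fun_mul hf hg, add_apply,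
    smul_apply, smul_eq_mul]; ring

lemma fderiv_conj {f : E → ℂ} {x : E} (hf : DifferentiableAt ℝ f x) (v : E) :
    fderiv ℝ (fun y => conj (f y)) x v = conj (fderiv ℝ f x v) := by
  have := (Complex.conjCLE.toContinuousLinearMap.hasFDerivAt.comp x hf.hasFDerivAt).fderiv
  have h2 : (fun y => conj (f y)) = (Complex.conjCLE.toContinuousLinearMap : ℂ → ℂ) ∘ f := by
    ext y; simp
  rw [h2, this]; simp

lemma db_conj {v : E} {f : E → ℂ} {x : E} (hf : DifferentiableAt ℝ f x) :
    db v (fun y => conj (f y)) x = conj (dd v f x) := by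
  simp only [db, dd, fderiv_conj hf]
  simp [Complex.conj_ofNat, sub_eq_add_neg]

lemma dd_conj {v : E} {f : E → ℂ} {x : E} (hf : DifferentiableAt ℝ f x) :
    dd v (fun y => conj (f y)) x = conj (db v f x) := by
  simp only [db, dd, fderiv_conj hf]
  simp [Complex.conj_ofNat, sub_eq_add_neg]

lemma db_ofReal {v : E} {f : E → ℝ} {x : E} (hf : DifferentiableAt ℝ f x) :
    db v (fun y => (f y : ℂ)) x = conj (dd v (fun y => (f y : ℂ)) x) := by
  have : DifferentiableAt ℝ (fun y => (f y : ℂ)) x :=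
    Complex.ofRealCLM.differentiableAt.comp x hf
  rw [← db_conj this]; simp

lemma fderiv_ofReal {f : E → ℝ} {x : E} (hf : DifferentiableAt ℝ f x) (v : E) :
    fderiv ℝ (fun y => (f y : ℂ)) x v = (fderiv ℝ f x v : ℂ) := by
  have := (Complex.ofRealCLM.hasFDerivAt.comp x hf.hasFDerivAt).fderiv
  have h2 : (fun y => (f y : ℂ)) = (Complex.ofRealCLM : ℝ → ℂ) ∘ f := by
    ext y; simp
  rw [h2, this]; simp

lemma dd_congr {v : E} {f g : E → ℂ} {x : E} (h : f =ᶠ[𝓝 x] g) : dd v f x = dd v g x := by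
  simp only [dd, h.fderiv_eq]

lemma db_congr {v : E} {f g : E → ℂ} {x : E} (h : f =ᶠ[𝓝 x] g) : db v f x = db v g x := by
  simp only [db, h.fderiv_eq]

/-- chain rule with a real function of one real variable -/
lemma fderiv_real_comp {g : ℝ → ℝ} {g' : ℝ} {f : E → ℝ} {x : E} (hf : DifferentiableAt ℝ f x)
    (hg : HasDerivAt g g' (f x)) (v : E) :
    fderiv ℝ (fun y => g (f y)) x v = g' * fderiv ℝ f x v := by
  have := (hg.comp_hasFDerivAt x hf.hasFDerivAt).fderiv
  change fderiv ℝ (g ∘ f) x v = _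
  rw [this]; simp

lemma dd_real_comp {g : ℝ → ℝ} {g' : ℝ} {f : E → ℝ} {x : E} (hf : DifferentiableAt ℝ f x)
    (hg : HasDerivAt g g' (f x)) (v : E) :
    dd v (fun y => (g (f y) : ℂ)) x = g' * dd v (fun y => (f y : ℂ)) x := by
  have h1 : DifferentiableAt ℝ (fun y => g (f y)) x := hg.differentiableAt.comp x hf
  simp only [dd, fderiv_ofReal h1, fderiv_ofReal hf, fderiv_real_comp hf hg]
  push_cast; ring

lemma contDiff_fderiv_apply {F : Type*} [NormedAddCommGroup F] [NormedSpace ℝ F]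
    {f : E → F} (hf : ContDiff ℝ ∞ f) (v : E) :
    ContDiff ℝ ∞ (fun x => fderiv ℝ f x v) :=
  (hf.fderiv_right (m := ∞) (by simp)).clm_apply contDiff_const

lemma contDiff_db {f : E → ℂ} (hf : ContDiff ℝ ∞ f) (v : E) : ContDiff ℝ ∞ (db v f) := by
  unfold db
  exact ((contDiff_fderiv_apply hf v).add
    (contDiff_const.mul (contDiff_fderiv_apply hf _))).div_const _

lemma contDiff_dd {f : E → ℂ} (hf : ContDiff ℝ ∞ f) (v : E) : ContDiff ℝ ∞ (dd v f) := by
  unfold dd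
  exact ((contDiff_fderiv_apply hf v).sub
    (contDiff_const.mul (contDiff_fderiv_apply hf _))).div_const _

lemma tsupport_fderiv_apply {f : E → ℂ} (v : E) :
    Function.support (fun x => fderiv ℝ f x v) ⊆ tsupport f := by
  intro x hx
  by_contra h
  apply hx
  have : f =ᶠ[𝓝 x] fun _ => 0 := by
    rw [notMem_tsupport_iff_eventuallyEq] at h; exact h
  simp [this.fderiv_eq]

lemma db_zero_of_notMem {f : E → ℂ} {v x : E} (h : x ∉ tsupport f) : db v f x = 0 := by
  have : f =ᶠ[𝓝 x] fun _ => 0 := by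
    rw [notMem_tsupport_iff_eventuallyEq] at h; exact h
  simp [db, this.fderiv_eq]

lemma dd_zero_of_notMem {f : E → ℂ} {v x : E} (h : x ∉ tsupport f) : dd v f x = 0 := by
  have : f =ᶠ[𝓝 x] fun _ => 0 := by
    rw [notMem_tsupport_iff_eventuallyEq] at h; exact h
  simp [dd, this.fderiv_eq]

lemma tsupport_db_subset {f : E → ℂ} (v : E) : tsupport (db v f) ⊆ tsupport f := by
  apply closure_minimal _ (isClosed_tsupport f)
  intro x hx
  by_contra h
  exact hx (db_zero_of_notMem h)

lemma tsupport_dd_subset {f : E → ℂ} (v : E) : tsupport (dd v f) ⊆ tsupport f := by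
  apply closure_minimal _ (isClosed_tsupport f)
  intro x hx
  by_contra h
  exact hx (dd_zero_of_notMem h)

lemma fderiv_fderiv_apply {F : Type*} [NormedAddCommGroup F] [NormedSpace ℝ F]
    {f : E → F} (hf : ContDiff ℝ ∞ f) (u v x : E) :
    fderiv ℝ (fun y => fderiv ℝ f y v) x u = fderiv ℝ (fderiv ℝ f) x u v := by
  have h : DifferentiableAt ℝ (fderiv ℝ f) x :=
    ((hf.fderiv_right (m := ∞) (by simp)).differentiable (by simp)) x
  rw [fderiv_clm_apply h (differentiableAt_const v)]
  simp

lemma fderiv_dd {f : E → ℂ} (hf : ContDiff ℝ ∞ f) (u v x : E) :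
    fderiv ℝ (dd v f) x u = (fderiv ℝ (fderiv ℝ f) x u v
      - Complex.I * fderiv ℝ (fderiv ℝ f) x u (Complex.I • v)) / 2 := by
  have d1 : ∀ w : E, DifferentiableAt ℝ (fun y => fderiv ℝ f y w) x := fun w =>
    (contDiff_fderiv_apply hf w).differentiable (by simp) x
  have : dd v f = fun y => (2 : ℂ)⁻¹ * (fderiv ℝ f y v -
      Complex.I * fderiv ℝ f y (Complex.I • v)) := by
    ext y; simp only [dd]; ring
  rw [this, fderiv_const_mul ((d1 v).fun_sub ((d1 _).const_mul _)), smul_apply,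
    fderiv_fun_sub (d1 v) ((d1 _).const_mul _), sub_apply,
    fderiv_const_mul (d1 _), smul_apply, fderiv_fderiv_apply hf,
    fderiv_fderiv_apply hf]
  simp only [smul_eq_mul]; ring

lemma fderiv_db {f : E → ℂ} (hf : ContDiff ℝ ∞ f) (u v x : E) :
    fderiv ℝ (db v f) x u = (fderiv ℝ (fderiv ℝ f) x u v
      + Complex.I * fderiv ℝ (fderiv ℝ f) x u (Complex.I • v)) / 2 := by
  have d1 : ∀ w : E, DifferentiableAt ℝ (fun y => fderiv ℝ f y w) x := fun w =>
    (contDiff_fderiv_apply hf w).differentiable (by simp) x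
  have : db v f = fun y => (2 : ℂ)⁻¹ * (fderiv ℝ f y v +
      Complex.I * fderiv ℝ f y (Complex.I • v)) := by
    ext y; simp only [db]; ring
  rw [this, fderiv_const_mul ((d1 v).fun_add ((d1 _).const_mul _)), smul_apply,
    fderiv_fun_add (d1 v) ((d1 _).const_mul _), add_apply,
    fderiv_const_mul (d1 _), smul_apply, fderiv_fderiv_apply hf,
    fderiv_fderiv_apply hf]
  simp only [smul_eq_mul]; ring

lemma snd_symm {F : Type*} [NormedAddCommGroup F] [NormedSpace ℝ F]
    {f : E → F} (hf : ContDiff ℝ ∞ f) (x u v : E) :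
    fderiv ℝ (fderiv ℝ f) x u v = fderiv ℝ (fderiv ℝ f) x v u :=
  (hf.contDiffAt.isSymmSndFDerivAt (by simp; exact WithTop.coe_le_coe.2 (le_top : (2:ℕ∞) ≤ ⊤))) u v

lemma db_dd_comm {f : E → ℂ} (hf : ContDiff ℝ ∞ f) (u v x : E) :
    db u (dd v f) x = dd v (db u f) x := by
  simp only [db.eq_1 u (dd v f), dd.eq_1 v (db u f), fderiv_dd hf, fderiv_db hf]
  rw [snd_symm hf x u v, snd_symm hf x (Complex.I • u) v, snd_symm hf x u (Complex.I • v),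
    snd_symm hf x (Complex.I • u) (Complex.I • v)]
  ring

lemma db_db_comm {f : E → ℂ} (hf : ContDiff ℝ ∞ f) (u v x : E) :
    db u (db v f) x = db v (db u f) x := by
  simp only [db.eq_1 u (db v f), db.eq_1 v (db u f), fderiv_db hf]
  rw [snd_symm hf x u v, snd_symm hf x (Complex.I • u) v, snd_symm hf x u (Complex.I • v),
    snd_symm hf x (Complex.I • u) (Complex.I • v)]
  ring

/-- four times the Levi form -/
def levi (φ : E → ℝ) (x v : E) : ℝ :=
  fderiv ℝ (fderiv ℝ φ) x v v +
    fderiv ℝ (fderiv ℝ φ) x (Complex.I • v) (Complex.I • v)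

lemma dd_dir_add (f : E → ℂ) (x u v : E) : dd (u + v) f x = dd u f x + dd v f x := by
  simp only [dd, smul_add, map_add]; ring

lemma db_dir_add (f : E → ℂ) (x u v : E) : db (u + v) f x = db u f x + db v f x := by
  simp only [db, smul_add, map_add]; ring

lemma dd_dir_smul (f : E → ℂ) (x v : E) (c : ℂ) : dd (c • v) f x = c * dd v f x := by
  have h : c • v = c.re • v + c.im • (Complex.I • v) := by
    rw [← Complex.coe_smul, ← Complex.coe_smul, smul_smul, ← add_smul, Complex.re_add_im]
  have h2 : Complex.I • c • v = c.re • (Complex.I • v) + (-c.im) • v := by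
    rw [← Complex.coe_smul, ← Complex.coe_smul, smul_smul, smul_smul, ← add_smul]
    congr 1
    apply Complex.ext <;> simp
  simp only [dd]
  rw [h2, h]
  simp only [map_add, map_smul, Complex.real_smul]
  conv_rhs => rw [← Complex.re_add_im c]
  push_cast
  linear_combination (c.im * fderiv ℝ f x (Complex.I • v) / 2) * Complex.I_sq

lemma db_dir_smul (f : E → ℂ) (x v : E) (c : ℂ) : db (c • v) f x = conj c * db v f x := by
  have h : c • v = c.re • v + c.im • (Complex.I • v) := by
    rw [← Complex.coe_smul, ← Complex.coe_smul, smul_smul, ← add_smul, Complex.re_add_im]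
  have h2 : Complex.I • c • v = c.re • (Complex.I • v) + (-c.im) • v := by
    rw [← Complex.coe_smul, ← Complex.coe_smul, smul_smul, smul_smul, ← add_smul]
    congr 1
    apply Complex.ext <;> simp
  have h3 : conj c = c.re - c.im * Complex.I := by
    apply Complex.ext <;> simp
  simp only [db]
  rw [h2, h, h3]
  simp only [map_add, map_smul, Complex.real_smul]
  push_cast
  linear_combination (c.im * fderiv ℝ f x (Complex.I • v) / 2) * Complex.I_sq

lemma dd_dir_sum {ι : Type*} (s : Finset ι) (f : E → ℂ) (x : E) (c : ι → ℂ) (e : ι → E) :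
    dd (∑ j ∈ s, c j • e j) f x = ∑ j ∈ s, c j * dd (e j) f x := by
  classical
  induction s using Finset.induction_on with
  | empty => simp [dd]
  | insert a s ha ih => rw [Finset.sum_insert ha, Finset.sum_insert ha, dd_dir_add, ih, dd_dir_smul]

lemma db_dir_sum {ι : Type*} (s : Finset ι) (f : E → ℂ) (x : E) (c : ι → ℂ) (e : ι → E) :
    db (∑ j ∈ s, c j • e j) f x = ∑ j ∈ s, conj (c j) * db (e j) f x := by
  classical
  induction s using Finset.induction_on with
  | empty => simp [db]
  | insert a s ha ih => rw [Finset.sum_insert ha, Finset.sum_insert ha, db_dir_add, ih, db_dir_smul]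

lemma fderiv2_ofReal {φ : E → ℝ} (hφ : ContDiff ℝ ∞ φ) (x u v : E) :
    fderiv ℝ (fderiv ℝ (fun y => (φ y : ℂ))) x u v = (fderiv ℝ (fderiv ℝ φ) x u v : ℂ) := by
  have hc : ContDiff ℝ ∞ (fun y => (φ y : ℂ)) := Complex.ofRealCLM.contDiff.comp hφ
  rw [← fderiv_fderiv_apply hc, ← fderiv_fderiv_apply hφ]
  have : (fun y => fderiv ℝ (fun y => (φ y : ℂ)) y v) = fun y => ((fderiv ℝ φ y v : ℝ) : ℂ) := by
    ext y; exact fderiv_ofReal (hφ.differentiable (by simp) y) v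
  rw [this, fderiv_ofReal ((contDiff_fderiv_apply hφ v).differentiable (by simp) x)]

lemma levi_sum {ι : Type*} [Fintype ι] {φ : E → ℝ} (hφ : ContDiff ℝ ∞ φ) (x : E)
    (c : ι → ℂ) (e : ι → E) :
    ∑ j, ∑ k, db (e k) (dd (e j) (fun y => (φ y : ℂ))) x * c j * conj (c k) =
      ((levi φ x (∑ j, c j • e j) / 4 : ℝ) : ℂ) := by
  set f : E → ℂ := fun y => (φ y : ℂ) with hf
  have hc : ContDiff ℝ ∞ f := Complex.ofRealCLM.contDiff.comp hφ
  set v := ∑ j, c j • e j with hv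
  have h1 : ∀ j, ∑ k, db (e k) (dd (e j) f) x * c j * conj (c k)
      = c j * dd (e j) (db v f) x := by
    intro j
    rw [← db_dd_comm hc, hv, db_dir_sum, Finset.mul_sum]
    refine Finset.sum_congr rfl fun k _ => by ring
  simp_rw [h1]
  rw [← dd_dir_sum, ← hv]
  rw [dd, fderiv_db hc, fderiv_db hc]
  simp only [hf, fderiv2_ofReal hφ, levi]
  rw [snd_symm hφ x v (Complex.I • v)]
  push_cast
  linear_combination (-(fderiv ℝ (fderiv ℝ φ) x (Complex.I • v) (Complex.I • v) : ℂ) / 4)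
    * Complex.I_sq

end Calc
end SC

namespace SC
open MeasureTheory Filter
open scoped ContDiff ComplexConjugate

set_option linter.unusedSectionVars false
section Basic
variable {E : Type*} [NormedAddCommGroup E] [NormedSpace ℂ E] [FiniteDimensional ℂ E]
  [MeasurableSpace E] [BorelSpace E] (μ : Measure E) [μ.IsAddHaarMeasure]

lemma hcs_of_tsupport {f g : E → ℂ} (hf : HasCompactSupport f) (h : tsupport g ⊆ tsupport f) :
    HasCompactSupport g := hf.of_isClosed_subset (isClosed_tsupport g) h

lemma integral_fderiv_zero {f : E → ℂ} (hf : ContDiff ℝ ∞ f) (hc : HasCompactSupport f) (v : E) :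
    ∫ x, fderiv ℝ f x v ∂μ = 0 := by
  have : FiniteDimensional ℝ E := FiniteDimensional.complexToReal E
  have hi : Integrable (fun x => fderiv ℝ f x v) μ := by
    apply (contDiff_fderiv_apply hf v).continuous.integrable_of_hasCompactSupport
    exact hcs_of_tsupport hc (closure_minimal (tsupport_fderiv_apply v) (isClosed_tsupport f))
  have h := integral_mul_fderiv_eq_neg_fderiv_mul_of_integrable (𝕜 := ℂ) (μ := μ)
    (f := fun _ => (1:ℂ)) (g := f) (v := v) (by simp) (by simpa using hi)
    (by simpa using hf.continuous.integrable_of_hasCompactSupport hc) (fun x _ => by fun_prop)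
    (fun x _ => hf.differentiable (by simp) x)
  simpa using h

lemma integrable_fderiv {f : E → ℂ} (hf : ContDiff ℝ ∞ f) (hc : HasCompactSupport f) (v : E) :
    Integrable (fun x => fderiv ℝ f x v) μ := by
  have : FiniteDimensional ℝ E := FiniteDimensional.complexToReal E
  apply (contDiff_fderiv_apply hf v).continuous.integrable_of_hasCompactSupport
  exact hcs_of_tsupport hc (closure_minimal (tsupport_fderiv_apply v) (isClosed_tsupport f))

lemma integral_db_zero {f : E → ℂ} (hf : ContDiff ℝ ∞ f) (hc : HasCompactSupport f) (v : E) :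
    ∫ x, db v f x ∂μ = 0 := by
  simp only [db]
  rw [integral_div, integral_add (integrable_fderiv μ hf hc v)
    ((integrable_fderiv μ hf hc _).const_mul _), integral_const_mul,
    integral_fderiv_zero μ hf hc, integral_fderiv_zero μ hf hc]
  simp

lemma integral_dd_zero {f : E → ℂ} (hf : ContDiff ℝ ∞ f) (hc : HasCompactSupport f) (v : E) :
    ∫ x, dd v f x ∂μ = 0 := by
  simp only [dd]
  rw [integral_div, integral_sub (integrable_fderiv μ hf hc v)
    ((integrable_fderiv μ hf hc _).const_mul _), integral_const_mul,
    integral_fderiv_zero μ hf hc, integral_fderiv_zero μ hf hc]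
  simp

lemma integrable_db {f : E → ℂ} (hf : ContDiff ℝ ∞ f) (hc : HasCompactSupport f) (v : E) :
    Integrable (db v f) μ := by
  have : FiniteDimensional ℝ E := FiniteDimensional.complexToReal E
  exact (contDiff_db hf v).continuous.integrable_of_hasCompactSupport
    (hcs_of_tsupport hc (tsupport_db_subset v))

lemma integrable_dd {f : E → ℂ} (hf : ContDiff ℝ ∞ f) (hc : HasCompactSupport f) (v : E) :
    Integrable (dd v f) μ := by
  have : FiniteDimensional ℝ E := FiniteDimensional.complexToReal E
  exact (contDiff_dd hf v).continuous.integrable_of_hasCompactSupport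
    (hcs_of_tsupport hc (tsupport_dd_subset v))

variable {ι : Type*} [Fintype ι]

/-- weight -/
def wt (φ : E → ℝ) (x : E) : ℂ := ((Real.exp (-φ x) : ℝ) : ℂ)

/-- weighted derivative -/
def Dw (φ : E → ℝ) (v : E) (f : E → ℂ) (x : E) : ℂ :=
  dd v f x - dd v (fun y => (φ y : ℂ)) x * f x

lemma contDiff_wt {φ : E → ℝ} (hφ : ContDiff ℝ ∞ φ) : ContDiff ℝ ∞ (wt φ) :=
  Complex.ofRealCLM.contDiff.comp (Real.contDiff_exp.comp hφ.neg)

lemma contDiff_Dw {φ : E → ℝ} (hφ : ContDiff ℝ ∞ φ) {f : E → ℂ} (hf : ContDiff ℝ ∞ f) (v : E) :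
    ContDiff ℝ ∞ (Dw φ v f) :=
  (contDiff_dd hf v).sub ((contDiff_dd (Complex.ofRealCLM.contDiff.comp hφ) v).mul hf)

lemma dd_wt {φ : E → ℝ} (hφ : ContDiff ℝ ∞ φ) (v x : E) :
    dd v (wt φ) x = - dd v (fun y => (φ y : ℂ)) x * wt φ x := by
  have h : HasDerivAt (fun t => Real.exp (-t)) (-Real.exp (-φ x)) (φ x) := by
    have := (hasDerivAt_neg (φ x)).exp
    convert this using 1; ring
  have := dd_real_comp (hφ.differentiable (by simp) x) h v
  change dd v (wt φ) x = _ at this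
  rw [this]; simp only [wt]; push_cast; ring

lemma dd_mul_wt {φ : E → ℝ} (hφ : ContDiff ℝ ∞ φ) {f : E → ℂ} (hf : ContDiff ℝ ∞ f) (v x : E) :
    dd v (fun y => f y * wt φ y) x = Dw φ v f x * wt φ x := by
  rw [dd_mul (hf.differentiable (by simp) x) ((contDiff_wt hφ).differentiable (by simp) x),
    dd_wt hφ, Dw]; ring

lemma conj_wt (φ : E → ℝ) (x : E) : conj (wt φ x) = wt φ x := by rw [wt, Complex.conj_ofReal]

lemma contDiff_conj {f : E → ℂ} (hf : ContDiff ℝ ∞ f) : ContDiff ℝ ∞ (fun x => conj (f x)) := by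
  exact Complex.conjCLE.toContinuousLinearMap.contDiff.comp hf

/-- first divergence term -/
lemma div1 {φ : E → ℝ} (hφ : ContDiff ℝ ∞ φ) {f g : E → ℂ} (hf : ContDiff ℝ ∞ f)
    (hg : ContDiff ℝ ∞ g) (v x : E) :
    db v (fun y => f y * conj (g y * wt φ y)) x =
      db v f x * conj (g x) * wt φ x + f x * conj (Dw φ v g x) * wt φ x := by
  have hgw : ContDiff ℝ ∞ (fun y => g y * wt φ y) := hg.mul (contDiff_wt hφ)
  rw [db_mul (hf.differentiable (by simp) x) ((contDiff_conj hgw).differentiable (by simp) x),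
    db_conj (hgw.differentiable (by simp) x), dd_mul_wt hφ hg, map_mul, map_mul, conj_wt]
  ring

/-- second divergence term -/
lemma div2 {φ : E → ℝ} (hφ : ContDiff ℝ ∞ φ) {f g : E → ℂ} (hf : ContDiff ℝ ∞ f)
    (hg : ContDiff ℝ ∞ g) (v x : E) :
    dd v (fun y => conj (g y) * (f y * wt φ y)) x =
      Dw φ v f x * conj (g x) * wt φ x + f x * conj (db v g x) * wt φ x := by
  have hgw : ContDiff ℝ ∞ (fun y => f y * wt φ y) := hf.mul (contDiff_wt hφ)
  rw [dd_mul ((contDiff_conj hg).differentiable (by simp) x) (hgw.differentiable (by simp) x),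
    dd_conj (hg.differentiable (by simp) x), dd_mul_wt hφ hf]
  ring

lemma commutator {φ : E → ℝ} (hφ : ContDiff ℝ ∞ φ) {f : E → ℂ} (hf : ContDiff ℝ ∞ f) (u v x : E) :
    db u (Dw φ v f) x = Dw φ v (db u f) x - db u (dd v (fun y => (φ y : ℂ))) x * f x := by
  have hc : ContDiff ℝ ∞ (fun y => (φ y : ℂ)) := Complex.ofRealCLM.contDiff.comp hφ
  have h1 := contDiff_dd hf v
  have h2 := contDiff_dd hc v
  have : Dw φ v f = fun y => dd v f y - dd v (fun y => (φ y : ℂ)) y * f y := rfl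
  rw [this, db_sub (h1.differentiable (by simp) x) ((h2.mul hf).differentiable (by simp) x),
    db_mul (h2.differentiable (by simp) x) (hf.differentiable (by simp) x), db_dd_comm hf, Dw]
  ring

/-- the integrated identity in divergence form -/
lemma basic_zero {φ : E → ℝ} (hφ : ContDiff ℝ ∞ φ) (e : ι → E) (α : ι → E → ℂ)
    (hα : ∀ j, ContDiff ℝ ∞ (α j)) (hc : ∀ j, HasCompactSupport (α j)) :
    ∫ x, (∑ j, ∑ k, (Dw φ (e j) (α j) x * conj (Dw φ (e k) (α k) x)
      - db (e k) (dd (e j) (fun y => (φ y : ℂ))) x * α j x * conj (α k x)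
      - db (e k) (α j) x * conj (db (e j) (α k) x)) * wt φ x) ∂μ = 0 := by
  have key : ∀ x, (∑ j, ∑ k, (Dw φ (e j) (α j) x * conj (Dw φ (e k) (α k) x)
      - db (e k) (dd (e j) (fun y => (φ y : ℂ))) x * α j x * conj (α k x)
      - db (e k) (α j) x * conj (db (e j) (α k) x)) * wt φ x) =
      ∑ j, ∑ k, (db (e k) (fun y => Dw φ (e j) (α j) y * conj (α k y * wt φ y)) x
        - dd (e j) (fun y => conj (α k y) * (db (e k) (α j) y * wt φ y)) x) := by
    intro x
    refine Finset.sum_congr rfl fun j _ => Finset.sum_congr rfl fun k _ => ?_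
    rw [div1 hφ (contDiff_Dw hφ (hα j) _) (hα k), div2 hφ (contDiff_db (hα j) _) (hα k),
      commutator hφ (hα j)]
    ring
  simp_rw [key]
  have s1 : ∀ j k, ContDiff ℝ ∞ (fun y => Dw φ (e j) (α j) y * conj (α k y * wt φ y)) :=
    fun j k => (contDiff_Dw hφ (hα j) _).mul (contDiff_conj ((hα k).mul (contDiff_wt hφ)))
  have s2 : ∀ j k, ContDiff ℝ ∞ (fun y => conj (α k y) * (db (e k) (α j) y * wt φ y)) :=
    fun j k => (contDiff_conj (hα k)).mul ((contDiff_db (hα j) _).mul (contDiff_wt hφ))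
  have c1 : ∀ j k, HasCompactSupport (fun y => Dw φ (e j) (α j) y * conj (α k y * wt φ y)) := by
    intro j k
    apply (hc k).mono
    intro x hx h0
    apply hx
    simp [h0]
  have c2 : ∀ j k, HasCompactSupport (fun y => conj (α k y) * (db (e k) (α j) y * wt φ y)) := by
    intro j k
    apply (hc k).mono
    intro x hx h0
    apply hx
    simp [h0]
  have i0 : ∀ j k, Integrable (fun x =>
      db (e k) (fun y => Dw φ (e j) (α j) y * conj (α k y * wt φ y)) x
        - dd (e j) (fun y => conj (α k y) * (db (e k) (α j) y * wt φ y)) x) μ := fun j k =>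
    (integrable_db μ (s1 j k) (c1 j k) _).sub (integrable_dd μ (s2 j k) (c2 j k) _)
  rw [integral_finsetSum _ (fun j _ => integrable_finsetSum _ fun k _ => i0 j k)]
  refine Finset.sum_eq_zero fun j _ => ?_
  rw [integral_finsetSum _ (fun k _ => i0 j k)]
  refine Finset.sum_eq_zero fun k _ => ?_
  rw [integral_sub (integrable_db μ (s1 j k) (c1 j k) _) (integrable_dd μ (s2 j k) (c2 j k) _),
    integral_db_zero μ (s1 j k) (c1 j k), integral_dd_zero μ (s2 j k) (c2 j k), sub_zero]

/-- pointwise rewriting of the integrand as a real quantity -/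
lemma pointwise_real (A : ι → ι → ℂ) (d : ι → ℂ) :
    (∑ j, ∑ k, (d j * conj (d k) - A k j * conj (A j k))) =
      ((‖∑ j, d j‖ ^ 2 - ∑ j, ∑ k, ‖A j k‖ ^ 2 +
        (1 / 2) * ∑ j, ∑ k, ‖A j k - A k j‖ ^ 2 : ℝ) : ℂ) := by
  have h0 : ∀ z : ℂ, ((‖z‖ ^ 2 : ℝ) : ℂ) = z * conj z := fun z => by
    rw [Complex.mul_conj, Complex.normSq_eq_norm_sq]
  push_cast
  simp only [← Complex.ofReal_pow, h0]
  simp only [Finset.sum_sub_distrib, map_sub, map_sum, sub_mul, mul_sub, Finset.sum_mul_sum]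
  have hc : ∑ j, ∑ k, A k j * conj (A k j) = ∑ j, ∑ k, A j k * conj (A j k) := Finset.sum_comm
  have hd : ∑ j, ∑ k, A j k * conj (A k j) = ∑ j, ∑ k, A k j * conj (A j k) := Finset.sum_comm
  rw [hc, hd]; ring

lemma norm_sum_mul_sq_le (a b : ι → ℂ) :
    ‖∑ j, a j * b j‖ ^ 2 ≤ (∑ j, ‖a j‖ ^ 2) * ∑ j, ‖b j‖ ^ 2 := by
  calc ‖∑ j, a j * b j‖ ^ 2 ≤ (∑ j, ‖a j‖ * ‖b j‖) ^ 2 := by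
        gcongr
        refine (norm_sum_le _ _).trans (by simp)
    _ ≤ _ := Finset.sum_mul_sq_le_sq_mul_sq _ _ _

/-- The basic estimate for smooth compactly supported forms. -/
lemma basic_estimate {φ : E → ℝ} (hφ : ContDiff ℝ ∞ φ) (e : ι → E) (α : ι → E → ℂ)
    (hα : ∀ j, ContDiff ℝ ∞ (α j)) (hc : ∀ j, HasCompactSupport (α j))
    (ψ : ι → E → ℂ) (hψ : ∀ j, Continuous (ψ j)) (q : E → ℝ) (hq : Continuous q)
    (hlevi : ∀ x, (∃ j, x ∈ tsupport (α j)) → ∀ c : ι → ℂ,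
      2 * ((∑ j, ‖ψ j x‖ ^ 2) + q x) * ∑ j, ‖c j‖ ^ 2 ≤ levi φ x (∑ j, c j • e j) / 4) :
    0 ≤ ∫ x, (2 * ‖∑ j, (Dw φ (e j) (α j) x + ψ j x * α j x)‖ ^ 2
      + (1 / 2) * ∑ j, ∑ k, ‖db (e j) (α k) x - db (e k) (α j) x‖ ^ 2
      - 2 * q x * ∑ j, ‖α j x‖ ^ 2) * Real.exp (-φ x) ∂μ := by
  have : FiniteDimensional ℝ E := FiniteDimensional.complexToReal E
  set R : E → ℝ := fun x => (‖∑ j, Dw φ (e j) (α j) x‖ ^ 2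
      - ∑ j, ∑ k, ‖db (e j) (α k) x‖ ^ 2
      + (1 / 2) * (∑ j, ∑ k, ‖db (e j) (α k) x - db (e k) (α j) x‖ ^ 2)
      - levi φ x (∑ j, α j x • e j) / 4) * Real.exp (-φ x) with hR
  have h0 : ∫ x, R x ∂μ = 0 := by
    have := basic_zero μ hφ e α hα hc
    have h1 : ∀ x, (∑ j, ∑ k, (Dw φ (e j) (α j) x * conj (Dw φ (e k) (α k) x)
      - db (e k) (dd (e j) (fun y => (φ y : ℂ))) x * α j x * conj (α k x)
      - db (e k) (α j) x * conj (db (e j) (α k) x)) * wt φ x) = (R x : ℂ) := by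
      intro x
      have e1 := pointwise_real (fun j k => db (e j) (α k) x) (fun j => Dw φ (e j) (α j) x)
      have e2 := levi_sum hφ x (fun j => α j x) e
      simp only [hR]
      rw [Complex.ofReal_mul, Complex.ofReal_sub, ← e1, ← e2]
      simp only [← Finset.sum_mul, ← Finset.sum_sub_distrib]
      congr 1
      refine Finset.sum_congr rfl fun j _ => Finset.sum_congr rfl fun k _ => ?_
      ring
    simp_rw [h1] at this
    rw [integral_complex_ofReal] at this
    exact_mod_cast this
  set K : Set E := ⋃ j, tsupport (α j) with hK
  have hKc : IsCompact K := isCompact_iUnion fun j => hc j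
  have out : ∀ x, x ∉ K → ∀ j, α j x = 0 ∧ (∀ v, db v (α j) x = 0) ∧ Dw φ (e j) (α j) x = 0 := by
    intro x hx j
    have hx' : x ∉ tsupport (α j) := fun h => hx (mem_iUnion.2 ⟨j, h⟩)
    have := image_eq_zero_of_notMem_tsupport hx'
    exact ⟨this, fun v => db_zero_of_notMem hx', by simp [Dw, this, dd_zero_of_notMem hx']⟩
  have cD : ∀ j, Continuous (Dw φ (e j) (α j)) := fun j => (contDiff_Dw hφ (hα j) _).continuous
  have cdb : ∀ j k, Continuous (db (e j) (α k)) := fun j k => (contDiff_db (hα k) _).continuous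
  have cα : ∀ j, Continuous (α j) := fun j => (hα j).continuous
  have clevi : Continuous (fun x => levi φ x (∑ j, α j x • e j)) := by
    unfold levi
    have h2 : Continuous (fderiv ℝ (fderiv ℝ φ)) :=
      ((hφ.fderiv_right (m := ∞) (by simp)).fderiv_right (m := ∞) (by simp)).continuous
    have h3 : Continuous (fun x => ∑ j, α j x • e j) := by fun_prop
    fun_prop
  have hce := hφ.continuous
  rw [← h0]
  apply integral_mono
  · apply Continuous.integrable_of_hasCompactSupport
    · simp only [hR]; fun_prop
    · apply HasCompactSupport.intro hKc
      intro x hx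
      have := out x hx
      simp [hR, this, levi]
  · apply Continuous.integrable_of_hasCompactSupport
    · fun_prop
    · apply HasCompactSupport.intro hKc
      intro x hx
      have := out x hx
      simp [this]
  · intro x
    simp only [hR]
    apply mul_le_mul_of_nonneg_right _ (Real.exp_pos _).le
    by_cases hx : x ∈ K
    · have hl := hlevi x (mem_iUnion.1 hx) (fun j => α j x)
      have h3 := norm_sum_mul_sq_le (fun j => ψ j x) (fun j => α j x)
      have h4 : ‖∑ j, Dw φ (e j) (α j) x‖ ^ 2 ≤
          2 * ‖∑ j, (Dw φ (e j) (α j) x + ψ j x * α j x)‖ ^ 2 + 2 * ‖∑ j, ψ j x * α j x‖ ^ 2 := by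
        rw [Finset.sum_add_distrib]
        have := norm_sub_le ((∑ j, Dw φ (e j) (α j) x) + ∑ j, ψ j x * α j x) (∑ j, ψ j x * α j x)
        rw [add_sub_cancel_right] at this
        have h5 := norm_nonneg (∑ j, Dw φ (e j) (α j) x)
        nlinarith [sq_nonneg (‖(∑ j, Dw φ (e j) (α j) x) + ∑ j, ψ j x * α j x‖ -
          ‖∑ j, ψ j x * α j x‖)]
      have h6 : 0 ≤ ∑ j, ∑ k, ‖db (e j) (α k) x‖ ^ 2 := by positivity
      nlinarith
    · have := out x hx
      simp [this, levi]

end Basic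
end SC

namespace SC
open MeasureTheory Filter
open scoped ContDiff ComplexConjugate ENNReal

set_option linter.unusedSectionVars false
set_option linter.style.haveILetI false
section Moll
variable {E : Type*} [NormedAddCommGroup E] [NormedSpace ℂ E] [FiniteDimensional ℂ E]
  [MeasurableSpace E] [BorelSpace E] (μ : Measure E) [μ.IsAddHaarMeasure]

/-- convolution -/
def mo (b g : E → ℂ) (x : E) : ℂ := ∫ t, b t * g (x - t) ∂μ

lemma mo_eq (b g : E → ℂ) : mo μ b g = convolution b g (ContinuousLinearMap.mul ℝ ℂ) μ := by
  ext x; simp [mo, convolution_def]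

lemma mo_integrable {b g : E → ℂ} (hb : LocallyIntegrable b μ) (hg : Continuous g)
    (hc : HasCompactSupport g) (x : E) : Integrable (fun t => b t * g (x - t)) μ := by
  have : FiniteDimensional ℝ E := FiniteDimensional.complexToReal E
  have := hc.convolutionExists_right (ContinuousLinearMap.mul ℝ ℂ) hb hg x
  simpa [ConvolutionExistsAt] using this

lemma mo_contDiff {b g : E → ℂ} (hb : LocallyIntegrable b μ) (hg : ContDiff ℝ ∞ g)
    (hc : HasCompactSupport g) : ContDiff ℝ ∞ (mo μ b g) := by
  have : FiniteDimensional ℝ E := FiniteDimensional.complexToReal E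
  rw [mo_eq]
  exact hc.contDiff_convolution_right _ hb hg

lemma mo_fderiv {b g : E → ℂ} (hb : LocallyIntegrable b μ) (hg : ContDiff ℝ ∞ g)
    (hc : HasCompactSupport g) (x v : E) :
    fderiv ℝ (mo μ b g) x v = mo μ b (fun y => fderiv ℝ g y v) x := by
  have : FiniteDimensional ℝ E := FiniteDimensional.complexToReal E
  rw [mo_eq, mo_eq,
    (hc.hasFDerivAt_convolution_right (ContinuousLinearMap.mul ℝ ℂ) hb
      (hg.of_le (by simp)) x).fderiv,
    convolution_precompR_apply _ hb (hc.fderiv (𝕜 := ℝ))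
      (hg.fderiv_right (m := ∞) (by simp)).continuous]

lemma mo_db {b g : E → ℂ} (hb : LocallyIntegrable b μ) (hg : ContDiff ℝ ∞ g)
    (hc : HasCompactSupport g) (x v : E) :
    db v (mo μ b g) x = mo μ b (db v g) x := by
  have hcd : ∀ v, HasCompactSupport (fun y => fderiv ℝ g y v) := fun v =>
    hcs_of_tsupport hc (closure_minimal (tsupport_fderiv_apply v) (isClosed_tsupport g))
  have i1 := fun v => mo_integrable μ hb (contDiff_fderiv_apply hg v).continuous (hcd v) x
  simp only [db, mo_fderiv μ hb hg hc]
  simp only [mo]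
  rw [← integral_const_mul, ← integral_add (i1 v) ((i1 _).const_mul _), ← integral_div]
  congr 1; ext t; simp only [db]; ring

lemma mo_dd {b g : E → ℂ} (hb : LocallyIntegrable b μ) (hg : ContDiff ℝ ∞ g)
    (hc : HasCompactSupport g) (x v : E) :
    dd v (mo μ b g) x = mo μ b (dd v g) x := by
  have hcd : ∀ v, HasCompactSupport (fun y => fderiv ℝ g y v) := fun v =>
    hcs_of_tsupport hc (closure_minimal (tsupport_fderiv_apply v) (isClosed_tsupport g))
  have i1 := fun v => mo_integrable μ hb (contDiff_fderiv_apply hg v).continuous (hcd v) x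
  simp only [dd, mo_fderiv μ hb hg hc]
  simp only [mo]
  rw [← integral_const_mul, ← integral_sub (i1 v) ((i1 _).const_mul _), ← integral_div]
  congr 1; ext t; simp only [dd]; ring

lemma fderiv_refl {g : E → ℂ} (hg : ContDiff ℝ ∞ g) (x t v : E) :
    fderiv ℝ (fun y => g (x - y)) t v = - fderiv ℝ g (x - t) v := by
  have h1 : HasFDerivAt (fun y : E => x - y) (-ContinuousLinearMap.id ℝ E) t := by
    simpa using (hasFDerivAt_id t).const_sub x
  have := ((hg.differentiable (by simp) (x - t)).hasFDerivAt.comp t h1).fderiv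
  change fderiv ℝ (g ∘ fun y => x - y) t v = _
  rw [this]; simp

lemma db_refl {g : E → ℂ} (hg : ContDiff ℝ ∞ g) (x t v : E) :
    db v (fun y => g (x - y)) t = - db v g (x - t) := by
  simp only [db, fderiv_refl hg]; ring

lemma dd_refl {g : E → ℂ} (hg : ContDiff ℝ ∞ g) (x t v : E) :
    dd v (fun y => g (x - y)) t = - dd v g (x - t) := by
  simp only [dd, fderiv_refl hg]; ring

lemma refl_contDiff {g : E → ℂ} (hg : ContDiff ℝ ∞ g) (x : E) :
    ContDiff ℝ ∞ (fun y => g (x - y)) := hg.comp (contDiff_const.sub contDiff_id)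

lemma refl_hcs {g : E → ℂ} (hg : HasCompactSupport g) (x : E) :
    HasCompactSupport (fun y => g (x - y)) :=
  hg.comp_homeomorph (Homeomorph.subLeft x)

/-- standard bump functions -/
def bmp [FiniteDimensional ℝ E] (n : ℕ) : ContDiffBump (0 : E) :=
  ⟨1 / (2 * ((n : ℝ) + 1)), 1 / ((n : ℝ) + 1), by positivity, by
    apply one_div_lt_one_div_of_lt <;> linarith [(Nat.cast_nonneg n : (0:ℝ) ≤ n)]⟩

/-- mollifier -/
def rho (n : ℕ) (x : E) : ℂ :=
  letI : FiniteDimensional ℝ E := FiniteDimensional.complexToReal E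
  ((bmp (E := E) n).normed μ x : ℂ)

lemma rho_contDiff (n : ℕ) : ContDiff ℝ ∞ (rho μ n) := by
  letI : FiniteDimensional ℝ E := FiniteDimensional.complexToReal E
  exact Complex.ofRealCLM.contDiff.comp ((bmp (E := E) n).contDiff_normed (μ := μ))

lemma rho_support (n : ℕ) {x : E} (hx : 1 / ((n : ℝ) + 1) ≤ ‖x‖) : rho μ n x = 0 := by
  letI : FiniteDimensional ℝ E := FiniteDimensional.complexToReal E
  have h := (bmp (E := E) n).support_normed_eq (μ := μ)
  have : x ∉ Function.support ((bmp (E := E) n).normed μ) := by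
    rw [h]; simp [bmp]; simpa using hx
  simp [rho, Function.notMem_support.1 this]

lemma rho_hcs (n : ℕ) : HasCompactSupport (rho μ n) := by
  letI : FiniteDimensional ℝ E := FiniteDimensional.complexToReal E
  apply HasCompactSupport.intro (isCompact_closedBall (0 : E) (1 / ((n : ℝ) + 1)))
  intro x hx
  apply rho_support
  simp at hx; simpa using hx.le

lemma trans_cont {b : E → ℂ} (hb : MemLp b 2 μ) :
    Tendsto (fun t => eLpNorm (fun x => b (x - t) - b x) 2 μ) (𝓝 0) (𝓝 0) := by
  letI : FiniteDimensional ℝ E := FiniteDimensional.complexToReal E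
  have : Fact ((2:ℝ≥0∞) ≠ ⊤) := ⟨by simp⟩
  have hc : Continuous (fun t : E => (DomAddAct.mk (-t)) +ᵥ hb.toLp b) :=
    (DomAddAct.mkHomeomorph.continuous.comp continuous_neg).vadd continuous_const
  have h1 := (hc.tendsto 0).edist (tendsto_const_nhds (x := hb.toLp b))
  have h2 : ∀ t : E, edist ((DomAddAct.mk (-t)) +ᵥ hb.toLp b) (hb.toLp b) =
      eLpNorm (fun x => b (x - t) - b x) 2 μ := by
    intro t
    rw [DomAddAct.mk_vadd_toLp, Lp.edist_toLp_toLp]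
    congr 1; ext x; simp [neg_add_eq_sub]
  simp_rw [h2] at h1
  simpa using h1

lemma mo_sub_le_aux {b : E → ℂ} (hm : StronglyMeasurable b) (hb : MemLp b 2 μ) (n : ℕ) (η : ℝ≥0∞)
    (hη : ∀ t : E, ‖t‖ < 1 / ((n : ℝ) + 1) → eLpNorm (fun x => b (x - t) - b x) 2 μ ≤ η) :
    eLpNorm (fun x => mo μ b (rho μ n) x - b x) 2 μ ≤ η := by
  letI : FiniteDimensional ℝ E := FiniteDimensional.complexToReal E
  have hli : LocallyIntegrable b μ := hb.locallyIntegrable (by norm_num)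
  set r : E → ℝ := (bmp (E := E) n).normed μ with hr
  have hr0 : ∀ x, 0 ≤ r x := (bmp (E := E) n).nonneg_normed
  have hrc : Continuous r := (bmp (E := E) n).continuous_normed
  have hri : Integrable r μ := (bmp (E := E) n).integrable_normed
  have hr1 : ∫ x, r x ∂μ = 1 := (bmp (E := E) n).integral_normed
  set ν : Measure E := μ.withDensity (fun t => ENNReal.ofReal (r t)) with hν
  have hrm : Measurable (fun t => ENNReal.ofReal (r t)) := by fun_prop
  have hνp : IsProbabilityMeasure ν := by
    constructor
    rw [hν, withDensity_apply _ MeasurableSet.univ, Measure.restrict_univ,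
      ← ofReal_integral_eq_lintegral_ofReal hri (Eventually.of_forall hr0), hr1]
    simp
  have hsupp : ∀ t : E, ¬ ‖t‖ < 1 / ((n : ℝ) + 1) → r t = 0 := by
    intro t ht
    have := rho_support μ n (not_lt.1 ht)
    simpa [rho] using this
  -- pointwise formula
  have hpt : ∀ x, mo μ b (rho μ n) x - b x = ∫ t, (b (x - t) - b x) ∂ν := by
    intro x
    have e1 : mo μ b (rho μ n) x = ∫ t, (r t : ℂ) * b (x - t) ∂μ := by
      rw [mo, ← integral_sub_left_eq_self _ μ x]
      congr 1; ext t; simp only [sub_sub_cancel]; rw [mul_comm]; rfl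
    have i1 : Integrable (fun t => (r t : ℂ) * b (x - t)) μ := by
      have := (mo_integrable μ hli (rho_contDiff μ n).continuous (rho_hcs μ n) x).comp_sub_left x
      refine this.congr (Eventually.of_forall fun t => ?_)
      simp only [sub_sub_cancel]; rw [mul_comm]; rfl
    have i2 : Integrable (fun t => (r t : ℂ) * b x) μ := hri.ofReal.mul_const _
    rw [hν, integral_withDensity_eq_integral_toReal_smul hrm (by simp)]
    have e2 : ∀ t, (ENNReal.ofReal (r t)).toReal • (b (x - t) - b x) =
        (r t : ℂ) * b (x - t) - (r t : ℂ) * b x := by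
      intro t
      rw [ENNReal.toReal_ofReal (hr0 t), Complex.real_smul]; ring
    simp_rw [e2]
    rw [integral_sub i1 i2, e1, integral_mul_const, integral_complex_ofReal, hr1]
    simp
  have hsm : StronglyMeasurable (fun p : E × E => b (p.1 - p.2) - b p.1) := by
    apply StronglyMeasurable.sub
    · exact hm.comp_measurable (measurable_fst.sub measurable_snd)
    · exact hm.comp_measurable measurable_fst
  have sq : ∀ (ν' : Measure E) (f : E → ℂ), eLpNorm f 2 ν' ^ 2 = ∫⁻ x, ‖f x‖ₑ ^ 2 ∂ν' := by
    intro ν' f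
    rw [eLpNorm_eq_lintegral_rpow_enorm_toReal (by simp) (by simp)]
    rw [← ENNReal.rpow_natCast, ← ENNReal.rpow_mul]
    simp
  have hj : ∀ x, ‖mo μ b (rho μ n) x - b x‖ₑ ^ 2 ≤ ∫⁻ t, ‖b (x - t) - b x‖ₑ ^ 2 ∂ν := by
    intro x
    rw [hpt, ← sq]
    gcongr
    calc ‖∫ t, (b (x - t) - b x) ∂ν‖ₑ ≤ ∫⁻ t, ‖b (x - t) - b x‖ₑ ∂ν :=
          enorm_integral_le_lintegral_enorm _
      _ = eLpNorm (fun t => b (x - t) - b x) 1 ν := by rw [eLpNorm_one_eq_lintegral_enorm]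
      _ ≤ _ := eLpNorm_le_eLpNorm_of_exponent_le (by norm_num)
          (hsm.comp_measurable (measurable_prodMk_left)).aestronglyMeasurable
  have hfin : eLpNorm (fun x => mo μ b (rho μ n) x - b x) 2 μ ^ 2 ≤ η ^ 2 := by
    rw [sq]
    calc ∫⁻ x, ‖mo μ b (rho μ n) x - b x‖ₑ ^ 2 ∂μ
        ≤ ∫⁻ x, ∫⁻ t, ‖b (x - t) - b x‖ₑ ^ 2 ∂ν ∂μ := lintegral_mono hj
      _ = ∫⁻ t, ∫⁻ x, ‖b (x - t) - b x‖ₑ ^ 2 ∂μ ∂ν := by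
          apply lintegral_lintegral_swap
          exact (hsm.enorm.pow_const 2).aemeasurable
      _ ≤ ∫⁻ t, η ^ 2 ∂ν := by
          rw [hν, lintegral_withDensity_eq_lintegral_mul_non_measurable₀ _ hrm.aemeasurable (by simp),
            lintegral_withDensity_eq_lintegral_mul_non_measurable₀ _ hrm.aemeasurable (by simp)]
          apply lintegral_mono
          intro t
          by_cases ht : ‖t‖ < 1 / ((n : ℝ) + 1)
          · simp only [Pi.mul_apply]
            gcongr
            rw [← sq]
            gcongr
            exact hη t ht
          · simp [hsupp t ht]
      _ = η ^ 2 := by simp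
  exact (ENNReal.pow_le_pow_left_iff (by norm_num)).1 hfin

/-- convergence in `L²` -/
def L2lim (f : ℕ → E → ℂ) (g : E → ℂ) : Prop :=
  (∀ n, MemLp (f n) 2 μ) ∧ MemLp g 2 μ ∧ Tendsto (fun n => eLpNorm (f n - g) 2 μ) atTop (𝓝 0)

lemma mo_L2lim {b : E → ℂ} (hb : MemLp b 2 μ) : L2lim μ (fun n => mo μ b (rho μ n)) b := by
  letI : FiniteDimensional ℝ E := FiniteDimensional.complexToReal E
  have hli : LocallyIntegrable b μ := hb.locallyIntegrable (by norm_num)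
  have key : ∀ (n : ℕ) (η : ℝ≥0∞),
     (∀ t : E, ‖t‖ < 1 / ((n : ℝ) + 1) → eLpNorm (fun x => b (x - t) - b x) 2 μ ≤ η) →
     eLpNorm (mo μ b (rho μ n) - b) 2 μ ≤ η := by
    intro n η h
    set b' := hb.1.mk b with hb'
    have hbb : b =ᵐ[μ] b' := hb.1.ae_eq_mk
    have e1 : mo μ b (rho μ n) = mo μ b' (rho μ n) := by
      ext x
      apply integral_congr_ae
      filter_upwards [hbb] with t ht
      rw [ht]
    have e2 : eLpNorm (mo μ b (rho μ n) - b) 2 μ =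
        eLpNorm (fun x => mo μ b' (rho μ n) x - b' x) 2 μ := by
      apply eLpNorm_congr_ae
      filter_upwards [hbb] with x hx
      simp [e1, hx]
    rw [e2]
    apply mo_sub_le_aux μ hb.1.stronglyMeasurable_mk (hb.ae_eq hbb)
    intro t ht
    refine le_trans (le_of_eq ?_) (h t ht)
    apply eLpNorm_congr_ae
    have h3 : ∀ᵐ x ∂μ, b (x - t) = b' (x - t) :=
      (measurePreserving_sub_right μ t).quasiMeasurePreserving.ae hbb
    filter_upwards [hbb, h3] with x hx hx2
    rw [hx, hx2]
  have conv : Tendsto (fun n => eLpNorm (mo μ b (rho μ n) - b) 2 μ) atTop (𝓝 0) := by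
    rw [ENNReal.tendsto_nhds_zero]
    intro η hη
    have h1 := (ENNReal.tendsto_nhds_zero.1 (trans_cont μ hb)) η hη
    obtain ⟨δ, hδ, h2⟩ := Metric.eventually_nhds_iff.1 h1
    have h3 : ∀ᶠ n : ℕ in atTop, 1 / ((n : ℝ) + 1) < δ :=
      (tendsto_one_div_add_atTop_nhds_zero_nat).eventually (gt_mem_nhds hδ)
    filter_upwards [h3] with n hn
    exact key n η fun t ht => h2 (by simpa using ht.trans hn)
  refine ⟨fun n => ?_, hb, conv⟩
  have hfin : MemLp (mo μ b (rho μ n) - b) 2 μ := by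
    refine ⟨(mo_contDiff μ hli (rho_contDiff μ n) (rho_hcs μ n)).continuous.aestronglyMeasurable.sub
      hb.1, ?_⟩
    refine lt_of_le_of_lt (key n (eLpNorm b 2 μ + eLpNorm b 2 μ) ?_)
      (ENNReal.add_lt_top.2 ⟨hb.2, hb.2⟩)
    intro t ht
    have hmp := measurePreserving_sub_right μ t
    have := eLpNorm_sub_le (μ := μ) (p := 2) (f := fun x => b (x - t)) (g := b)
      (hb.comp_measurePreserving hmp).1 hb.1 (by norm_num)
    refine this.trans (le_of_eq ?_)
    congr 1
    exact eLpNorm_comp_measurePreserving hb.1 hmp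
  simpa using hfin.add hb

end Moll
end SC

namespace SC
open MeasureTheory Filter
open scoped ContDiff ComplexConjugate ENNReal

set_option linter.unusedSectionVars false
set_option linter.style.haveILetI false
section LemB
variable {E : Type*} [NormedAddCommGroup E] [NormedSpace ℂ E] [FiniteDimensional ℂ E]
  [MeasurableSpace E] [BorelSpace E] (μ : Measure E) [μ.IsAddHaarMeasure]

variable {μ}

lemma L2lim.add {f f' : ℕ → E → ℂ} {g g' : E → ℂ} (h : L2lim μ f g) (h' : L2lim μ f' g') :
    L2lim μ (fun n x => f n x + f' n x) (fun x => g x + g' x) := by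
  refine ⟨fun n => (h.1 n).add (h'.1 n), h.2.1.add h'.2.1, ?_⟩
  have h3 := Tendsto.add h.2.2 h'.2.2
  rw [add_zero] at h3
  refine tendsto_of_tendsto_of_tendsto_of_le_of_le tendsto_const_nhds h3 (fun _ => zero_le) ?_
  intro n
  have := eLpNorm_add_le (μ := μ) (p := 2) ((h.1 n).sub h.2.1).1 ((h'.1 n).sub h'.2.1).1
    (by norm_num)
  have e : ((fun x => f n x + f' n x) - fun x => g x + g' x) = (f n - g) + (f' n - g') := by
    ext x; simp only [Pi.sub_apply, Pi.add_apply]; ring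
  calc eLpNorm ((fun x => f n x + f' n x) - fun x => g x + g' x) 2 μ
      = eLpNorm ((f n - g) + (f' n - g')) 2 μ := by rw [e]
    _ ≤ _ := this

lemma L2lim.zero : L2lim μ (fun _ _ => (0:ℂ)) (fun _ => 0) := by
  refine ⟨fun n => MemLp.zero, MemLp.zero, ?_⟩
  have : ((fun _ => 0 : E → ℂ) - fun _ => 0) = (0 : E → ℂ) := by ext; simp
  simp only [this]; simp

lemma L2lim.sum {ι : Type*} (s : Finset ι) {f : ι → ℕ → E → ℂ} {g : ι → E → ℂ}
    (h : ∀ i, L2lim μ (f i) (g i)) :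
    L2lim μ (fun n x => ∑ i ∈ s, f i n x) (fun x => ∑ i ∈ s, g i x) := by
  classical
  induction s using Finset.induction_on with
  | empty => simpa using L2lim.zero
  | insert a s ha ih => simpa [Finset.sum_insert ha] using (h a).add ih

lemma memLp_mul_cont {g : E → ℂ} (hg : MemLp g 2 μ) {a : E → ℂ} (ha : Continuous a) {K : Set E}
    (hK : IsCompact K) (hgK : ∀ x, x ∉ K → g x = 0) : MemLp (fun x => a x * g x) 2 μ := by
  obtain ⟨C, hC⟩ := hK.exists_bound_of_continuousOn ha.continuousOn
  refine hg.of_le_mul (c := C) (ha.aestronglyMeasurable.mul hg.1) (Eventually.of_forall fun x => ?_)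
  by_cases hx : x ∈ K
  · rw [norm_mul]; gcongr; exact hC x hx
  · simp [hgK x hx]

lemma L2lim.mul_cont {f : ℕ → E → ℂ} {g : E → ℂ} (h : L2lim μ f g) {a : E → ℂ}
    (ha : Continuous a) {K : Set E} (hK : IsCompact K) (hf : ∀ n x, x ∉ K → f n x = 0)
    (hgK : ∀ x, x ∉ K → g x = 0) :
    L2lim μ (fun n x => a x * f n x) (fun x => a x * g x) := by
  refine ⟨fun n => memLp_mul_cont (h.1 n) ha hK (hf n), memLp_mul_cont h.2.1 ha hK hgK, ?_⟩
  obtain ⟨C, hC⟩ := hK.exists_bound_of_continuousOn ha.continuousOn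
  have h3 : Tendsto (fun n => ENNReal.ofReal C * eLpNorm (f n - g) 2 μ) atTop (𝓝 0) := by
    simpa using ENNReal.Tendsto.const_mul h.2.2 (Or.inr ENNReal.ofReal_ne_top)
  refine tendsto_of_tendsto_of_tendsto_of_le_of_le tendsto_const_nhds h3 (fun _ => zero_le) ?_
  intro n
  apply eLpNorm_le_mul_eLpNorm_of_ae_le_mul
  refine Eventually.of_forall fun x => ?_
  simp only [Pi.sub_apply, ← mul_sub, norm_mul]
  by_cases hx : x ∈ K
  · gcongr; exact hC x hx
  · simp [hf n x hx, hgK x hx]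

lemma integral_norm_sq_eq {g : E → ℂ} (hg : MemLp g 2 μ) :
    ∫ x, ‖g x‖ ^ 2 ∂μ = (eLpNorm g 2 μ).toReal ^ 2 := by
  rw [hg.eLpNorm_eq_integral_rpow_norm (by simp) (by simp)]
  have : 0 ≤ ∫ x, ‖g x‖ ^ (2:ℝ) ∂μ := integral_nonneg fun x => by positivity
  rw [ENNReal.toReal_ofReal (by positivity), ← Real.rpow_natCast, ← Real.rpow_mul (by simpa using this)]
  simp

lemma L2lim.integral {f : ℕ → E → ℂ} {g : E → ℂ} (h : L2lim μ f g) :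
    Tendsto (fun n => ∫ x, ‖f n x‖ ^ 2 ∂μ) atTop (𝓝 (∫ x, ‖g x‖ ^ 2 ∂μ)) := by
  have e1 : ∀ n, ∫ x, ‖f n x‖ ^ 2 ∂μ = ‖(h.1 n).toLp (f n)‖ ^ 2 := fun n => by
    rw [integral_norm_sq_eq (h.1 n), Lp.norm_toLp]
  have e2 : ∫ x, ‖g x‖ ^ 2 ∂μ = ‖h.2.1.toLp g‖ ^ 2 := by
    rw [integral_norm_sq_eq h.2.1, Lp.norm_toLp]
  simp_rw [e1, e2]
  refine Tendsto.pow (Tendsto.norm ?_) 2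
  rw [tendsto_iff_edist_tendsto_0]
  simp_rw [Lp.edist_toLp_toLp]
  exact h.2.2

lemma L2lim.congr {f f' : ℕ → E → ℂ} {g : E → ℂ} (h : L2lim μ f g) (hf : ∀ n x, f n x = f' n x) :
    L2lim μ f' g := by
  have : f = f' := by ext n x; exact hf n x
  rwa [← this]

lemma mo_zero_off {b : E → ℂ} {K : Set E} (hb : ∀ x, x ∉ K → b x = 0) (n : ℕ) {x : E}
    (hx : x ∉ Metric.cthickening (1 / ((n : ℝ) + 1)) K) : mo μ b (rho μ n) x = 0 := by
  rw [mo]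
  apply integral_eq_zero_of_ae
  refine Eventually.of_forall fun t => ?_
  by_cases ht : t ∈ K
  · have : rho μ n (x - t) = 0 := by
      apply rho_support
      by_contra h
      apply hx
      apply Metric.mem_cthickening_of_dist_le x t _ K ht
      rw [dist_eq_norm]; exact (not_le.1 h).le
    simp [this]
  · simp [hb t ht]

variable {ι : Type*} [Fintype ι]
variable (μ)

lemma lemma_B {φ : E → ℝ} (hφ : ContDiff ℝ ∞ φ) (e : ι → E) (b : ι → E → ℂ) (h : E → ℂ)
    (c : ι → ι → E → ℂ) (hb : ∀ j, MemLp (b j) 2 μ) (hh : MemLp h 2 μ)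
    (hc : ∀ j k, MemLp (c j k) 2 μ) {K V : Set E} (hK : IsCompact K) (hV : IsOpen V) (hKV : K ⊆ V)
    (hbK : ∀ j x, x ∉ K → b j x = 0) (hhK : ∀ x, x ∉ K → h x = 0)
    (hcK : ∀ j k x, x ∉ K → c j k x = 0)
    (w1 : ∀ γ : E → ℂ, ContDiff ℝ ∞ γ → HasCompactSupport γ →
      ∑ j, ∫ x, b j x * dd (e j) γ x ∂μ = - ∫ x, h x * γ x ∂μ)
    (w2 : ∀ j k, ∀ γ : E → ℂ, ContDiff ℝ ∞ γ → HasCompactSupport γ →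
      ∫ x, b k x * db (e j) γ x ∂μ - ∫ x, b j x * db (e k) γ x ∂μ = - ∫ x, c j k x * γ x ∂μ)
    (ψ : ι → E → ℂ) (hψ : ∀ j, Continuous (ψ j)) (q : E → ℝ) (hq : Continuous q)
    (hlevi : ∀ x ∈ V, ∀ c : ι → ℂ,
      2 * ((∑ j, ‖ψ j x‖ ^ 2) + q x ^ 2) * ∑ j, ‖c j‖ ^ 2 ≤ levi φ x (∑ j, c j • e j) / 4)
    (W : E → ℂ) (hW : W = fun x => ((Real.exp (-φ x / 2) : ℝ) : ℂ)) :
    2 * ∑ j, ∫ x, ‖(q x : ℂ) * (W x * b j x)‖ ^ 2 ∂μ ≤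
      2 * ∫ x, ‖W x * (h x + ∑ j, (ψ j x - dd (e j) (fun y => (φ y : ℂ)) x) * b j x)‖ ^ 2 ∂μ
      + (1 / 2) * ∑ j, ∑ k, ∫ x, ‖W x * c j k x‖ ^ 2 ∂μ := by
  have fdr : FiniteDimensional ℝ E := FiniteDimensional.complexToReal E
  have hli : ∀ j, LocallyIntegrable (b j) μ := fun j => (hb j).locallyIntegrable (by norm_num)
  set K1 := Metric.cthickening 1 K with hK1
  have hK1c : IsCompact K1 := hK.cthickening
  have hthick : ∀ n : ℕ, Metric.cthickening (1 / ((n : ℝ) + 1)) K ⊆ K1 := fun n =>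
    Metric.cthickening_mono (by
      rw [div_le_one (by positivity)]; linarith [(Nat.cast_nonneg n : (0:ℝ) ≤ n)]) K
  have hKK1 : K ⊆ K1 := Metric.self_subset_cthickening K
  set α : ℕ → ι → E → ℂ := fun n j => mo μ (b j) (rho μ n) with hα
  have hαs : ∀ n j, ContDiff ℝ ∞ (α n j) := fun n j =>
    mo_contDiff μ (hli j) (rho_contDiff μ n) (rho_hcs μ n)
  have offm : ∀ (f : E → ℂ), (∀ x, x ∉ K → f x = 0) → ∀ n x, x ∉ K1 → mo μ f (rho μ n) x = 0 :=
    fun f hf n x hx => mo_zero_off hf n (fun h => hx (hthick n h))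
  have hαc : ∀ n j, HasCompactSupport (α n j) := fun n j =>
    HasCompactSupport.intro hK1c (offm _ (hbK j) n)
  have offK1 : ∀ (f : E → ℂ), (∀ x, x ∉ K → f x = 0) → ∀ x, x ∉ K1 → f x = 0 :=
    fun f hf x hx => hf x (fun h => hx (hKK1 h))
  have cW : Continuous W := by
    have := hφ.continuous
    rw [hW]; fun_prop
  have nW : ∀ x, ‖W x‖ ^ 2 = Real.exp (-φ x) := by
    intro x
    rw [hW]; simp only [Complex.norm_real, Real.norm_eq_abs, Real.abs_exp, ← Real.exp_nat_mul]
    congr 1; push_cast; ring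
  -- derivative identities
  have d1 : ∀ n x, ∑ j, dd (e j) (α n j) x = mo μ h (rho μ n) x := by
    intro n x
    have := w1 (fun y => rho μ n (x - y)) (refl_contDiff (rho_contDiff μ n) x)
      (refl_hcs (rho_hcs μ n) x)
    simp only [hα, mo_dd μ (hli _) (rho_contDiff μ n) (rho_hcs μ n)]
    simp only [mo]
    rw [eq_neg_iff_add_eq_zero, add_comm, ← eq_neg_iff_add_eq_zero] at this
    rw [this, ← Finset.sum_neg_distrib]
    refine Finset.sum_congr rfl fun j _ => ?_
    rw [← integral_neg]
    congr 1; ext t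
    rw [dd_refl (rho_contDiff μ n)]; ring
  have d2 : ∀ n x j k, db (e j) (α n k) x - db (e k) (α n j) x = mo μ (c j k) (rho μ n) x := by
    intro n x j k
    have := w2 j k (fun y => rho μ n (x - y)) (refl_contDiff (rho_contDiff μ n) x)
      (refl_hcs (rho_hcs μ n) x)
    simp only [hα, mo_db μ (hli _) (rho_contDiff μ n) (rho_hcs μ n)]
    simp only [mo]
    simp only [db_refl (rho_contDiff μ n), mul_neg, integral_neg] at this
    linear_combination (-1 : ℂ) * this
  -- limits
  have Lb : ∀ j, L2lim μ (fun n => α n j) (b j) := fun j => mo_L2lim μ (hb j)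
  have cφ : ∀ j, Continuous (dd (e j) (fun y => (φ y : ℂ))) := fun j =>
    (contDiff_dd (Complex.ofRealCLM.contDiff.comp hφ) _).continuous
  have L1 : L2lim μ (fun n x => W x * (mo μ h (rho μ n) x
      + ∑ j, (ψ j x - dd (e j) (fun y => (φ y : ℂ)) x) * α n j x))
      (fun x => W x * (h x + ∑ j, (ψ j x - dd (e j) (fun y => (φ y : ℂ)) x) * b j x)) := by
    refine L2lim.mul_cont (L2lim.add (mo_L2lim μ hh) (L2lim.sum _ fun j =>
      (Lb j).mul_cont ((hψ j).sub (cφ j)) hK1c (fun n => offm _ (hbK j) n) (offK1 _ (hbK j))))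
      cW hK1c ?_ ?_
    · intro n x hx
      have h1 := offm _ hhK n x hx
      have h2 := fun j => offm _ (hbK j) n x hx
      simp [h1, hα, h2]
    · intro x hx
      have h1 := offK1 _ hhK x hx
      have h2 := fun j => offK1 _ (hbK j) x hx
      simp [h1, h2]
  have L2 : ∀ j k, L2lim μ (fun n x => W x * mo μ (c j k) (rho μ n) x) (fun x => W x * c j k x) :=
    fun j k => (mo_L2lim μ (hc j k)).mul_cont cW hK1c (offm _ (hcK j k)) (offK1 _ (hcK j k))
  have L3 : ∀ j, L2lim μ (fun n x => (q x : ℂ) * (W x * α n j x))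
      (fun x => (q x : ℂ) * (W x * b j x)) := by
    intro j
    refine L2lim.mul_cont ((Lb j).mul_cont cW hK1c (fun n => offm _ (hbK j) n) (offK1 _ (hbK j)))
      (by fun_prop) hK1c ?_ ?_
    · intro n x hx
      have h2 := offm _ (hbK j) n x hx
      simp [hα, h2]
    · intro x hx
      have h2 := offK1 _ (hbK j) x hx
      simp [h2]
  have lim1 := L1.integral
  have lim2 := tendsto_finsetSum Finset.univ fun j _ => tendsto_finsetSum Finset.univ
    fun k _ => (L2 j k).integral
  have lim3 := tendsto_finsetSum Finset.univ fun j _ => (L3 j).integral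
  refine le_of_tendsto_of_tendsto (lim3.const_mul 2)
    ((lim1.const_mul 2).add (lim2.const_mul (1 / 2))) ?_
  obtain ⟨δ, hδ, hδV⟩ := hK.exists_cthickening_subset_open hV hKV
  have h3 : ∀ᶠ n : ℕ in atTop, 1 / ((n : ℝ) + 1) < δ :=
    (tendsto_one_div_add_atTop_nhds_zero_nat).eventually (gt_mem_nhds hδ)
  filter_upwards [h3] with n hn
  have hsupp : ∀ j, tsupport (α n j) ⊆ V := by
    intro j
    have : tsupport (α n j) ⊆ Metric.cthickening (1 / ((n : ℝ) + 1)) K := by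
      apply closure_minimal _ Metric.isClosed_cthickening
      intro x hx
      by_contra h
      exact hx (mo_zero_off (hbK j) n h)
    exact this.trans ((Metric.cthickening_mono hn.le K).trans hδV)
  have main := basic_estimate μ hφ e (α n) (hαs n) (hαc n) ψ hψ (fun x => q x ^ 2) (hq.pow 2)
    (fun x ⟨j, hx⟩ => hlevi x (hsupp j hx))
  have isq : ∀ f : ℕ → E → ℂ, ∀ g, L2lim μ f g → Integrable (fun x => ‖f n x‖ ^ 2) μ := by
    intro f g hfg
    exact (memLp_two_iff_integrable_sq_norm (hfg.1 n).1).1 (hfg.1 n)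
  have i1 := isq _ _ L1
  have i2 := fun j k => isq _ _ (L2 j k)
  have i3 := fun j => isq _ _ (L3 j)
  have eq : ∀ x, (2 * ‖∑ j, (Dw φ (e j) (α n j) x + ψ j x * α n j x)‖ ^ 2
      + (1 / 2) * ∑ j, ∑ k, ‖db (e j) (α n k) x - db (e k) (α n j) x‖ ^ 2
      - 2 * q x ^ 2 * ∑ j, ‖α n j x‖ ^ 2) * Real.exp (-φ x) =
      2 * ‖W x * (mo μ h (rho μ n) x
        + ∑ j, (ψ j x - dd (e j) (fun y => (φ y : ℂ)) x) * α n j x)‖ ^ 2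
      + (1 / 2) * ∑ j, ∑ k, ‖W x * mo μ (c j k) (rho μ n) x‖ ^ 2
      - 2 * ∑ j, ‖(q x : ℂ) * (W x * α n j x)‖ ^ 2 := by
    intro x
    have e1 : ∑ j, (Dw φ (e j) (α n j) x + ψ j x * α n j x) = mo μ h (rho μ n) x
        + ∑ j, (ψ j x - dd (e j) (fun y => (φ y : ℂ)) x) * α n j x := by
      rw [← d1, ← Finset.sum_add_distrib]
      refine Finset.sum_congr rfl fun j _ => ?_
      simp only [Dw]; ring
    rw [e1]
    simp only [d2, norm_mul, mul_pow, nW, ← Finset.mul_sum, Complex.norm_real, Real.norm_eq_abs,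
      sq_abs]
    ring
  simp_rw [eq] at main
  have j2 : Integrable (fun x => (1 / 2) * ∑ j, ∑ k, ‖W x * mo μ (c j k) (rho μ n) x‖ ^ 2) μ :=
    (integrable_finsetSum _ fun j _ => integrable_finsetSum _ fun k _ => i2 j k).const_mul _
  have j3 : Integrable (fun x => 2 * ∑ j, ‖(q x : ℂ) * (W x * α n j x)‖ ^ 2) μ :=
    (integrable_finsetSum _ fun j _ => i3 j).const_mul _
  have j1 := i1.const_mul 2
  rw [integral_sub (by exact j1.add j2) j3, integral_add j1 j2, integral_const_mul,
    integral_const_mul, integral_const_mul,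
    integral_finsetSum _ (fun j _ => integrable_finsetSum _ fun k _ => i2 j k),
    integral_finsetSum _ (fun j _ => i3 j)] at main
  have e5 : ∀ j, ∫ x, ∑ k, ‖W x * mo μ (c j k) (rho μ n) x‖ ^ 2 ∂μ =
      ∑ k, ∫ x, ‖W x * mo μ (c j k) (rho μ n) x‖ ^ 2 ∂μ := fun j =>
    integral_finsetSum _ (fun k _ => i2 j k)
  simp_rw [e5] at main
  linarith

end LemB
end SC

namespace SC
open MeasureTheory Filter
open scoped ContDiff ComplexConjugate ENNReal
set_option linter.unusedSectionVars false
set_option linter.style.haveILetI false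

section Weights
variable {E : Type*} [NormedAddCommGroup E] [NormedSpace ℂ E] [FiniteDimensional ℂ E]
  [MeasurableSpace E] [BorelSpace E] (μ : Measure E) [μ.IsAddHaarMeasure]
variable {ι : Type*} [Fintype ι]

lemma exists_sigma {c : ℝ} (hc : c < 1) : ∃ σ : ℝ → ℝ, ContDiff ℝ ∞ σ ∧
    ∀ t ≤ c, σ t = 1 / (1 - t) := by
  set d := (1 - c) / 2 with hd
  have hd0 : 0 < d := by rw [hd]; linarith
  refine ⟨fun t => Real.smoothTransition ((1 - t) / d - 1) / (1 - t), ?_, ?_⟩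
  · rw [contDiff_iff_contDiffAt]
    intro t
    rcases lt_or_ge t 1 with h | h
    · apply ContDiffAt.div
      · exact (Real.smoothTransition.contDiff (n := ⊤)).contDiffAt.comp t
          (((contDiffAt_const.sub contDiffAt_id).div_const d).sub contDiffAt_const)
      · fun_prop
      · linarith
    · have : (fun t => Real.smoothTransition ((1 - t) / d - 1) / (1 - t)) =ᶠ[𝓝 t] fun _ => 0 := by
        filter_upwards [lt_mem_nhds (show 1 - d < t by linarith)] with y hy
        rw [Real.smoothTransition.zero_of_nonpos, zero_div]
        rw [sub_nonpos, div_le_one hd0]; linarith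
      exact contDiffAt_const.congr_of_eventuallyEq this
  · intro t ht
    simp only
    rw [Real.smoothTransition.one_of_one_le]
    rw [le_sub_iff_add_le, le_div_iff₀ hd0]; linarith

lemma levi_comp {g : ℝ → ℝ} (hg : ContDiff ℝ ∞ g) {r : E → ℝ} (hr : ContDiff ℝ ∞ r) (x v : E)
    (h2 : 0 ≤ deriv (deriv g) (r x)) :
    deriv g (r x) * levi r x v ≤ levi (fun y => g (r y)) x v := by
  have hgr : ContDiff ℝ ∞ (fun y => g (r y)) := hg.comp hr
  have hdg : ContDiff ℝ ∞ (deriv g) := by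
    have := (contDiff_infty_iff_deriv.1 hg).2; exact this
  have key : ∀ u : E, fderiv ℝ (fderiv ℝ (fun y => g (r y))) x u u =
      deriv (deriv g) (r x) * (fderiv ℝ r x u) ^ 2 +
        deriv g (r x) * fderiv ℝ (fderiv ℝ r) x u u := by
    intro u
    rw [← fderiv_fderiv_apply hgr]
    have e1 : (fun y => fderiv ℝ (fun y => g (r y)) y u) =
        fun y => deriv g (r y) * fderiv ℝ r y u := by
      ext y
      exact fderiv_real_comp (hr.differentiable (by simp) y)
        ((hg.differentiable (by simp) _).hasDerivAt) u
    have d1 : DifferentiableAt ℝ (fun y => deriv g (r y)) x :=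
      (hdg.comp hr).differentiable (by simp) x
    have d2 : DifferentiableAt ℝ (fun y => fderiv ℝ r y u) x :=
      (contDiff_fderiv_apply hr u).differentiable (by simp) x
    rw [e1, fderiv_fun_mul d1 d2]
    simp only [add_apply, smul_apply, smul_eq_mul]
    rw [fderiv_real_comp (hr.differentiable (by simp) x)
        ((hdg.differentiable (by simp) _).hasDerivAt) u, fderiv_fderiv_apply hr]
    ring
  unfold levi
  rw [key, key]
  nlinarith [mul_nonneg h2 (sq_nonneg (fderiv ℝ r x v)),
    mul_nonneg h2 (sq_nonneg (fderiv ℝ r x (Complex.I • v)))]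

lemma deriv_sigma {σ : ℝ → ℝ} {c : ℝ} (hc : c < 1) (h : ∀ t ≤ c, σ t = 1 / (1 - t)) {t : ℝ}
    (ht : t < c) : deriv σ t = 1 / (1 - t) ^ 2 ∧ deriv (deriv σ) t = 2 / (1 - t) ^ 3 := by
  have e1 : ∀ t < c, deriv σ t = 1 / (1 - t) ^ 2 := by
    intro t ht
    have : σ =ᶠ[𝓝 t] fun t => 1 / (1 - t) := by
      filter_upwards [gt_mem_nhds ht] with y hy using h y hy.le
    rw [this.deriv_eq]
    have hd : HasDerivAt (fun t : ℝ => 1 - t) (-1) t := by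
      simpa using (hasDerivAt_id t).const_sub 1
    have := (hd.inv (by linarith)).deriv
    simp only [one_div]
    rw [show (fun t : ℝ => (1 - t)⁻¹) = (fun t : ℝ => 1 - t)⁻¹ from rfl, this]
    field_simp
  refine ⟨e1 t ht, ?_⟩
  have : deriv σ =ᶠ[𝓝 t] fun t => ((1 - t) ^ 2)⁻¹ := by
    filter_upwards [gt_mem_nhds ht] with y hy
    rw [e1 y hy, one_div]
  rw [this.deriv_eq]
  have h0 : 1 - t ≠ 0 := by linarith
  have hd : HasDerivAt (fun t : ℝ => (1 - t) ^ 2) (2 * (1 - t) * (-1)) t := by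
    have := ((hasDerivAt_id t).const_sub 1).pow 2
    refine this.congr_deriv ?_
    simp
  have := (hd.inv (by positivity)).deriv
  rw [show (fun t : ℝ => ((1 - t) ^ 2)⁻¹) = (fun t : ℝ => (1 - t) ^ 2)⁻¹ from rfl, this]
  field_simp

end Weights
end SC

namespace SC
open MeasureTheory Filter
open scoped ContDiff ComplexConjugate ENNReal
set_option linter.unusedSectionVars false
set_option linter.style.haveILetI false

section LemA
variable {E : Type*} [NormedAddCommGroup E] [NormedSpace ℂ E] [FiniteDimensional ℂ E]
  [MeasurableSpace E] [BorelSpace E] (μ : Measure E) [μ.IsAddHaarMeasure]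
variable {ι : Type*} [Fintype ι]

/-- the weight `√w₂` -/
def aw (r : E → ℝ) (K : ℝ) (x : E) : ℝ :=
  if r x < 1 then 1 / (1 - r x) * Real.exp (-(K * (1 / (1 - r x))) / 2) else 0

lemma mul_cont_memLp {g : E → ℂ} (hg : MemLp g 2 μ) {a : E → ℂ} (ha : Continuous a) {K : Set E}
    (hK : IsCompact K) (haK : ∀ x, x ∉ K → a x = 0) : MemLp (fun x => a x * g x) 2 μ := by
  obtain ⟨C, hC⟩ := hK.exists_bound_of_continuousOn ha.continuousOn
  refine hg.of_le_mul (c := |C|) (ha.aestronglyMeasurable.mul hg.1)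
    (Eventually.of_forall fun x => ?_)
  by_cases hx : x ∈ K
  · rw [norm_mul]; gcongr; exact (hC x hx).trans (le_abs_self C)
  · simp only [haK x hx, zero_mul, norm_zero]
    positivity

lemma mul_cont_integrable {g : E → ℂ} (hg : MemLp g 2 μ) {a : E → ℂ} (ha : Continuous a) {K : Set E}
    (hK : IsCompact K) (haK : ∀ x, x ∉ K → a x = 0) : Integrable (fun x => a x * g x) μ :=
  (hg.locallyIntegrable (by norm_num)).integrable_smul_left_of_hasCompactSupport ha
    (HasCompactSupport.intro hK haK)

lemma lemma_A_nu {r : E → ℝ} (hr : ContDiff ℝ ∞ r) (hrc : IsCompact {x | r x ≤ 1})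
    (e : ι → E) {K : ℝ} (hK : 0 < K)
    (hlevi : ∀ x, r x < 1 → ∀ c : ι → ℂ,
      8 * (4 * (∑ j, ‖dd (e j) (fun y => (r y : ℂ)) x‖ ^ 2) + 1) * ∑ j, ‖c j‖ ^ 2 ≤
        K * levi r x (∑ j, c j • e j))
    (m : ι → E → ℂ) (hm : ∀ j, MemLp (m j) 2 μ)
    (hcl : ∀ j k, ∀ γ : E → ℂ, ContDiff ℝ ∞ γ → HasCompactSupport γ → tsupport γ ⊆ {x | r x < 1} →
      ∫ x, m k x / aw r K x * db (e j) γ x ∂μ - ∫ x, m j x / aw r K x * db (e k) γ x ∂μ = 0)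
    (u : E → ℂ) (hu : Continuous u)
    (hdiv : ∀ γ : E → ℂ, ContDiff ℝ ∞ γ → HasCompactSupport γ → tsupport γ ⊆ {x | r x < 1} →
      ∑ j, ∫ x, aw r K x * m j x * dd (e j) γ x ∂μ = - ∫ x, u x * γ x ∂μ)
    (η : E → ℝ) (hη : ContDiff ℝ ∞ η) {c1 : ℝ} (hc1 : c1 < 1) (hη0 : ∀ x, c1 ≤ r x → η x = 0) :
    2 * ∑ j, ∫ x, ‖(η x : ℂ) * m j x‖ ^ 2 ∂μ ≤
      2 * ∫ x, ‖η x * (1 - r x) / aw r K x * u x +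
        (1 - r x) * ∑ j, m j x * dd (e j) (fun y => (η y : ℂ)) x‖ ^ 2 ∂μ
      + (1 / 2) * ∑ j, ∑ k, ∫ x, ‖(1 - r x) * (m k x * db (e j) (fun y => (η y : ℂ)) x -
          m j x * db (e k) (fun y => (η y : ℂ)) x)‖ ^ 2 ∂μ := by
  have : FiniteDimensional ℝ E := FiniteDimensional.complexToReal E
  set c2 := (c1 + 1) / 2 with hc2
  have hc12 : c1 < c2 := by rw [hc2]; linarith
  have hc21 : c2 < 1 := by rw [hc2]; linarith
  obtain ⟨σ, hσ, hσe⟩ := exists_sigma hc21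
  set st : E → ℝ := fun x => σ (r x) with hst
  have hsts : ContDiff ℝ ∞ st := hσ.comp hr
  have ste : ∀ x, r x ≤ c2 → st x = 1 / (1 - r x) := fun x hx => hσe _ hx
  set φ : E → ℝ := fun x => K * st x with hφd
  have hφ : ContDiff ℝ ∞ φ := contDiff_const.mul hsts
  have oR : ∀ {f : E → ℝ}, ContDiff ℝ ∞ f → ContDiff ℝ ∞ (fun x => (f x : ℂ)) := fun hf =>
    Complex.ofRealCLM.contDiff.comp hf
  -- the compact set
  set KK : Set E := {x | r x ≤ c1} with hKK
  set V : Set E := {x | r x < c2} with hV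
  have hKKc : IsCompact KK := hrc.of_isClosed_subset (isClosed_le hr.continuous continuous_const)
    (fun x hx => le_trans hx hc1.le)
  have hVo : IsOpen V := isOpen_lt hr.continuous continuous_const
  have hKV : KK ⊆ V := fun x hx => lt_of_le_of_lt hx hc12
  have hηK : ∀ x, x ∉ KK → η x = 0 := fun x hx => hη0 x (not_le.1 hx).le
  have tsη : tsupport (fun x => (η x : ℂ)) ⊆ KK := by
    apply closure_minimal _ hKKc.isClosed
    intro x hx; by_contra h; apply hx; simp [hηK x h]
  have hdη : ∀ v x, x ∉ KK → dd v (fun x => (η x : ℂ)) x = 0 := fun v x hx =>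
    dd_zero_of_notMem (fun h => hx (tsη h))
  have hbη : ∀ v x, x ∉ KK → db v (fun x => (η x : ℂ)) x = 0 := fun v x hx =>
    db_zero_of_notMem (fun h => hx (tsη h))
  -- real multipliers
  set B : E → ℝ := fun x => (1 - r x) * Real.exp (φ x / 2) with hB
  have hBs : ContDiff ℝ ∞ B := (contDiff_const.sub hr).mul (Real.contDiff_exp.comp (hφ.div_const 2))
  have awB : ∀ x ∈ V, aw r K x * B x = 1 := by
    intro x hx
    have hx' : r x < c2 := hx
    have h1 : 1 - r x ≠ 0 := by linarith
    simp only [aw, if_pos (hx'.trans hc21), hB, hφd, ste x hx'.le]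
    rw [show -(K * (1 / (1 - r x))) / 2 = -(K * (1 / (1 - r x)) / 2) by ring, Real.exp_neg]
    field_simp
  have awne : ∀ x ∈ V, aw r K x ≠ 0 := fun x hx h => by
    have := awB x hx; rw [h] at this; simp at this
  have Binv : ∀ x ∈ V, (B x : ℂ) = (aw r K x : ℂ)⁻¹ := by
    intro x hx
    have := awB x hx
    rw [← Complex.ofReal_inv, eq_inv_of_mul_eq_one_right this]
  set at' : E → ℝ := fun x => st x * Real.exp (-φ x / 2) with hat
  have hats : ContDiff ℝ ∞ at' := hsts.mul (Real.contDiff_exp.comp (hφ.neg.div_const 2))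
  have atE : ∀ x ∈ V, at' x = aw r K x := by
    intro x hx
    have hx' : r x < c2 := hx
    simp only [aw, if_pos (hx'.trans hc21), hat, hφd, ste x hx'.le]
  have oD : ∀ {f : E → ℝ}, ContDiff ℝ ∞ f → ∀ x, DifferentiableAt ℝ (fun x => (f x : ℂ)) x :=
    fun hf x => (oR hf).differentiable (by simp) x
  set ψ : ι → E → ℂ := fun j x => 2 * st x * dd (e j) (fun y => (r y : ℂ)) x with hψ
  set P : E → ℂ := fun x => (η x : ℂ) * (B x * B x) with hP
  have hPs : ContDiff ℝ ∞ P := (oR hη).mul ((oR hBs).mul (oR hBs))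
  have tsP : tsupport P ⊆ KK := by
    apply closure_minimal _ hKKc.isClosed
    intro x hx; by_contra h; apply hx; simp [hP, hηK x h]
  have KΩ : KK ⊆ {x | r x < 1} := fun x hx => lt_of_le_of_lt hx hc1
  have ddB : ∀ j, ∀ x ∈ V, dd (e j) (fun y => (B y : ℂ)) x =
      B x * (dd (e j) (fun y => (φ y : ℂ)) x / 2 - st x * dd (e j) (fun y => (r y : ℂ)) x) := by
    intro j x hx
    have hx' : r x < c2 := hx
    have h1 : 1 - r x ≠ 0 := by linarith
    have h1' : (1 : ℂ) - r x ≠ 0 := by exact_mod_cast h1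
    have e1 : (fun y => (B y : ℂ)) = fun y => ((1 - r y : ℝ) : ℂ) * ((Real.exp (φ y / 2) : ℝ) : ℂ) := by
      ext y; simp [hB]
    have hf1 : ContDiff ℝ ∞ (fun y => 1 - r y) := contDiff_const.sub hr
    have hf2 : ContDiff ℝ ∞ (fun y => Real.exp (φ y / 2)) :=
      Real.contDiff_exp.comp (hφ.div_const 2)
    rw [e1, dd_mul (oD hf1 x) (oD hf2 x),
      dd_real_comp (g := fun t => 1 - t) (g' := -1) (hr.differentiable (by simp) x)
        (by simpa using (hasDerivAt_id (r x)).const_sub 1),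
      dd_real_comp (g := fun t => Real.exp (t / 2)) (g' := Real.exp (φ x / 2) * (1 / 2))
        (hφ.differentiable (by simp) x)
        (((hasDerivAt_id (φ x)).div_const 2).exp)]
    simp only [hB, ste x hx'.le]
    push_cast
    field_simp
    ring
  have ddP : ∀ j x, at' x * dd (e j) P x = B x * (dd (e j) (fun y => (η y : ℂ)) x +
      η x * (dd (e j) (fun y => (φ y : ℂ)) x - ψ j x)) := by
    intro j x
    by_cases hx : x ∈ KK
    · have hxV := hKV hx
      have dB := oD hBs x
      rw [hP, dd_mul (oD hη x) (dB.fun_mul dB), dd_mul dB dB, ddB j x hxV, atE x hxV]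
      have := awB x hxV
      have h2 : (aw r K x : ℂ) * B x = 1 := by exact_mod_cast this
      simp only [hψ]
      linear_combination (B x * (dd (e j) (fun y => (η y : ℂ)) x +
      η x * (dd (e j) (fun y => (φ y : ℂ)) x - 2 * st x * dd (e j) (fun y => (r y : ℂ)) x))) * h2
    · rw [dd_zero_of_notMem (fun h => hx (tsP h)), hdη _ x hx, hηK x hx]; simp
  set h : E → ℂ := fun x => P x * u x + ∑ j, (at' x * dd (e j) P x) * m j x with hh
  have cP : ∀ j, Continuous (fun x => (at' x : ℂ) * dd (e j) P x) := fun j =>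
    (oR hats).continuous.mul (contDiff_dd hPs _).continuous
  have zP : ∀ j x, x ∉ KK → (at' x : ℂ) * dd (e j) P x = 0 := fun j x hx => by
    rw [dd_zero_of_notMem (fun h => hx (tsP h)), mul_zero]
  have P0 : ∀ x, x ∉ KK → P x = 0 := fun x hx => by simp [hP, hηK x hx]
  have PuL : MemLp (fun x => P x * u x) 2 μ :=
    (hPs.continuous.mul hu).memLp_of_hasCompactSupport
      (HasCompactSupport.intro hKKc fun x hx => by simp [P0 x hx])
  have hhL : MemLp h 2 μ := PuL.add (memLp_finsetSum _ fun j _ => mul_cont_memLp μ (hm j) (cP j)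
    hKKc (zP j))
  set Q : E → ℂ := fun x => (η x : ℂ) * B x with hQ
  have cQ : Continuous Q := ((oR hη).mul (oR hBs)).continuous
  have Q0 : ∀ x, x ∉ KK → Q x = 0 := fun x hx => by simp [hQ, hηK x hx]
  have QP : ∀ x, Q x = at' x * P x := by
    intro x
    by_cases hx : x ∈ KK
    · have h2 : (aw r K x : ℂ) * B x = 1 := by exact_mod_cast awB x (hKV hx)
      simp only [hQ, hP, atE x (hKV hx)]
      linear_combination (-(η x : ℂ) * B x) * h2
    · rw [Q0 x hx, P0 x hx, mul_zero]
  have hcB : ∀ j, Continuous fun x => (B x : ℂ) * db (e j) (fun y => (η y : ℂ)) x := fun j =>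
    (oR hBs).continuous.mul (contDiff_db (oR hη) _).continuous
  have zc : ∀ j x, x ∉ KK → (B x : ℂ) * db (e j) (fun y => (η y : ℂ)) x = 0 := fun j x hx => by
    rw [hbη _ x hx, mul_zero]
  have main := lemma_B μ hφ e (fun j x => Q x * m j x) h
    (fun j k x => (B x * db (e j) (fun y => (η y : ℂ)) x) * m k x -
      (B x * db (e k) (fun y => (η y : ℂ)) x) * m j x)
    (fun j => mul_cont_memLp μ (hm j) cQ hKKc Q0) hhL
    (fun j k => (mul_cont_memLp μ (hm k) (hcB j) hKKc (zc j)).sub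
      (mul_cont_memLp μ (hm j) (hcB k) hKKc (zc k))) hKKc hVo hKV
    (fun j x hx => by simp only [Q0 x hx, zero_mul])
    (fun x hx => by simp only [hh, P0 x hx, zP _ x hx, zero_mul, Finset.sum_const_zero, add_zero])
    (fun j k x hx => by simp only [zc _ x hx, zero_mul, sub_zero])
    ?_ ?_ ψ (fun j => (continuous_const.mul (oR hsts).continuous).mul
      (contDiff_dd (oR hr) _).continuous) st hsts.continuous ?_ _ rfl
  · have WB : ∀ x, ((Real.exp (-φ x / 2) : ℝ) : ℂ) * B x = 1 - r x := by
      intro x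
      have : Real.exp (-φ x / 2) * B x = 1 - r x := by
        simp only [hB]
        rw [show -φ x / 2 = -(φ x / 2) by ring, Real.exp_neg]
        field_simp
      exact_mod_cast this
    have l1 : ∀ j, ∫ x, ‖(st x : ℂ) * (((Real.exp (-φ x / 2) : ℝ) : ℂ) * (Q x * m j x))‖ ^ 2 ∂μ =
        ∫ x, ‖(η x : ℂ) * m j x‖ ^ 2 ∂μ := by
      intro j
      congr 1; ext x; congr 2
      by_cases hx : x ∈ KK
      · have h2 : (at' x : ℂ) * B x = 1 := by
          rw [atE x (hKV hx)]; exact_mod_cast awB x (hKV hx)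
        simp only [hat] at h2
        push_cast at h2 ⊢
        simp only [hQ]
        linear_combination (η x * m j x) * h2
      · rw [Q0 x hx, hηK x hx]; simp
    have l2 : ∀ x, ((Real.exp (-φ x / 2) : ℝ) : ℂ) * (h x + ∑ j, (ψ j x -
        dd (e j) (fun y => (φ y : ℂ)) x) * (Q x * m j x)) =
        η x * (1 - r x) / aw r K x * u x +
        (1 - r x) * ∑ j, m j x * dd (e j) (fun y => (η y : ℂ)) x := by
      intro x
      have a1 : h x + ∑ j, (ψ j x - dd (e j) (fun y => (φ y : ℂ)) x) * (Q x * m j x) =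
          P x * u x + B x * ∑ j, m j x * dd (e j) (fun y => (η y : ℂ)) x := by
        simp only [hh, add_assoc, ← Finset.sum_add_distrib, Finset.mul_sum]
        congr 1
        refine Finset.sum_congr rfl fun j _ => ?_
        rw [ddP]; simp only [hQ]; ring
      rw [a1, ← WB x]
      by_cases hx : x ∈ KK
      · rw [div_eq_mul_inv (_ * _ : ℂ) (aw r K x : ℂ), ← Binv x (hKV hx)]
        simp only [hP]; ring
      · rw [P0 x hx, hηK x hx]; simp; ring
    simp only [l1, l2] at main
    refine main.trans (le_of_eq ?_)
    congr 2
    refine Finset.sum_congr rfl fun j _ => Finset.sum_congr rfl fun k _ => ?_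
    congr 1; ext x
    rw [← WB x]; congr 2; ring
  · intro γ hγ hγc
    have hγP : ContDiff ℝ ∞ (fun x => P x * γ x) := hPs.mul hγ
    have tsγ : tsupport (fun x => P x * γ x) ⊆ KK :=
      (tsupport_mul_subset_left).trans tsP
    have hd := hdiv (fun x => P x * γ x) hγP
      (HasCompactSupport.intro hKKc fun x hx => by simp [P0 x hx]) (tsγ.trans KΩ)
    have i1 : ∀ j, Integrable (fun x => ((at' x * dd (e j) P x) * γ x) * m j x) μ := fun j =>
      mul_cont_integrable μ (hm j) ((cP j).mul hγ.continuous) hKKc (fun x hx => by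
        simp only [zP j x hx, zero_mul])
    have i2 : ∀ j, Integrable (fun x => (Q x * dd (e j) γ x) * m j x) μ := fun j =>
      mul_cont_integrable μ (hm j) (cQ.mul (contDiff_dd hγ _).continuous) hKKc (fun x hx => by
        simp only [Q0 x hx, zero_mul])
    have e1 : ∀ j, ∫ x, aw r K x * m j x * dd (e j) (fun x => P x * γ x) x ∂μ =
        ∫ x, (Q x * dd (e j) γ x) * m j x ∂μ +
          ∫ x, ((at' x * dd (e j) P x) * γ x) * m j x ∂μ := by
      intro j
      rw [← integral_add (i2 j) (i1 j)]
      congr 1; ext x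
      by_cases hx : x ∈ KK
      · rw [dd_mul (hPs.differentiable (by simp) x) (hγ.differentiable (by simp) x), QP, 
          ← atE x (hKV hx)]
        ring
      · rw [dd_zero_of_notMem (fun h => hx (tsγ h)), Q0 x hx, zP j x hx]; simp
    have i3 : Integrable (fun x => u x * (P x * γ x)) μ := by
      apply Continuous.integrable_of_hasCompactSupport
      · exact hu.mul (hPs.continuous.mul hγ.continuous)
      · exact HasCompactSupport.intro hKKc fun x hx => by simp [P0 x hx]
    have e2 : ∫ x, h x * γ x ∂μ = ∫ x, u x * (P x * γ x) ∂μ +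
        ∑ j, ∫ x, ((at' x * dd (e j) P x) * γ x) * m j x ∂μ := by
      rw [← integral_finsetSum _ (fun j _ => i1 j),
        ← integral_add i3 (integrable_finsetSum _ (fun j _ => i1 j))]
      congr 1; ext x
      simp only [hh, add_mul, Finset.sum_mul]
      congr 1
      · ring
      · exact Finset.sum_congr rfl fun j _ => by ring
    have e3 : ∑ j, ∫ x, Q x * m j x * dd (e j) γ x ∂μ =
        ∑ j, ∫ x, (Q x * dd (e j) γ x) * m j x ∂μ :=
      Finset.sum_congr rfl fun j _ => by congr 1; ext x; ring
    rw [e3, e2]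
    simp only [e1, Finset.sum_add_distrib] at hd
    linear_combination hd
  · intro j k γ hγ hγc
    have hγP : ContDiff ℝ ∞ (fun x => (η x : ℂ) * γ x) := (oR hη).mul hγ
    have tsγ : tsupport (fun x => (η x : ℂ) * γ x) ⊆ KK :=
      (tsupport_mul_subset_left).trans tsη
    have hd := hcl j k (fun x => (η x : ℂ) * γ x) hγP
      (HasCompactSupport.intro hKKc fun x hx => by simp [hηK x hx]) (tsγ.trans KΩ)
    have i1 : ∀ j k, Integrable (fun x => (B x * db (e j) (fun y => (η y : ℂ)) x) * γ x * m k x) μ :=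
      fun j k => mul_cont_integrable μ (hm k) ((hcB j).mul hγ.continuous) hKKc (fun x hx => by
        simp only [zc j x hx, zero_mul])
    have i2 : ∀ j k, Integrable (fun x => (Q x * db (e j) γ x) * m k x) μ := fun j k =>
      mul_cont_integrable μ (hm k) (cQ.mul (contDiff_db hγ _).continuous) hKKc (fun x hx => by
        simp only [Q0 x hx, zero_mul])
    have e1 : ∀ j k, ∫ x, m k x / aw r K x * db (e j) (fun x => (η x : ℂ) * γ x) x ∂μ =
        ∫ x, (Q x * db (e j) γ x) * m k x ∂μ +
          ∫ x, (B x * db (e j) (fun y => (η y : ℂ)) x) * γ x * m k x ∂μ := by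
      intro j k
      rw [← integral_add (i2 j k) (i1 j k)]
      congr 1; ext x
      by_cases hx : x ∈ KK
      · rw [db_mul (oD hη x) (hγ.differentiable (by simp) x), div_eq_mul_inv,
          ← Binv x (hKV hx)]
        simp only [hQ]
        ring
      · rw [db_zero_of_notMem (fun h => hx (tsγ h)), Q0 x hx, zc j x hx]; simp
    have e2 : ∫ x, ((B x * db (e j) (fun y => (η y : ℂ)) x) * m k x -
      (B x * db (e k) (fun y => (η y : ℂ)) x) * m j x) * γ x ∂μ =
        ∫ x, (B x * db (e j) (fun y => (η y : ℂ)) x) * γ x * m k x ∂μ -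
        ∫ x, (B x * db (e k) (fun y => (η y : ℂ)) x) * γ x * m j x ∂μ := by
      rw [← integral_sub (i1 j k) (i1 k j)]
      congr 1; ext x; ring
    have e3 : ∀ j k, ∫ x, Q x * m k x * db (e j) γ x ∂μ =
        ∫ x, (Q x * db (e j) γ x) * m k x ∂μ := fun j k => by congr 1; ext x; ring
    rw [e3, e3, e2]
    rw [e1, e1] at hd
    linear_combination hd
  · intro x hx c
    have hx' : r x < c2 := hx
    have h1 : 0 < 1 - r x := by linarith
    have hl := hlevi x (hx'.trans hc21) c
    obtain ⟨d1, d2⟩ := deriv_sigma hc21 hσe hx'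
    have hg : ContDiff ℝ ∞ (fun t => K * σ t) := contDiff_const.mul hσ
    have dg : deriv (fun t => K * σ t) = fun t => K * deriv σ t := by
      ext t; exact deriv_const_mul _ (hσ.differentiable (by simp) t)
    have hl2 := levi_comp hg hr x (∑ j, c j • e j) (by
      rw [dg, deriv_const_mul _ ((contDiff_infty_iff_deriv.1 hσ).2.differentiable (by simp) _), d2]
      positivity)
    rw [dg] at hl2
    simp only [d1] at hl2
    have e1 : ∑ j, ‖ψ j x‖ ^ 2 = 4 * (1 / (1 - r x)) ^ 2 *
        ∑ j, ‖dd (e j) (fun y => (r y : ℂ)) x‖ ^ 2 := by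
      rw [Finset.mul_sum]
      refine Finset.sum_congr rfl fun j _ => ?_
      simp only [hψ, norm_mul, Complex.norm_real, ste x hx'.le, Complex.norm_ofNat, mul_pow]
      rw [Real.norm_eq_abs, sq_abs]; norm_num
    rw [e1, ste x hx'.le]
    have hp : 0 ≤ (1 / (1 - r x)) ^ 2 := by positivity
    have := mul_le_mul_of_nonneg_left hl hp
    have e2 : K * (1 / (1 - r x) ^ 2) = (1 / (1 - r x)) ^ 2 * K := by rw [one_div_pow]; ring
    rw [e2] at hl2
    have hφe : φ = fun y => K * σ (r y) := rfl
    rw [hφe]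
    linarith

end LemA
end SC

namespace SC
open MeasureTheory Filter
open scoped ContDiff ComplexConjugate ENNReal
set_option linter.unusedSectionVars false
set_option linter.style.haveILetI false

section LemA2
variable {E : Type*} [NormedAddCommGroup E] [NormedSpace ℂ E] [FiniteDimensional ℂ E]
  [MeasurableSpace E] [BorelSpace E] (μ : Measure E) [μ.IsAddHaarMeasure]
variable {ι : Type*} [Fintype ι]

lemma measurable_aw {r : E → ℝ} (hr : Continuous r) (K : ℝ) : Measurable (aw r K) := by
  have hm : Measurable r := hr.measurable
  unfold aw
  refine Measurable.ite (isOpen_lt hr continuous_const).measurableSet ?_ measurable_const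
  fun_prop

lemma trans_deriv_zero {y : ℝ} (hy : y < 0 ∨ 1 < y) : deriv Real.smoothTransition y = 0 := by
  rcases hy with h | h
  · have : Real.smoothTransition =ᶠ[𝓝 y] fun _ => 0 := by
      filter_upwards [gt_mem_nhds h] with z hz
      exact Real.smoothTransition.zero_of_nonpos hz.le
    rw [this.deriv_eq]; simp
  · have : Real.smoothTransition =ᶠ[𝓝 y] fun _ => 1 := by
      filter_upwards [lt_mem_nhds h] with z hz
      exact Real.smoothTransition.one_of_one_le hz.le
    rw [this.deriv_eq]; simp

lemma trans_bound : ∃ C : ℝ, 0 ≤ C ∧ ∀ y, |(y + 1) * deriv Real.smoothTransition y| ≤ C := by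
  have hT : ContDiff ℝ ∞ Real.smoothTransition := Real.smoothTransition.contDiff (n := ⊤)
  have hc : Continuous (fun y => (y + 1) * deriv Real.smoothTransition y) :=
    (continuous_id.add continuous_const).mul (contDiff_infty_iff_deriv.1 hT).2.continuous
  obtain ⟨C, hC⟩ := (isCompact_Icc (a := (0 : ℝ)) (b := 1)).exists_bound_of_continuousOn
    hc.continuousOn
  refine ⟨|C|, abs_nonneg _, fun y => ?_⟩
  by_cases hy : y ∈ Icc (0 : ℝ) 1
  · exact (hC y hy).trans (le_abs_self _)
  · rw [trans_deriv_zero]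
    · simp
    · by_contra! h; exact hy ⟨h.1, h.2⟩

lemma lemma_A {r : E → ℝ} (hr : ContDiff ℝ ∞ r) (hrc : IsCompact {x | r x ≤ 1})
    (e : ι → E) {K : ℝ} (hK : 0 < K)
    (hlevi : ∀ x, r x < 1 → ∀ c : ι → ℂ,
      8 * (4 * (∑ j, ‖dd (e j) (fun y => (r y : ℂ)) x‖ ^ 2) + 1) * ∑ j, ‖c j‖ ^ 2 ≤
        K * levi r x (∑ j, c j • e j))
    (m : ι → E → ℂ) (hm : ∀ j, MemLp (m j) 2 μ)
    (hcl : ∀ j k, ∀ γ : E → ℂ, ContDiff ℝ ∞ γ → HasCompactSupport γ → tsupport γ ⊆ {x | r x < 1} →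
      ∫ x, m k x / aw r K x * db (e j) γ x ∂μ - ∫ x, m j x / aw r K x * db (e k) γ x ∂μ = 0)
    (u : E → ℂ) (hu : Continuous u) (huL : MemLp (fun x => (1 - r x) / aw r K x * u x) 2 μ)
    (hdiv : ∀ γ : E → ℂ, ContDiff ℝ ∞ γ → HasCompactSupport γ → tsupport γ ⊆ {x | r x < 1} →
      ∑ j, ∫ x, aw r K x * m j x * dd (e j) γ x ∂μ = - ∫ x, u x * γ x ∂μ) :
    ∑ j, ∫ x in {x | r x < 1}, ‖m j x‖ ^ 2 ∂μ ≤ ∫ x, ‖(1 - r x) / aw r K x * u x‖ ^ 2 ∂μ := by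
  have : FiniteDimensional ℝ E := FiniteDimensional.complexToReal E
  have hT : ContDiff ℝ ∞ Real.smoothTransition := Real.smoothTransition.contDiff (n := ⊤)
  obtain ⟨CT, hCT0, hCT⟩ := trans_bound
  have oR : ∀ {f : E → ℝ}, ContDiff ℝ ∞ f → ContDiff ℝ ∞ (fun x => (f x : ℂ)) := fun hf =>
    Complex.ofRealCLM.contDiff.comp hf
  have hR : ∃ R : ℝ, 0 ≤ R ∧ ∀ j, ∀ x, r x ≤ 1 → ‖dd (e j) (fun y => (r y : ℂ)) x‖ ≤ R := by
    have : ∀ j, ∃ R : ℝ, ∀ x ∈ {x | r x ≤ 1}, ‖dd (e j) (fun y => (r y : ℂ)) x‖ ≤ R := fun j =>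
      hrc.exists_bound_of_continuousOn (contDiff_dd (oR hr) _).continuous.continuousOn
    choose R hR using this
    refine ⟨∑ j, |R j|, by positivity, fun j x hx => (hR j x hx).trans ?_⟩
    exact (le_abs_self _).trans (Finset.single_le_sum (f := fun j => |R j|)
      (fun _ _ => abs_nonneg _) (Finset.mem_univ j))
  obtain ⟨R, hR0, hR⟩ := hR
  set y : ℕ → E → ℝ := fun n x => (n + 1) * (1 - r x) - 1 with hy
  set η : ℕ → E → ℝ := fun n x => Real.smoothTransition (y n x) with hη
  have hηs : ∀ n, ContDiff ℝ ∞ (η n) := fun n =>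
    hT.comp ((contDiff_const.mul (contDiff_const.sub hr)).sub contDiff_const)
  have hη1 : ∀ n x, |η n x| ≤ 1 := fun n x => by
    rw [abs_of_nonneg (Real.smoothTransition.nonneg _)]
    exact Real.smoothTransition.le_one _
  have ddη : ∀ n j x, dd (e j) (fun y => (η n y : ℂ)) x =
      ((-(n + 1) * deriv Real.smoothTransition (y n x) : ℝ) : ℂ) *
        dd (e j) (fun y => (r y : ℂ)) x := by
    intro n j x
    refine dd_real_comp (g := fun t => Real.smoothTransition ((n + 1) * (1 - t) - 1))
      (hr.differentiable (by simp) x) ?_ _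
    have h1 : HasDerivAt (fun t : ℝ => ((n : ℝ) + 1) * (1 - t) - 1) (-(n + 1)) (r x) := by
      have := (((hasDerivAt_id (r x)).const_sub 1).const_mul ((n : ℝ) + 1)).sub_const 1
      simpa using this
    have := ((hT.differentiable (by simp) (y n x)).hasDerivAt).comp (r x) h1
    rw [mul_comm]; exact this
  have dbη : ∀ n j x, db (e j) (fun y => (η n y : ℂ)) x =
      conj (dd (e j) (fun y => (η n y : ℂ)) x) := fun n j x =>
    db_ofReal ((hηs n).differentiable (by simp) x)
  set C := CT * R with hC
  have hC0 : 0 ≤ C := by positivity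
  have bdd : ∀ n j x, ‖((1 : ℂ) - r x) * dd (e j) (fun y => (η n y : ℂ)) x‖ ≤ C := by
    intro n j x
    rw [ddη]
    have e1 : ((1 : ℂ) - r x) * (((-(n + 1) * deriv Real.smoothTransition (y n x) : ℝ) : ℂ) *
        dd (e j) (fun y => (r y : ℂ)) x) =
        ((-((y n x + 1) * deriv Real.smoothTransition (y n x)) : ℝ) : ℂ) *
          dd (e j) (fun y => (r y : ℂ)) x := by
      simp only [hy]; push_cast; ring
    rw [e1]
    rcases le_or_gt (r x) 1 with h | h
    · rw [norm_mul, Complex.norm_real, norm_neg]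
      exact mul_le_mul (hCT _) (hR j x h) (norm_nonneg _) hCT0
    · rw [trans_deriv_zero (Or.inl (by simp only [hy]; nlinarith [(Nat.cast_nonneg n : (0 : ℝ) ≤ n)]))]
      simpa using hC0
  have off : ∀ x, ¬ r x < 1 → ∀ n, η n x = 0 ∧ deriv Real.smoothTransition (y n x) = 0 := by
    intro x hx n
    have : y n x < 0 := by simp only [hy]; nlinarith [(Nat.cast_nonneg n : (0 : ℝ) ≤ n)]
    exact ⟨Real.smoothTransition.zero_of_nonpos this.le, trans_deriv_zero (Or.inl this)⟩
  have on : ∀ x, r x < 1 → ∀ᶠ n in atTop, η n x = 1 ∧ deriv Real.smoothTransition (y n x) = 0 := by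
    intro x hx
    obtain ⟨N, hN⟩ := exists_nat_gt (2 / (1 - r x))
    filter_upwards [eventually_ge_atTop N] with n hn
    have h1 : 0 < 1 - r x := by linarith
    have h2 : (2 : ℝ) < n * (1 - r x) := by
      rw [div_lt_iff₀ h1] at hN
      have : (N : ℝ) ≤ n := by exact_mod_cast hn
      nlinarith
    have : 1 < y n x := by simp only [hy]; linarith
    exact ⟨Real.smoothTransition.one_of_one_le this.le, trans_deriv_zero (Or.inr this)⟩
  have hmaw : Measurable (aw r K) := measurable_aw hr.continuous K
  have hmr : Continuous (fun x => (r x : ℂ)) := (oR hr).continuous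
  have mη : ∀ n, Continuous (fun x => (η n x : ℂ)) := fun n => (oR (hηs n)).continuous
  have mdη : ∀ n j, Continuous (dd (e j) (fun y => (η n y : ℂ))) := fun n j =>
    (contDiff_dd (oR (hηs n)) _).continuous
  have mbη : ∀ n j, Continuous (db (e j) (fun y => (η n y : ℂ))) := fun n j =>
    (contDiff_db (oR (hηs n)) _).continuous
  -- limits
  have L1 : ∀ j, Tendsto (fun n => ∫ x, ‖(η n x : ℂ) * m j x‖ ^ 2 ∂μ) atTop
      (𝓝 (∫ x in {x | r x < 1}, ‖m j x‖ ^ 2 ∂μ)) := by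
    intro j
    rw [← integral_indicator (isOpen_lt hr.continuous continuous_const).measurableSet]
    refine tendsto_integral_of_dominated_convergence (fun x => ‖m j x‖ ^ 2) ?_
      (hm j).norm.integrable_sq ?_ ?_
    · intro n
      exact (((mη n).aestronglyMeasurable.mul (hm j).1).norm.pow 2)
    · intro n
      refine Eventually.of_forall fun x => ?_
      rw [norm_pow, norm_norm, norm_mul, Complex.norm_real]
      gcongr
      exact mul_le_of_le_one_left (norm_nonneg _) (hη1 n x)
    · refine Eventually.of_forall fun x => ?_
      by_cases hx : r x < 1
      · rw [indicator_of_mem (by exact hx)]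
        refine tendsto_const_nhds.congr' ?_
        filter_upwards [on x hx] with n hn
        rw [hn.1]; simp
      · rw [indicator_of_notMem (by exact hx)]
        refine tendsto_const_nhds.congr fun n => ?_
        rw [(off x hx n).1]; simp
  have L2 : Tendsto (fun n => ∫ x, ‖η n x * (1 - r x) / aw r K x * u x +
        (1 - r x) * ∑ j, m j x * dd (e j) (fun y => (η n y : ℂ)) x‖ ^ 2 ∂μ) atTop
      (𝓝 (∫ x, ‖(1 - r x) / aw r K x * u x‖ ^ 2 ∂μ)) := by
    refine tendsto_integral_of_dominated_convergence
      (fun x => (‖(1 - r x) / aw r K x * u x‖ + ∑ j, C * ‖m j x‖) ^ 2) ?_ ?_ ?_ ?_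
    · intro n
      refine AEStronglyMeasurable.pow ?_ 2
      refine AEStronglyMeasurable.norm ?_
      refine AEStronglyMeasurable.add ?_ ?_
      · refine Measurable.aestronglyMeasurable ?_
        have := (mη n).measurable
        have := hmr.measurable
        have := hu.measurable
        fun_prop
      · refine AEStronglyMeasurable.mul ?_ ?_
        · exact (continuous_const.sub hmr).aestronglyMeasurable
        · exact Finset.aestronglyMeasurable_fun_sum _ fun j _ =>
            (hm j).1.mul (mdη n j).aestronglyMeasurable
    · have : MemLp (fun x => ‖(1 - r x) / aw r K x * u x‖ + ∑ j, C * ‖m j x‖) 2 μ :=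
        huL.norm.add (memLp_finsetSum _ fun j _ => (hm j).norm.const_mul C)
      exact this.integrable_sq
    · intro n
      refine Eventually.of_forall fun x => ?_
      rw [norm_pow, norm_norm]
      gcongr
      refine (norm_add_le _ _).trans ?_
      gcongr
      · rw [show (η n x : ℂ) * (1 - r x) / aw r K x * u x = η n x * ((1 - r x) / aw r K x * u x) by
          ring, norm_mul, Complex.norm_real]
        exact mul_le_of_le_one_left (norm_nonneg _) (hη1 n x)
      · rw [Finset.mul_sum]
        refine (norm_sum_le _ _).trans (Finset.sum_le_sum fun j _ => ?_)
        rw [show ((1 : ℂ) - r x) * (m j x * dd (e j) (fun y => (η n y : ℂ)) x) =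
          (((1 : ℂ) - r x) * dd (e j) (fun y => (η n y : ℂ)) x) * m j x by ring, norm_mul]
        gcongr
        exact bdd n j x
    · refine Eventually.of_forall fun x => ?_
      by_cases hx : r x < 1
      · refine tendsto_const_nhds.congr' ?_
        filter_upwards [on x hx] with n hn
        simp only [ddη, hn.1, hn.2]; simp
      · refine tendsto_const_nhds.congr fun n => ?_
        simp only [ddη, (off x hx n).1, (off x hx n).2]; simp [aw, hx]
  have L3 : ∀ j k, Tendsto (fun n => ∫ x, ‖(1 - r x) * (m k x * db (e j) (fun y => (η n y : ℂ)) x -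
          m j x * db (e k) (fun y => (η n y : ℂ)) x)‖ ^ 2 ∂μ) atTop (𝓝 0) := by
    intro j k
    rw [show (0 : ℝ) = ∫ x, (0 : ℝ) ∂μ by simp]
    refine tendsto_integral_of_dominated_convergence
      (fun x => (C * ‖m k x‖ + C * ‖m j x‖) ^ 2) ?_ ?_ ?_ ?_
    · intro n
      exact ((continuous_const.sub hmr).aestronglyMeasurable.mul
        (((hm k).1.mul (mbη n j).aestronglyMeasurable).sub
        ((hm j).1.mul (mbη n k).aestronglyMeasurable))).norm.pow 2
    · exact (((hm k).norm.const_mul C).add ((hm j).norm.const_mul C)).integrable_sq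
    · intro n
      refine Eventually.of_forall fun x => ?_
      rw [norm_pow, norm_norm]
      gcongr
      have hb : ∀ j, ‖((1 : ℂ) - r x) * db (e j) (fun y => (η n y : ℂ)) x‖ ≤ C := fun j => by
        rw [dbη, norm_mul, RCLike.norm_conj, ← norm_mul]; exact bdd n j x
      rw [show ((1 : ℂ) - r x) * (m k x * db (e j) (fun y => (η n y : ℂ)) x -
          m j x * db (e k) (fun y => (η n y : ℂ)) x) =
          (((1 : ℂ) - r x) * db (e j) (fun y => (η n y : ℂ)) x) * m k x -
          (((1 : ℂ) - r x) * db (e k) (fun y => (η n y : ℂ)) x) * m j x by ring]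
      refine (norm_sub_le _ _).trans ?_
      rw [norm_mul _ (m k x), norm_mul _ (m j x)]
      exact add_le_add (mul_le_mul_of_nonneg_right (hb j) (norm_nonneg _))
        (mul_le_mul_of_nonneg_right (hb k) (norm_nonneg _))
    · refine Eventually.of_forall fun x => ?_
      by_cases hx : r x < 1
      · refine tendsto_const_nhds.congr' ?_
        filter_upwards [on x hx] with n hn
        simp only [dbη, ddη, hn.2]; simp
      · refine tendsto_const_nhds.congr fun n => ?_
        simp only [dbη, ddη, (off x hx n).2]; simp
  have key := fun n : ℕ => lemma_A_nu μ hr hrc e hK hlevi m hm hcl u hu hdiv (η n) (hηs n)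
    (c1 := 1 - 1 / ((n : ℝ) + 1)) (by
      have : (0 : ℝ) < 1 / ((n : ℝ) + 1) := by positivity
      linarith) (by
      intro x hx
      apply Real.smoothTransition.zero_of_nonpos
      have h0 : (0 : ℝ) < (n : ℝ) + 1 := by positivity
      have : ((n : ℝ) + 1) * (1 - r x) ≤ 1 := by
        have h3 : 1 - r x ≤ 1 / ((n : ℝ) + 1) := by linarith
        rw [le_div_iff₀ h0] at h3; linarith
      simp only [hy]; linarith)
  have fin := le_of_tendsto_of_tendsto' ((tendsto_finsetSum _ fun j _ => L1 j).const_mul 2)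
    ((L2.const_mul 2).add ((tendsto_finsetSum _ fun j _ => tendsto_finsetSum _ fun k _ =>
      L3 j k).const_mul (1 / 2))) key
  simp only [Finset.sum_const_zero, mul_zero, add_zero] at fin
  linarith

end LemA2
end SC

namespace SC
open MeasureTheory Filter
open scoped ContDiff ComplexConjugate ENNReal
set_option linter.unusedSectionVars false
set_option linter.style.haveILetI false

section Hilb

lemma hilbert_solve {H G : Type*} [NormedAddCommGroup H] [InnerProductSpace ℂ H] [CompleteSpace H]
    [AddCommGroup G] [Module ℂ G] (A : G →ₗ[ℂ] H) (l : G →ₗ[ℂ] ℂ) (C : ℝ) (hC : 0 ≤ C)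
    (h : ∀ g, ‖l g‖ ≤ C * ‖A g‖) : ∃ v : H, ‖v‖ ≤ C ∧ ∀ g, inner ℂ v (A g) = l g := by
  obtain ⟨s, hs⟩ := A.rangeRestrict.exists_rightInverse_of_surjective A.range_rangeRestrict
  have hs' : ∀ y : LinearMap.range A, A (s y) = y := fun y => by
    have := congrArg Subtype.val (LinearMap.congr_fun hs y)
    simpa using this
  set f : LinearMap.range A →L[ℂ] ℂ := (l ∘ₗ s).mkContinuous C (fun y => by
    simpa [hs'] using h (s y)) with hf
  obtain ⟨F, hF, hFn⟩ := exists_extension_norm_eq (LinearMap.range A) f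
  refine ⟨(InnerProductSpace.toDual ℂ H).symm F, ?_, fun g => ?_⟩
  · rw [LinearIsometryEquiv.norm_map, hFn]
    exact LinearMap.mkContinuous_norm_le _ hC _
  · rw [InnerProductSpace.toDual_symm_apply]
    have := hF ⟨A g, LinearMap.mem_range_self A g⟩
    rw [this, hf]
    simp only [LinearMap.mkContinuous_apply, LinearMap.comp_apply]
    have h2 := h (s ⟨A g, LinearMap.mem_range_self A g⟩ - g)
    rw [map_sub A, hs', sub_self, norm_zero, mul_zero, map_sub] at h2
    exact sub_eq_zero.1 (norm_le_zero_iff.1 h2)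

variable {E : Type*} [NormedAddCommGroup E] [NormedSpace ℂ E] [FiniteDimensional ℂ E]
  [MeasurableSpace E] [BorelSpace E] (μ : Measure E) [μ.IsAddHaarMeasure]
variable {ι : Type*} [Fintype ι]

/-- test functions -/
def testF (Ω : Set E) : Submodule ℂ (E → ℂ) where
  carrier := {γ | ContDiff ℝ ∞ γ ∧ HasCompactSupport γ ∧ tsupport γ ⊆ Ω}
  add_mem' := by
    rintro a b ⟨a1, a2, a3⟩ ⟨b1, b2, b3⟩
    exact ⟨a1.add b1, a2.add b2, (tsupport_add a b).trans (union_subset a3 b3)⟩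
  zero_mem' := ⟨contDiff_const, HasCompactSupport.zero, by
    rw [show (0 : E → ℂ) = fun _ => 0 from rfl]; simp [tsupport]⟩
  smul_mem' := by
    rintro c a ⟨a1, a2, a3⟩
    exact ⟨contDiff_const.smul a1, a2.smul_left, (tsupport_smul_subset_right (fun _ => c) a).trans a3⟩

/-- a linear map into `L²` from pointwise data -/
def toL2 {G : Type*} [AddCommGroup G] [Module ℂ G] (T : G →ₗ[ℂ] (E → ℂ))
    (hT : ∀ g, MemLp (T g) 2 μ) : G →ₗ[ℂ] Lp ℂ 2 μ where
  toFun g := (hT g).toLp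
  map_add' a b := by
    rw [← MemLp.toLp_add]; congr 1; exact map_add T a b
  map_smul' c a := by
    rw [RingHom.id_apply, ← MemLp.toLp_const_smul]; congr 1; exact map_smul T c a

lemma inner_toLp_left {f : E → ℂ} (hf : MemLp f 2 μ) (y : Lp ℂ 2 μ) :
    inner ℂ (hf.toLp) y = ∫ x, y x * conj (f x) ∂μ := by
  rw [L2.inner_def]
  refine integral_congr_ae ?_
  filter_upwards [hf.coeFn_toLp] with x hx
  rw [hx]; rfl

lemma norm_toLp_sq {f : E → ℂ} (hf : MemLp f 2 μ) :
    ‖hf.toLp‖ ^ 2 = ∫ x, ‖f x‖ ^ 2 ∂μ := by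
  have h := inner_self_eq_norm_sq_to_K (𝕜 := ℂ) hf.toLp
  rw [inner_toLp_left] at h
  have h2 : ∫ x, (hf.toLp f) x * conj (f x) ∂μ = ((∫ x, ‖f x‖ ^ 2 ∂μ : ℝ) : ℂ) := by
    rw [← integral_complex_ofReal]
    refine integral_congr_ae ?_
    filter_upwards [hf.coeFn_toLp] with x hx
    rw [hx, Complex.mul_conj, Complex.normSq_eq_norm_sq]
  rw [h2] at h
  apply Complex.ofReal_injective
  rw [h]; push_cast; rfl

lemma int_parts_dd {f g : E → ℂ} (hf : ContDiff ℝ ∞ f) (hg : ContDiff ℝ ∞ g)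
    (hc : HasCompactSupport f) (v : E) :
    ∫ x, f x * dd v g x ∂μ = - ∫ x, dd v f x * g x ∂μ := by
  have : FiniteDimensional ℝ E := FiniteDimensional.complexToReal E
  have h0 := integral_dd_zero μ (hf.mul hg) (hc.mul_right (f' := g)) v
  have e1 : ∀ x, dd v (fun y => f y * g y) x = dd v f x * g x + f x * dd v g x := fun x => by
    rw [dd_mul (hf.differentiable (by simp) x) (hg.differentiable (by simp) x)]; ring
  have i1 : Integrable (fun x => dd v f x * g x) μ :=
    ((contDiff_dd hf v).continuous.mul hg.continuous).integrable_of_hasCompactSupport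
      ((hcs_of_tsupport hc (tsupport_dd_subset v)).mul_right)
  have i2 : Integrable (fun x => f x * dd v g x) μ :=
    (hf.continuous.mul (contDiff_dd hg v).continuous).integrable_of_hasCompactSupport
      (hc.mul_right)
  have h1 : ∫ x, dd v (fun y => f y * g y) x ∂μ = 0 := h0
  simp only [e1] at h1
  rw [integral_add i1 i2] at h1
  linear_combination h1

lemma int_parts_db {f g : E → ℂ} (hf : ContDiff ℝ ∞ f) (hg : ContDiff ℝ ∞ g)
    (hc : HasCompactSupport f) (v : E) :
    ∫ x, f x * db v g x ∂μ = - ∫ x, db v f x * g x ∂μ := by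
  have : FiniteDimensional ℝ E := FiniteDimensional.complexToReal E
  have h0 := integral_db_zero μ (hf.mul hg) (hc.mul_right (f' := g)) v
  have e1 : ∀ x, db v (fun y => f y * g y) x = db v f x * g x + f x * db v g x := fun x => by
    rw [db_mul (hf.differentiable (by simp) x) (hg.differentiable (by simp) x)]; ring
  have i1 : Integrable (fun x => db v f x * g x) μ :=
    ((contDiff_db hf v).continuous.mul hg.continuous).integrable_of_hasCompactSupport
      ((hcs_of_tsupport hc (tsupport_db_subset v)).mul_right)
  have i2 : Integrable (fun x => f x * db v g x) μ :=
    (hf.continuous.mul (contDiff_db hg v).continuous).integrable_of_hasCompactSupport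
      (hc.mul_right)
  have h1 : ∫ x, db v (fun y => f y * g y) x ∂μ = 0 := h0
  simp only [e1] at h1
  rw [integral_add i1 i2] at h1
  linear_combination h1

lemma aw_ne {r : E → ℝ} {K : ℝ} {x : E} (hx : r x < 1) : aw r K x ≠ 0 := by
  simp only [aw, if_pos hx]
  have : 0 < 1 - r x := by linarith
  positivity

lemma aw_contOn {r : E → ℝ} (hr : Continuous r) (K : ℝ) : ContinuousOn (aw r K) {x | r x < 1} := by
  have : ContinuousOn (fun x => 1 / (1 - r x) * Real.exp (-(K * (1 / (1 - r x))) / 2))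
      {x | r x < 1} := by
    have h1 : ContinuousOn (fun x => 1 / (1 - r x)) {x | r x < 1} :=
      continuousOn_const.div (continuousOn_const.sub hr.continuousOn) (fun x hx => by
        have : r x < 1 := hx
        linarith)
    exact h1.mul (((continuousOn_const.mul h1).neg.div_const 2).rexp)
  exact this.congr fun x hx => by simp only [aw, if_pos (show r x < 1 from hx)]

/-- a function continuous on an open set, times a compactly supported continuous function -/
lemma contOn_mul {Ω : Set E} (hΩ : IsOpen Ω) {a γ : E → ℂ} (ha : ContinuousOn a Ω)
    (hγ : Continuous γ) (hs : tsupport γ ⊆ Ω) : Continuous (fun x => a x * γ x) := by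
  rw [continuous_iff_continuousAt]
  intro x
  by_cases hx : x ∈ Ω
  · exact (ha.continuousAt (hΩ.mem_nhds hx)).mul hγ.continuousAt
  · have : (fun x => a x * γ x) =ᶠ[𝓝 x] fun _ => 0 := by
      have h1 := notMem_tsupport_iff_eventuallyEq.1 (fun h => hx (hs h))
      filter_upwards [h1] with y hy
      simp [hy]
    exact continuousAt_const.congr this.symm

lemma contOn_mul_memLp {Ω : Set E} (hΩ : IsOpen Ω) {a γ : E → ℂ} (ha : ContinuousOn a Ω)
    (hγ : Continuous γ) (hc : HasCompactSupport γ) (hs : tsupport γ ⊆ Ω) :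
    MemLp (fun x => a x * γ x) 2 μ :=
  (contOn_mul hΩ ha hγ hs).memLp_of_hasCompactSupport hc.mul_left

end Hilb
end SC

namespace SC
open MeasureTheory Filter
open scoped ContDiff ComplexConjugate ENNReal
set_option linter.unusedSectionVars false
set_option linter.style.haveILetI false

section Solve
variable {E : Type*} [NormedAddCommGroup E] [NormedSpace ℂ E] [FiniteDimensional ℂ E]
  [MeasurableSpace E] [BorelSpace E] (μ : Measure E) [μ.IsAddHaarMeasure]
variable {ι : Type*} [Fintype ι]

lemma awi_contOn {r : E → ℝ} (hr : Continuous r) (K : ℝ) :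
    ContinuousOn (fun x => ((aw r K x : ℂ))⁻¹) {x | r x < 1} :=
  (Complex.continuous_ofReal.comp_continuousOn (aw_contOn hr K)).inv₀
    (fun x hx => Complex.ofReal_ne_zero.2 (aw_ne hx))

lemma awc_contOn {r : E → ℝ} (hr : Continuous r) (K : ℝ) :
    ContinuousOn (fun x => ((aw r K x : ℂ))) {x | r x < 1} :=
  Complex.continuous_ofReal.comp_continuousOn (aw_contOn hr K)

lemma tsupport_conj (f : E → ℂ) : tsupport (fun x => conj (f x)) = tsupport f := by
  unfold tsupport; congr 1; ext x; simp

lemma q_memLp {r : E → ℝ} (hr : ContDiff ℝ ∞ r) (K : ℝ) (v : E) (γ : testF {x : E | r x < 1}) :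
    MemLp (fun x => (aw r K x : ℂ)⁻¹ * conj (db v γ x)) 2 μ := by
  have ht : tsupport (fun x => conj (db v γ.1 x)) ⊆ tsupport γ.1 := by
    rw [tsupport_conj]; exact tsupport_db_subset v
  exact contOn_mul_memLp μ (isOpen_lt hr.continuous continuous_const) (awi_contOn hr.continuous K)
    (contDiff_conj (contDiff_db γ.2.1 v)).continuous (hcs_of_tsupport γ.2.2.1 ht) (ht.trans γ.2.2.2)

/-- closed forms -/
def MM {r : E → ℝ} (hr : ContDiff ℝ ∞ r) (K : ℝ) (e : ι → E) :
    Submodule ℂ (PiLp 2 (fun _ : ι => Lp ℂ 2 μ)) where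
  carrier := {m | ∀ (j k : ι) (γ : testF {x : E | r x < 1}),
    inner ℂ ((q_memLp μ hr K (e j) γ).toLp) (m k) -
      inner ℂ ((q_memLp μ hr K (e k) γ).toLp) (m j) = 0}
  add_mem' := by
    intro a b ha hb j k γ
    have h1 := ha j k γ
    have h2 := hb j k γ
    simp only [PiLp.add_apply, inner_add_right]
    linear_combination h1 + h2
  zero_mem' := by
    intro j k γ; simp
  smul_mem' := by
    intro c a ha j k γ
    have h1 := ha j k γ
    simp only [PiLp.smul_apply, inner_smul_right]
    linear_combination c * h1

lemma MM_closed {r : E → ℝ} (hr : ContDiff ℝ ∞ r) (K : ℝ) (e : ι → E) :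
    IsClosed (MM μ hr K e : Set (PiLp 2 (fun _ : ι => Lp ℂ 2 μ))) := by
  have : (MM μ hr K e : Set (PiLp 2 (fun _ : ι => Lp ℂ 2 μ))) =
    {m | ∀ (j k : ι) (γ : testF {x : E | r x < 1}),
    inner ℂ ((q_memLp μ hr K (e j) γ).toLp) (m k) -
      inner ℂ ((q_memLp μ hr K (e k) γ).toLp) (m j) = 0} := rfl
  rw [this]
  simp only [ofPred_forall]
  refine isClosed_iInter fun j => isClosed_iInter fun k =>
    isClosed_iInter fun γ => isClosed_eq ?_ continuous_const
  fun_prop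

lemma mem_MM {r : E → ℝ} (hr : ContDiff ℝ ∞ r) (K : ℝ) (e : ι → E)
    (m : PiLp 2 (fun _ : ι => Lp ℂ 2 μ)) : m ∈ MM μ hr K e ↔
    ∀ j k, ∀ γ : E → ℂ, ContDiff ℝ ∞ γ → HasCompactSupport γ → tsupport γ ⊆ {x | r x < 1} →
      ∫ x, m k x / aw r K x * db (e j) γ x ∂μ - ∫ x, m j x / aw r K x * db (e k) γ x ∂μ = 0 := by
  have key : ∀ (j k : ι) (γ : testF {x : E | r x < 1}),
      inner ℂ ((q_memLp μ hr K (e j) γ).toLp) (m k) =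
        ∫ x, m k x / aw r K x * db (e j) γ x ∂μ := by
    intro j k γ
    rw [inner_toLp_left]
    congr 1; ext x
    rw [map_mul, map_inv₀, Complex.conj_ofReal, Complex.conj_conj]
    ring
  constructor
  · intro h j k γ h1 h2 h3
    have := h j k ⟨γ, h1, h2, h3⟩
    rw [key, key] at this
    exact this
  · intro h j k γ
    rw [key, key]
    exact h j k γ γ.2.1 γ.2.2.1 γ.2.2.2

/-- the operator `g ↦ (∑ ∂_j g_j) / √w₁` -/
def opA (r : E → ℝ) (K : ℝ) (e : ι → E) : (ι → testF {x : E | r x < 1}) →ₗ[ℂ] (E → ℂ) where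
  toFun g x := (1 - r x) / aw r K x * ∑ j, dd (e j) (g j) x
  map_add' a b := by
    ext x
    simp only [Pi.add_apply, ← mul_add, ← Finset.sum_add_distrib]
    congr 1
    refine Finset.sum_congr rfl fun j _ => ?_
    exact dd_add ((a j).2.1.differentiable (by simp) x) ((b j).2.1.differentiable (by simp) x)
  map_smul' c a := by
    ext x
    simp only [Pi.smul_apply, RingHom.id_apply, smul_eq_mul]
    rw [mul_left_comm]
    congr 1
    rw [Finset.mul_sum]
    refine Finset.sum_congr rfl fun j _ => ?_
    have : ((c • a j : testF {x : E | r x < 1}) : E → ℂ) = fun y => (fun _ => c) y * (a j).1 y := rfl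
    rw [this, dd_mul (by fun_prop) ((a j).2.1.differentiable (by simp) x)]
    simp [dd]

/-- the operator `g ↦ g / √w₂` -/
def opB (r : E → ℝ) (K : ℝ) : testF {x : E | r x < 1} →ₗ[ℂ] (E → ℂ) where
  toFun g x := (aw r K x : ℂ)⁻¹ * g.1 x
  map_add' a b := by
    ext x
    exact mul_add _ _ _
  map_smul' c a := by
    ext x
    exact mul_left_comm _ _ _

lemma opA_memLp {r : E → ℝ} (hr : ContDiff ℝ ∞ r) (K : ℝ) (e : ι → E)
    (g : ι → testF {x : E | r x < 1}) : MemLp (opA r K e g) 2 μ := by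
  have : opA r K e g = fun x => ∑ j, (1 - r x) * (aw r K x : ℂ)⁻¹ * dd (e j) (g j) x := by
    ext x; simp only [opA, LinearMap.coe_mk, AddHom.coe_mk, Finset.mul_sum]; rfl
  rw [this]
  refine memLp_finsetSum _ fun j _ => ?_
  refine contOn_mul_memLp μ (isOpen_lt hr.continuous continuous_const) ?_
    (contDiff_dd (g j).2.1 _).continuous (hcs_of_tsupport (g j).2.2.1 (tsupport_dd_subset _))
    ((tsupport_dd_subset _).trans (g j).2.2.2)
  exact (continuousOn_const.sub (Complex.continuous_ofReal.comp hr.continuous).continuousOn).mul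
    (awi_contOn hr.continuous K)

lemma opB_memLp {r : E → ℝ} (hr : ContDiff ℝ ∞ r) (K : ℝ)
    (g : testF {x : E | r x < 1}) : MemLp (opB r K g) 2 μ :=
  contOn_mul_memLp μ (isOpen_lt hr.continuous continuous_const) (awi_contOn hr.continuous K)
    g.2.1.continuous g.2.2.1 g.2.2.2

/-- vector version -/
def opBB {r : E → ℝ} (hr : ContDiff ℝ ∞ r) (K : ℝ) :
    (ι → testF {x : E | r x < 1}) →ₗ[ℂ] PiLp 2 (fun _ : ι => Lp ℂ 2 μ) :=
  (WithLp.linearEquiv 2 ℂ (ι → Lp ℂ 2 μ)).symm.toLinearMap ∘ₗ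
    LinearMap.pi (fun j => (toL2 μ (opB r K) (opB_memLp μ hr K)) ∘ₗ LinearMap.proj j)

lemma opBB_apply {r : E → ℝ} (hr : ContDiff ℝ ∞ r) (K : ℝ) (g : ι → testF {x : E | r x < 1}) (j : ι) :
    opBB μ hr K g j = (opB_memLp μ hr K (g j)).toLp := rfl

end Solve
end SC

namespace SC
open MeasureTheory Filter
open scoped ContDiff ComplexConjugate ENNReal
set_option linter.unusedSectionVars false
set_option linter.style.haveILetI false

section Solve2
variable {E : Type*} [NormedAddCommGroup E] [NormedSpace ℂ E] [FiniteDimensional ℂ E]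
  [MeasurableSpace E] [BorelSpace E] (μ : Measure E) [μ.IsAddHaarMeasure]
variable {ι : Type*} [Fintype ι]

lemma solve_dbar {r : E → ℝ} (hr : ContDiff ℝ ∞ r) (hrc : IsCompact {x | r x ≤ 1})
    (e : ι → E) {K : ℝ} (hK : 0 < K)
    (hlevi : ∀ x, r x < 1 → ∀ c : ι → ℂ,
      8 * (4 * (∑ j, ‖dd (e j) (fun y => (r y : ℂ)) x‖ ^ 2) + 1) * ∑ j, ‖c j‖ ^ 2 ≤
        K * levi r x (∑ j, c j • e j))
    (om : ι → E → ℂ) (hom : ∀ j, MemLp (fun x => aw r K x * om j x) 2 μ)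
    (hcl : ∀ j k, ∀ γ : E → ℂ, ContDiff ℝ ∞ γ → HasCompactSupport γ → tsupport γ ⊆ {x | r x < 1} →
      ∫ x, om k x * db (e j) γ x ∂μ - ∫ x, om j x * db (e k) γ x ∂μ = 0) :
    ∃ v : E → ℂ, MemLp v 2 μ ∧ ∫ x, ‖v x‖ ^ 2 ∂μ ≤ ∑ j, ∫ x, ‖aw r K x * om j x‖ ^ 2 ∂μ ∧
      ∀ j, ∀ γ : E → ℂ, ContDiff ℝ ∞ γ → HasCompactSupport γ → tsupport γ ⊆ {x | r x < 1} →
        ∫ x, ((1 - r x) / aw r K x * v x) * db (e j) γ x ∂μ = - ∫ x, om j x * γ x ∂μ := by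
  have : FiniteDimensional ℝ E := FiniteDimensional.complexToReal E
  set Ω := {x | r x < 1} with hΩ
  have hΩo : IsOpen Ω := isOpen_lt hr.continuous continuous_const
  have hne : ∀ x ∈ Ω, (aw r K x : ℂ) ≠ 0 := fun x hx => Complex.ofReal_ne_zero.2 (aw_ne hx)
  set M := MM μ hr K e with hM
  have hMc : IsClosed (M : Set (PiLp 2 (fun _ : ι => Lp ℂ 2 μ))) := MM_closed μ hr K e
  have : CompleteSpace M := hMc.completeSpace_coe
  set w : PiLp 2 (fun _ : ι => Lp ℂ 2 μ) := WithLp.toLp 2 (fun j => (hom j).toLp) with hw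
  have wj : ∀ j, w j = (hom j).toLp := fun j => rfl
  have hwM : w ∈ M := by
    rw [hM, mem_MM]
    intro j k γ h1 h2 h3
    have : ∀ j k, ∫ x, w k x / aw r K x * db (e j) γ x ∂μ = ∫ x, om k x * db (e j) γ x ∂μ := by
      intro j k
      refine integral_congr_ae ?_
      filter_upwards [(hom k).coeFn_toLp] with x hx
      rw [wj, hx]
      by_cases hxΩ : x ∈ Ω
      · rw [mul_div_cancel_left₀ _ (hne x hxΩ)]
      · rw [db_zero_of_notMem (fun h => hxΩ (h3 h))]; simp
    rw [this, this]
    exact hcl j k γ h1 h2 h3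
  have hwn : ‖w‖ ^ 2 = ∑ j, ∫ x, ‖aw r K x * om j x‖ ^ 2 ∂μ := by
    rw [PiLp.norm_sq_eq_of_L2]
    exact Finset.sum_congr rfl fun j _ => norm_toLp_sq μ (hom j)
  -- key estimate
  have est : ∀ g : ι → testF Ω, ‖inner ℂ w (opBB μ hr K g)‖ ≤
      ‖w‖ * ‖toL2 μ (opA r K e) (opA_memLp μ hr K e) g‖ := by
    intro g
    set m : PiLp 2 (fun _ : ι => Lp ℂ 2 μ) := M.starProjection (opBB μ hr K g) with hm
    have hmM : m ∈ M := M.starProjection_apply_mem _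
    have hort : ∀ z ∈ M, inner ℂ z (opBB μ hr K g) = inner ℂ z m := by
      intro z hz
      have := (Submodule.mem_orthogonal M _).1 (M.sub_starProjection_mem_orthogonal (opBB μ hr K g)) z hz
      rw [inner_sub_right] at this
      exact sub_eq_zero.1 this
    have hA := lemma_A μ hr hrc e hK hlevi (fun j => m j) (fun j => Lp.memLp _)
      ((mem_MM μ hr K e m).1 hmM) (fun x => ∑ j, dd (e j) (g j) x)
      (continuous_finsetSum _ fun j _ => (contDiff_dd (g j).2.1 _).continuous)
      (opA_memLp μ hr K e g) ?_
    · have hA' : ∑ j, ∫ x in Ω, ‖m j x‖ ^ 2 ∂μ ≤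
          ‖toL2 μ (opA r K e) (opA_memLp μ hr K e) g‖ ^ 2 :=
        hA.trans (le_of_eq (norm_toLp_sq μ (opA_memLp μ hr K e g)).symm)
      rw [hort w hwM]
      have hmi : ∀ j, MemLp (Ω.indicator (m j)) 2 μ := fun j =>
        (Lp.memLp (m j)).indicator hΩo.measurableSet
      set m' : PiLp 2 (fun _ : ι => Lp ℂ 2 μ) := WithLp.toLp 2 (fun j => (hmi j).toLp) with hm'
      have e1 : inner ℂ w m = inner ℂ w m' := by
        rw [PiLp.inner_apply, PiLp.inner_apply]
        refine Finset.sum_congr rfl fun j _ => ?_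
        rw [wj, inner_toLp_left, inner_toLp_left]
        refine integral_congr_ae ?_
        filter_upwards [(hmi j).coeFn_toLp] with x hx
        change _ = ((hmi j).toLp) x * _
        rw [hx]
        by_cases hxΩ : x ∈ Ω
        · rw [indicator_of_mem hxΩ]
        · have : aw r K x = 0 := by simp only [aw, if_neg (show ¬ r x < 1 from hxΩ)]
          simp [this]
      have e2 : ‖m'‖ ^ 2 = ∑ j, ∫ x in Ω, ‖m j x‖ ^ 2 ∂μ := by
        rw [PiLp.norm_sq_eq_of_L2]
        refine Finset.sum_congr rfl fun j _ => ?_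
        rw [← integral_indicator hΩo.measurableSet]
        refine (norm_toLp_sq μ (hmi j)).trans ?_
        congr 1; ext x
        by_cases hxΩ : x ∈ Ω
        · simp [hxΩ]
        · simp [hxΩ]
      rw [e1]
      refine (norm_inner_le_norm _ _).trans ?_
      gcongr
      rw [← e2] at hA'
      exact le_of_sq_le_sq hA' (norm_nonneg _)
    · intro γ h1 h2 h3
      have hcγ := contDiff_conj h1
      have tc : ∀ j, tsupport (db (e j) (fun x => conj (γ x))) ⊆ tsupport γ := fun j => by
        refine (tsupport_db_subset _).trans ?_; rw [tsupport_conj]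
      have hz : ∀ j, MemLp (fun x => (aw r K x : ℂ) * db (e j) (fun x => conj (γ x)) x) 2 μ := fun j =>
        contOn_mul_memLp μ hΩo (awc_contOn hr.continuous K) (contDiff_db hcγ _).continuous
          (hcs_of_tsupport h2 (tc j)) ((tc j).trans h3)
      set z : PiLp 2 (fun _ : ι => Lp ℂ 2 μ) := WithLp.toLp 2 (fun j => (hz j).toLp) with hzd
      have zj : ∀ j, z j = (hz j).toLp := fun j => rfl
      have hzM : z ∈ M := by
        rw [hM, mem_MM]
        intro j k γ' h1' h2' h3'
        have : ∀ j k, ∫ x, z k x / aw r K x * db (e j) γ' x ∂μ =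
            ∫ x, db (e j) γ' x * db (e k) (fun x => conj (γ x)) x ∂μ := by
          intro j k
          refine integral_congr_ae ?_
          filter_upwards [(hz k).coeFn_toLp] with x hx
          rw [zj, hx]
          by_cases hxΩ : x ∈ Ω
          · rw [mul_div_cancel_left₀ _ (hne x hxΩ), mul_comm]
          · rw [db_zero_of_notMem (fun h => hxΩ (h3' h))]; simp
        rw [this, this]
        have p := fun j k => int_parts_db μ h1' (contDiff_db hcγ (e k)) h2' (e j)
        have q : ∫ x, γ' x * db (e j) (db (e k) (fun x => conj (γ x))) x ∂μ =
            ∫ x, γ' x * db (e k) (db (e j) (fun x => conj (γ x))) x ∂μ := by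
          congr 1; ext x; rw [db_db_comm hcγ]
        linear_combination p j k - p k j - q
      have hin := hort z hzM
      rw [PiLp.inner_apply, PiLp.inner_apply] at hin
      have cj : ∀ j x, conj (db (e j) (fun x => conj (γ x)) x) = dd (e j) γ x := fun j x => by
        rw [db_conj (h1.differentiable (by simp) x), Complex.conj_conj]
      have l1 : ∀ j, inner ℂ (z j) (opBB μ hr K g j) = - ∫ x, dd (e j) (g j) x * γ x ∂μ := by
        intro j
        rw [← int_parts_dd μ (g j).2.1 h1 (g j).2.2.1, zj, inner_toLp_left, opBB_apply]
        refine integral_congr_ae ?_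
        filter_upwards [(opB_memLp μ hr K (g j)).coeFn_toLp] with x hx
        rw [hx, map_mul, cj, Complex.conj_ofReal]
        change ((aw r K x : ℂ)⁻¹ * (g j).1 x) * _ = _
        by_cases hxΩ : x ∈ Ω
        · have := hne x hxΩ
          field_simp
        · rw [dd_zero_of_notMem (fun h => hxΩ (h3 h))]; simp
      have l2 : ∀ j, inner ℂ (z j) (m j) = ∫ x, aw r K x * m j x * dd (e j) γ x ∂μ := by
        intro j
        rw [zj, inner_toLp_left]
        congr 1; ext x
        rw [map_mul, cj, Complex.conj_ofReal]; ring
      simp only [l1, l2] at hin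
      rw [← hin, Finset.sum_neg_distrib, ← integral_finsetSum]
      · congr 2; ext x; rw [Finset.sum_mul]
      · intro j _
        exact ((contDiff_dd (g j).2.1 _).continuous.mul h1.continuous).integrable_of_hasCompactSupport
          h2.mul_left
  obtain ⟨v, hv1, hv2⟩ := hilbert_solve (toL2 μ (opA r K e) (opA_memLp μ hr K e))
    (-((innerSL ℂ w).toLinearMap ∘ₗ opBB μ hr K)) ‖w‖ (norm_nonneg _) (fun g => by
      simpa using est g)
  refine ⟨v, Lp.memLp v, ?_, ?_⟩
  · rw [← hwn, ← norm_toLp_sq μ (Lp.memLp v), Lp.toLp_coeFn]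
    gcongr
  · intro j γ h1 h2 h3
    classical
    have hcγ := contDiff_conj h1
    set γc : testF Ω := ⟨fun x => conj (γ x), hcγ, hcs_of_tsupport h2 (by rw [tsupport_conj]),
      by rw [tsupport_conj]; exact h3⟩ with hγc
    have h := congrArg conj (hv2 (Pi.single j γc))
    rw [inner_conj_symm] at h
    have hl : inner ℂ (toL2 μ (opA r K e) (opA_memLp μ hr K e) (Pi.single j γc)) v =
        ∫ x, ((1 - r x) / aw r K x * v x) * db (e j) γ x ∂μ := by
      refine (inner_toLp_left μ (opA_memLp μ hr K e (Pi.single j γc)) v).trans ?_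
      congr 1; ext x
      have : opA r K e (Pi.single j γc) x = (1 - r x) / aw r K x * conj (db (e j) γ x) := by
        simp only [opA, LinearMap.coe_mk, AddHom.coe_mk]
        rw [Finset.sum_eq_single j]
        · rw [Pi.single_eq_same]
          congr 1
          rw [hγc]
          exact dd_conj (h1.differentiable (by simp) x)
        · intro k _ hk
          rw [Pi.single_eq_of_ne hk]
          have : ((0 : testF Ω) : E → ℂ) = fun _ => 0 := rfl
          rw [this]; simp [dd]
        · simp
      rw [this]
      simp only [map_mul, map_div₀, map_sub, map_one, Complex.conj_ofReal, Complex.conj_conj]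
      ring
    have hr' : inner ℂ (opBB μ hr K (Pi.single j γc)) w = ∫ x, om j x * γ x ∂μ := by
      rw [PiLp.inner_apply, Finset.sum_eq_single j]
      · rw [opBB_apply, inner_toLp_left]
        refine integral_congr_ae ?_
        filter_upwards [(hom j).coeFn_toLp] with x hx
        rw [wj, hx]
        have : opB r K ((Pi.single j γc : ι → testF Ω) j) x = (aw r K x : ℂ)⁻¹ * conj (γ x) := by
          rw [Pi.single_eq_same]; rfl
        rw [this]
        simp only [map_mul, map_inv₀, Complex.conj_ofReal, Complex.conj_conj]
        by_cases hxΩ : x ∈ Ω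
        · have := hne x hxΩ
          field_simp
        · rw [image_eq_zero_of_notMem_tsupport (fun h => hxΩ (h3 h))]; simp
      · intro k _ hk
        have : opBB μ hr K (Pi.single j γc) k = 0 := by
          change toL2 μ (opB r K) (opB_memLp μ hr K) ((Pi.single j γc : ι → testF Ω) k) = 0
          rw [Pi.single_eq_of_ne hk, map_zero]
        rw [this, inner_zero_left]
      · simp
    rw [hl] at h
    rw [h, ← hr']
    simp [inner_conj_symm]

end Solve2
end SC

namespace SC
open MeasureTheory Filter
open scoped ContDiff ComplexConjugate ENNReal
set_option linter.unusedSectionVars false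
set_option linter.style.haveILetI false

section Kernel
variable {E : Type*} [NormedAddCommGroup E] [NormedSpace ℂ E] [FiniteDimensional ℂ E]
  [MeasurableSpace E] [BorelSpace E] (μ : Measure E) [μ.IsAddHaarMeasure]

lemma integral_rot (f : E → ℂ) {a : ℂ} (ha : ‖a‖ = 1) : ∫ x, f (a • x) ∂μ = ∫ x, f x ∂μ := by
  have : FiniteDimensional ℝ E := FiniteDimensional.complexToReal E
  have ha0 : a ≠ 0 := by rintro rfl; simp at ha
  have hh : (μ.map (Homeomorph.smulOfNeZero (α := E) a ha0)).IsAddHaarMeasure :=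
    AddEquiv.isAddHaarMeasure_map μ (DistribMulAction.toAddEquiv₀ E a ha0)
      (Homeomorph.smulOfNeZero a ha0).continuous (Homeomorph.smulOfNeZero a ha0).symm.continuous
  have he : μ.map (Homeomorph.smulOfNeZero (α := E) a ha0) = μ := by
    have h1 := Measure.isAddLeftInvariant_eq_smul (μ.map (Homeomorph.smulOfNeZero (α := E) a ha0)) μ
    set c := Measure.addHaarScalarFactor (μ.map (Homeomorph.smulOfNeZero (α := E) a ha0)) μ
    have h2 := congrArg (fun ν => ν (Metric.closedBall (0 : E) 1)) h1
    have h9 := (Homeomorph.smulOfNeZero (α := E) a ha0).toMeasurableEquiv.map_apply (μ := μ) (Metric.closedBall (0 : E) 1)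
    replace h2 := h9.symm.trans h2
    have h3 : (Homeomorph.smulOfNeZero (α := E) a ha0).toMeasurableEquiv ⁻¹' (Metric.closedBall (0 : E) 1)
        = Metric.closedBall (0 : E) 1 := by
      ext x
      simp [norm_smul, ha]
    rw [h3, Measure.smul_apply] at h2
    have h4 : μ (Metric.closedBall (0 : E) 1) ≠ 0 := (Metric.measure_closedBall_pos μ _ one_pos).ne'
    have h5 : μ (Metric.closedBall (0 : E) 1) ≠ ⊤ := (isCompact_closedBall _ _).measure_lt_top.ne
    have h6 : c = 1 := by
      have : (c : ℝ≥0∞) = 1 := by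
        have h7 : (1 : ℝ≥0∞) * μ (Metric.closedBall (0 : E) 1) = c * μ (Metric.closedBall (0 : E) 1) := by
          rw [one_mul]; exact h2
        exact ((ENNReal.mul_left_inj h4 h5).1 h7).symm
      exact_mod_cast this
    rw [h1, h6, one_smul]
  have := (Homeomorph.smulOfNeZero (α := E) a ha0).toMeasurableEquiv.measurableEmbedding.integral_map
    (μ := μ) f
  have h8 : (⇑(Homeomorph.smulOfNeZero (α := E) a ha0).toMeasurableEquiv) =
    ⇑(Homeomorph.smulOfNeZero (α := E) a ha0) := rfl
  rw [h8, he] at this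
  rw [this]; rfl

lemma kernel_mean {k : E → ℂ} (hk : Continuous k) {κ' κ : ℝ} (hκ : κ' < κ)
    (hs : ∀ w, κ' ≤ ‖w‖ → k w = 0) (hrot : ∀ (a : ℂ) w, ‖a‖ = 1 → k (a • w) = k w)
    {p : E} {H : E → ℂ} (hH : DifferentiableOn ℂ H (Metric.ball p κ)) :
    ∫ t, H t * k (p - t) ∂μ = H p * ∫ t, k t ∂μ := by
  have : FiniteDimensional ℝ E := FiniteDimensional.complexToReal E
  set D := Metric.closedBall (0 : E) κ' with hD
  have hDc : IsCompact D := isCompact_closedBall _ _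
  have hmem : ∀ w ∈ D, ∀ a : ℂ, ‖a‖ ≤ 1 → p - a • w ∈ Metric.ball p κ := by
    intro w hw a ha
    rw [Metric.mem_ball, dist_eq_norm]
    simp only [sub_sub_cancel_left, norm_neg, norm_smul]
    simp [hD] at hw
    nlinarith [norm_nonneg w, norm_nonneg a]
  have h1 : ∫ t, H t * k (p - t) ∂μ = ∫ w, H (p - w) * k w ∂μ := by
    rw [← integral_sub_left_eq_self (fun w => H (p - w) * k w) μ p]
    simp
  have h2 : ∀ θ : ℝ, ∫ w, H (p - circleMap 0 1 θ • w) * k w ∂μ = ∫ w, H (p - w) * k w ∂μ := by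
    intro θ
    rw [← integral_rot μ (fun w => H (p - w) * k w) (a := circleMap 0 1 θ) (by simp)]
    congr 1; ext w
    rw [hrot _ _ (by simp)]
  have hset : ∀ f : E → ℂ, ∫ w in D, f w * k w ∂μ = ∫ w, f w * k w ∂μ := by
    intro f
    apply setIntegral_eq_integral_of_forall_compl_eq_zero
    intro w hw
    rw [hs w (by simp [hD] at hw; exact hw.le), mul_zero]
  have hswap : ∫ θ in Ioc 0 (2 * Real.pi), (∫ w in D, H (p - circleMap 0 1 θ • w) * k w ∂μ) =
      ∫ w in D, (∫ θ in Ioc 0 (2 * Real.pi), H (p - circleMap 0 1 θ • w) * k w) ∂μ := by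
    apply integral_integral_swap
    rw [Measure.prod_restrict]
    apply IntegrableOn.mono_set (t := Icc 0 (2 * Real.pi) ×ˢ D)
    · apply ContinuousOn.integrableOn_compact (isCompact_Icc.prod hDc)
      apply ContinuousOn.mul
      · apply hH.continuousOn.comp
        · have := continuous_circleMap 0 1
          fun_prop
        · rintro ⟨θ, w⟩ ⟨_, hw⟩
          exact hmem w hw _ (by simp)
      · fun_prop
    · exact prod_mono Ioc_subset_Icc_self le_rfl
  have hmv : ∀ w ∈ D, ∫ θ in Ioc 0 (2 * Real.pi), H (p - circleMap 0 1 θ • w) * k w =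
      (2 * Real.pi) * (H p * k w) := by
    intro w hw
    have hd : DiffContOnCl ℂ (fun ζ : ℂ => H (p - ζ • w)) (Metric.ball 0 |1|) := by
      have : DifferentiableOn ℂ (fun ζ : ℂ => H (p - ζ • w)) (Metric.closedBall 0 |1|) := by
        apply hH.comp
        · fun_prop
        · intro ζ hζ
          exact hmem w hw ζ (by simpa using hζ)
      apply DifferentiableOn.diffContOnCl
      exact this.mono Metric.closure_ball_subset_closedBall
    have := hd.circleAverage
    rw [Real.circleAverage_def, intervalIntegral.integral_of_le (by positivity)] at this
    rw [integral_mul_const]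
    simp only [zero_smul, sub_zero] at this
    rw [← this]
    simp only [Complex.real_smul]
    push_cast
    have : (Real.pi : ℂ) ≠ 0 := by exact_mod_cast Real.pi_ne_zero
    field_simp
  rw [h1]
  have e1 : ∫ θ in Ioc 0 (2 * Real.pi), (∫ w in D, H (p - circleMap 0 1 θ • w) * k w ∂μ) =
      (2 * Real.pi) * ∫ w, H (p - w) * k w ∂μ := by
    simp only [hset (fun w => H (p - circleMap 0 1 _ • w)), h2]
    simp [Real.pi_pos.le]
  have e2 : ∫ w in D, (∫ θ in Ioc 0 (2 * Real.pi), H (p - circleMap 0 1 θ • w) * k w) ∂μ =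
      (2 * Real.pi) * (H p * ∫ w, k w ∂μ) := by
    rw [setIntegral_congr_fun hDc.measurableSet hmv, integral_const_mul]
    rw [hset (fun _ => H p), integral_const_mul]
  rw [e1, e2] at hswap
  have : (2 * Real.pi : ℂ) ≠ 0 := by exact_mod_cast (by positivity : (2 * Real.pi) ≠ 0)
  exact mul_left_cancel₀ this hswap

lemma exists_kernel {κ : ℝ} (hκ : 0 < κ) : ∃ k : E → ℂ, ContDiff ℝ ∞ k ∧ HasCompactSupport k ∧
    (∀ w, κ / 2 ≤ ‖w‖ → k w = 0) ∧ (∀ (a : ℂ) w, ‖a‖ = 1 → k (a • w) = k w) ∧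
    ∫ t, k t ∂μ = 1 ∧ ∫ t, ‖k t‖ ∂μ = 1 := by
  have : FiniteDimensional ℝ E := FiniteDimensional.complexToReal E
  set L : E ≃L[ℂ] EuclideanSpace ℂ (Fin (Module.finrank ℂ E)) :=
    ContinuousLinearEquiv.ofFinrankEq (by simp) with hL
  -- ‖w‖ ≤ C ‖L w‖
  set C := ‖(L.symm : EuclideanSpace ℂ (Fin (Module.finrank ℂ E)) →L[ℂ] E)‖ + 1 with hC
  have hC0 : 0 < C := by positivity
  have hLw : ∀ w, ‖w‖ ≤ C * ‖L w‖ := by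
    intro w
    have := (L.symm : EuclideanSpace ℂ (Fin (Module.finrank ℂ E)) →L[ℂ] E).le_opNorm (L w)
    simp only [ContinuousLinearEquiv.coe_coe, ContinuousLinearEquiv.symm_apply_apply] at this
    nlinarith [norm_nonneg (L w)]
  set g : E → ℝ := fun w => Real.smoothTransition (1 - (2 * C / κ) ^ 2 * ‖L w‖ ^ 2) with hg
  have hgc : ContDiff ℝ ∞ g := by
    apply (Real.smoothTransition.contDiff (n := ⊤)).comp
    apply contDiff_const.sub
    apply contDiff_const.mul
    apply ContDiff.norm_sq ℂ
    exact ((L : E →L[ℂ] EuclideanSpace ℂ (Fin (Module.finrank ℂ E))).restrictScalars ℝ).contDiff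
  have hg0 : ∀ w, κ / 2 ≤ ‖w‖ → g w = 0 := by
    intro w hw
    apply Real.smoothTransition.zero_of_nonpos
    have h1 : κ / 2 ≤ C * ‖L w‖ := hw.trans (hLw w)
    have h2 : 1 ≤ (2 * C / κ) * ‖L w‖ := by
      rw [div_mul_eq_mul_div, le_div_iff₀ hκ]; linarith
    have : 1 ≤ ((2 * C / κ) * ‖L w‖) ^ 2 := one_le_pow₀ h2
    rw [mul_pow] at this; linarith
  have hgn : ∀ w, 0 ≤ g w := fun w => Real.smoothTransition.nonneg _
  have hgs : HasCompactSupport g := by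
    apply HasCompactSupport.intro (isCompact_closedBall (0 : E) (κ / 2))
    intro x hx
    apply hg0
    simp at hx; exact hx.le
  have hgi : Integrable g μ := hgc.continuous.integrable_of_hasCompactSupport hgs
  have hpos : 0 < ∫ t, g t ∂μ := by
    apply hgc.continuous.integral_pos_of_hasCompactSupport_nonneg_nonzero hgs hgn (x := 0)
    simp [hg]
  set c := ∫ t, g t ∂μ with hc
  refine ⟨fun w => ((g w / c : ℝ) : ℂ), ?_, ?_, ?_, ?_, ?_, ?_⟩
  · exact Complex.ofRealCLM.contDiff.comp (hgc.div_const c)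
  · apply hgs.mono'
    intro x hx
    apply subset_tsupport
    intro h; apply hx; simp [h]
  · intro w hw; simp [hg0 w hw]
  · intro a w ha
    simp [hg, norm_smul, ha]
  · rw [integral_complex_ofReal, integral_div, ← hc, div_self hpos.ne']; simp
  · simp only [Complex.norm_real, Real.norm_eq_abs]
    have : ∀ t, |g t / c| = g t / c := fun t => abs_of_nonneg (div_nonneg (hgn t) hpos.le)
    simp only [this]
    rw [integral_div, ← hc, div_self hpos.ne']

end Kernel
end SC

namespace SC
open MeasureTheory Filter
open scoped ContDiff ComplexConjugate ENNReal
set_option linter.unusedSectionVars false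
set_option linter.style.haveILetI false

section Approx
variable {E : Type*} [NormedAddCommGroup E] [NormedSpace ℂ E] [FiniteDimensional ℂ E]
  [MeasurableSpace E] [BorelSpace E] (μ : Measure E) [μ.IsAddHaarMeasure]
variable {ι : Type*} [Fintype ι]

lemma differentiableAt_of_db (e : Module.Basis ι ℂ E) {F : E → ℂ} {x : E}
    (hF : DifferentiableAt ℝ F x) (h : ∀ j, db (e j) F x = 0) : DifferentiableAt ℂ F x := by
  have hv : ∀ v, fderiv ℝ F x (Complex.I • v) = Complex.I * fderiv ℝ F x v := by
    intro v
    have h1 : db v F x = 0 := by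
      rw [← e.sum_repr v, db_dir_sum]
      simp [h]
    rw [db] at h1
    have h2 : fderiv ℝ F x v + Complex.I * fderiv ℝ F x (Complex.I • v) = 0 := by
      simpa using h1
    linear_combination (-Complex.I) * h2 + (fderiv ℝ F x (Complex.I • v)) * Complex.I_mul_I
  rw [differentiableAt_iff_restrictScalars ℝ hF]
  refine ⟨{ toFun := fderiv ℝ F x, map_add' := map_add _, map_smul' := ?_, cont := (fderiv ℝ F x).cont }, rfl⟩
  intro c v
  have h3 : c • v = c.re • v + c.im • (Complex.I • v) := by
    rw [← Complex.coe_smul, ← Complex.coe_smul, smul_smul, ← add_smul, Complex.re_add_im]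
  rw [h3, map_add, map_smul, map_smul, hv]
  simp only [RingHom.id_apply, smul_eq_mul, Complex.real_smul]
  linear_combination (fderiv ℝ F x v) * (Complex.re_add_im c)

lemma cs_L2 {f g : E → ℂ} (hf : MemLp f 2 μ) (hg : MemLp g 2 μ) :
    ‖∫ x, g x * f x ∂μ‖ ≤ √(∫ x, ‖g x‖ ^ 2 ∂μ) * √(∫ x, ‖f x‖ ^ 2 ∂μ) := by
  have hfc : MemLp (fun x => conj (f x)) 2 μ := by
    refine MemLp.of_le hf (Complex.continuous_conj.comp_aestronglyMeasurable hf.1) ?_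
    exact Eventually.of_forall fun x => by simp
  have h1 : inner ℂ (hfc.toLp) (hg.toLp) = ∫ x, g x * f x ∂μ := by
    rw [inner_toLp_left]
    refine integral_congr_ae ?_
    filter_upwards [hg.coeFn_toLp] with x hx
    rw [hx, Complex.conj_conj]
  rw [← h1]
  refine (norm_inner_le_norm _ _).trans (le_of_eq ?_)
  rw [mul_comm]
  congr 1
  · rw [← norm_toLp_sq μ hg, Real.sqrt_sq (norm_nonneg _)]
  · have := norm_toLp_sq μ hfc
    simp only [RCLike.norm_conj] at this
    rw [← this, Real.sqrt_sq (norm_nonneg _)]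

lemma aw_le {r : E → ℝ} {K : ℝ} (hK : 0 < K) (x : E) : |aw r K x| ≤ 2 / K := by
  unfold aw
  split_ifs with h
  · set s := 1 / (1 - r x) with hs
    have hs0 : 0 < s := by rw [hs]; exact one_div_pos.2 (by linarith)
    rw [abs_of_nonneg (by positivity)]
    have h1 := Real.add_one_le_exp (K * s / 2)
    have h2 : Real.exp (-(K * s) / 2) = (Real.exp (K * s / 2))⁻¹ := by
      rw [← Real.exp_neg]; congr 1; ring
    rw [h2, ← div_eq_mul_inv, div_le_div_iff₀ (Real.exp_pos _) hK]
    nlinarith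
  · simp; positivity

lemma dbar_approx (μ : Measure E) [μ.IsAddHaarMeasure] {r : E → ℝ} (hr : ContDiff ℝ ∞ r) (hrc : IsCompact {x | r x ≤ 1})
    (e : Module.Basis ι ℂ E) {K : ℝ} (hK : 0 < K)
    (hlevi : ∀ x, r x < 1 → ∀ c : ι → ℂ,
      8 * (4 * (∑ j, ‖dd (e j) (fun y => (r y : ℂ)) x‖ ^ 2) + 1) * ∑ j, ‖c j‖ ^ 2 ≤
        K * levi r x (∑ j, c j • e j))
    {A : Set E} (hA : IsCompact A) {κ : ℝ} (hκ : 0 < κ)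
    (hAκ : Metric.cthickening (2 * κ) A ⊆ {x | r x < 1}) :
    ∃ C : ℝ, 0 ≤ C ∧ ∀ G : E → ℂ, ContDiff ℝ ∞ G → ∀ ε : ℝ, 0 ≤ ε →
      (∀ x, r x < 1 → ∀ j, ‖db (e j) G x‖ ≤ ε) →
      ∃ F : E → ℂ, DifferentiableOn ℂ F (Metric.thickening κ A) ∧
        ∀ p ∈ A, ∀ (H : E → ℂ) (B : ℝ), DifferentiableOn ℂ H (Metric.ball p κ) →
          (∀ x ∈ Metric.ball p κ, ‖G x - H x‖ ≤ B) → ‖F p - H p‖ ≤ C * ε + B := by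
  have : FiniteDimensional ℝ E := FiniteDimensional.complexToReal E
  have : ProperSpace E := FiniteDimensional.proper ℝ E
  set Ω := {x | r x < 1} with hΩ
  have hΩo : IsOpen Ω := isOpen_lt hr.continuous continuous_const
  have hΩf : μ Ω ≠ ⊤ := ((measure_mono (fun x (hx : r x < 1) => hx.le)).trans_lt hrc.measure_lt_top).ne
  have hne : ∀ x ∈ Ω, (aw r K x : ℂ) ≠ 0 := fun x hx => Complex.ofReal_ne_zero.2 (aw_ne hx)
  obtain ⟨k, k1, k2, k3, k4, k5, k6⟩ := exists_kernel μ hκ (E := E)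
  set A' := Metric.cthickening (2 * κ) A with hA'
  have hA'c : IsCompact A' := hA.cthickening
  have hA'm : MeasurableSet A' := hA'c.measurableSet
  set q : E → ℂ := fun x => (1 - r x) / aw r K x with hq
  have hqc : ContinuousOn q A' := by
    apply ContinuousOn.mono _ hAκ
    exact (continuousOn_const.sub (Complex.continuous_ofReal.comp hr.continuous).continuousOn).mul
      (awi_contOn hr.continuous K)
  have hqm : Measurable q := by
    have h1 := measurable_aw hr.continuous K
    have h2 := hr.continuous.measurable
    fun_prop
  obtain ⟨Q0, hQ0⟩ := hA'c.exists_bound_of_continuousOn hqc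
  set Q := max Q0 0 with hQd
  have hQn : 0 ≤ Q := le_max_right _ _
  have hQ : ∀ x ∈ A', ‖q x‖ ≤ Q := fun x hx => (hQ0 x hx).trans (le_max_left _ _)
  set C1 := √(∑ j : ι, (2 / K) ^ 2 * μ.real Ω) with hC1
  refine ⟨Q * C1 * √(∫ x, ‖k x‖ ^ 2 ∂μ), by positivity, ?_⟩
  intro G hG ε hε hGε
  have hbd : ∀ j x, ‖(aw r K x : ℂ) * db (e j) G x‖ ≤ ‖Ω.indicator (fun _ => (2 / K * ε : ℝ)) x‖ := by
    intro j x
    by_cases hx : x ∈ Ω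
    · rw [indicator_of_mem hx, norm_mul, Complex.norm_real, Real.norm_eq_abs, Real.norm_eq_abs,
        abs_of_nonneg (by positivity : 0 ≤ 2 / K * ε)]
      exact mul_le_mul (aw_le hK x) (hGε x hx j) (norm_nonneg _) (by positivity)
    · have : aw r K x = 0 := by simp only [aw, if_neg (show ¬ r x < 1 from hx)]
      simp [this, hx]
  have hind : MemLp (Ω.indicator (fun _ => (2 / K * ε : ℝ))) 2 μ :=
    memLp_indicator_const 2 hΩo.measurableSet _ (Or.inr hΩf)
  have hom : ∀ j, MemLp (fun x => (aw r K x : ℂ) * db (e j) G x) 2 μ := by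
    intro j
    refine MemLp.mono hind ?_ (Eventually.of_forall (hbd j))
    have h1 := measurable_aw hr.continuous K
    have h2 := (contDiff_db hG (e j)).continuous.measurable
    exact (Measurable.mul (by fun_prop) h2).aestronglyMeasurable
  obtain ⟨v, v1, v2, v3⟩ := solve_dbar μ hr hrc e hK hlevi (fun j => db (e j) G) hom (by
    intro j k γ h1 h2 h3
    have p := fun j k => int_parts_db μ h1 (contDiff_db hG (e k)) h2 (e j)
    have q : ∫ x, γ x * db (e j) (db (e k) G) x ∂μ = ∫ x, γ x * db (e k) (db (e j) G) x ∂μ := by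
      congr 1; ext x; rw [db_db_comm hG]
    simp only [mul_comm (db (e _) G _)]
    linear_combination p j k - p k j - q)
  have v2' : ∫ x, ‖v x‖ ^ 2 ∂μ ≤ (C1 * ε) ^ 2 := by
    refine v2.trans ?_
    rw [mul_pow, Real.sq_sqrt (by positivity), Finset.sum_mul]
    refine Finset.sum_le_sum fun j _ => ?_
    calc ∫ x, ‖(aw r K x : ℂ) * db (e j) G x‖ ^ 2 ∂μ
        ≤ ∫ x, Ω.indicator (fun _ => (2 / K * ε) ^ 2) x ∂μ := by
          apply integral_mono
          · exact (hom j).norm.integrable_sq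
          · exact (integrable_indicator_iff hΩo.measurableSet).2 (integrableOn_const hΩf)
          · intro x
            have := hbd j x
            by_cases hx : x ∈ Ω
            · rw [indicator_of_mem hx] at this ⊢
              rw [Real.norm_of_nonneg (by positivity : 0 ≤ 2 / K * ε)] at this
              simp only
              gcongr
            · rw [indicator_of_notMem hx] at this ⊢
              have h0 : ‖(aw r K x : ℂ) * db (e j) G x‖ = 0 := le_antisymm (by simpa using this) (norm_nonneg _)
              simp only [h0]; simp
      _ = (2 / K) ^ 2 * μ.real Ω * ε ^ 2 := by
          rw [integral_indicator hΩo.measurableSet, setIntegral_const, smul_eq_mul]; ring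
  set g1 : E → ℂ := A'.indicator G with hg1
  set g2 : E → ℂ := A'.indicator (fun x => q x * v x) with hg2
  have hg1L : MemLp g1 2 μ := by
    obtain ⟨b, hb⟩ := hA'c.exists_bound_of_continuousOn hG.continuous.continuousOn
    refine MemLp.mono (memLp_indicator_const 2 hA'm b (Or.inr hA'c.measure_lt_top.ne))
      (hG.continuous.measurable.indicator hA'm).aestronglyMeasurable (Eventually.of_forall fun x => ?_)
    by_cases hx : x ∈ A'
    · simp only [hg1, indicator_of_mem hx]; exact (hb x hx).trans (le_abs_self _)
    · simp [hg1, hx]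
  have hg2b : ∀ x, ‖g2 x‖ ≤ Q * ‖v x‖ := by
    intro x
    by_cases hx : x ∈ A'
    · simp only [hg2, indicator_of_mem hx, norm_mul]
      exact mul_le_mul_of_nonneg_right (hQ x hx) (norm_nonneg _)
    · simp only [hg2, indicator_of_notMem hx, norm_zero]; positivity
  have hg2L : MemLp g2 2 μ := by
    refine MemLp.of_le_mul (c := Q) v1 ?_ (Eventually.of_forall hg2b)
    exact (hqm.aestronglyMeasurable.mul v1.1).indicator hA'm
  have hg1l : LocallyIntegrable g1 μ := hg1L.locallyIntegrable (by norm_num)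
  have hg2l : LocallyIntegrable g2 μ := hg2L.locallyIntegrable (by norm_num)
  refine ⟨fun x => mo μ g1 k x - mo μ g2 k x, ?_, ?_⟩
  · intro x hx
    refine (differentiableAt_of_db e ?_ ?_).differentiableWithinAt
    · exact ((mo_contDiff μ hg1l k1 k2).differentiable (by simp) x).sub
        ((mo_contDiff μ hg2l k1 k2).differentiable (by simp) x)
    · intro j
      rw [db_sub ((mo_contDiff μ hg1l k1 k2).differentiable (by simp) x)
        ((mo_contDiff μ hg2l k1 k2).differentiable (by simp) x), mo_db μ hg1l k1 k2, mo_db μ hg2l k1 k2]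
      set γ : E → ℂ := fun t => k (x - t) with hγ
      have c1 : ContDiff ℝ ∞ γ := refl_contDiff k1 x
      have c2 : HasCompactSupport γ := refl_hcs k2 x
      have c3 : tsupport γ ⊆ A' := by
        have h1 : tsupport γ ⊆ Metric.closedBall x (κ / 2) := by
          apply closure_minimal _ Metric.isClosed_closedBall
          intro t ht
          by_contra hh
          apply ht
          apply k3
          rw [Metric.mem_closedBall, dist_comm, dist_eq_norm, not_le] at hh
          exact hh.le
        refine h1.trans ?_
        intro t ht
        obtain ⟨y, hy, hxy⟩ := Metric.mem_thickening_iff.1 hx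
        apply Metric.mem_cthickening_of_dist_le t y _ _ hy
        have := dist_triangle t x y
        rw [Metric.mem_closedBall] at ht
        linarith
      have d1 : mo μ g1 (db (e j) k) x = - ∫ t, G t * db (e j) γ t ∂μ := by
        rw [mo, ← integral_neg]
        congr 1; ext t
        rw [hγ, db_refl k1]
        by_cases ht : t ∈ A'
        · simp [hg1, ht]
        · have := db_zero_of_notMem (v := e j) (fun h => ht (c3 h))
          rw [hγ, db_refl k1] at this
          rw [this, neg_eq_zero.1 this]; simp
      have d2 : mo μ g2 (db (e j) k) x = - ∫ t, (q t * v t) * db (e j) γ t ∂μ := by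
        rw [mo, ← integral_neg]
        congr 1; ext t
        rw [hγ, db_refl k1]
        by_cases ht : t ∈ A'
        · simp [hg2, ht]
        · have := db_zero_of_notMem (v := e j) (fun h => ht (c3 h))
          rw [hγ, db_refl k1] at this
          rw [this, neg_eq_zero.1 this]; simp
      rw [d1, d2, v3 j γ c1 c2 (c3.trans hAκ)]
      have p := int_parts_db μ c1 hG c2 (e j)
      simp only [mul_comm (G _), mul_comm (db (e _) G _)]
      linear_combination -p
  · intro p hp H B hH hB
    have hm := kernel_mean μ k1.continuous (κ' := κ / 2) (by linarith) k3 k4 hH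
    rw [k5, mul_one] at hm
    have hin : ∀ t, t ∉ Metric.closedBall p (κ / 2) → k (p - t) = 0 := by
      intro t hh
      apply k3
      rw [Metric.mem_closedBall, dist_comm, dist_eq_norm, not_le] at hh
      exact hh.le
    have hHi : Integrable (fun t => H t * k (p - t)) μ := by
      apply IntegrableOn.integrable_of_forall_notMem_eq_zero (s := Metric.closedBall p (κ / 2))
      · apply ContinuousOn.integrableOn_compact (isCompact_closedBall _ _)
        apply ContinuousOn.mul
        · exact hH.continuousOn.mono (Metric.closedBall_subset_ball (by linarith))
        · exact (k1.continuous.comp (continuous_const.sub continuous_id)).continuousOn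
      · intro t ht; rw [hin t ht, mul_zero]
    have hki : Integrable (fun t => ‖k (p - t)‖) μ :=
      ((refl_contDiff k1 p).continuous.norm).integrable_of_hasCompactSupport (refl_hcs k2 p).norm
    have hg1i := mo_integrable μ hg1l k1.continuous k2 p
    have b1 : ‖mo μ g1 k p - H p‖ ≤ B := by
      rw [← hm, mo, ← integral_sub hg1i hHi]
      calc _ ≤ ∫ t, B * ‖k (p - t)‖ ∂μ := by
            apply norm_integral_le_of_norm_le (hki.const_mul B)
            refine Eventually.of_forall fun t => ?_
            by_cases ht : t ∈ Metric.closedBall p (κ / 2)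
            · have htA : t ∈ A' := by
                apply Metric.mem_cthickening_of_dist_le t p _ _ hp
                rw [Metric.mem_closedBall] at ht; linarith
              rw [← sub_mul, norm_mul]
              apply mul_le_mul_of_nonneg_right _ (norm_nonneg _)
              simp only [hg1, indicator_of_mem htA]
              exact hB t (Metric.closedBall_subset_ball (by linarith) ht)
            · rw [hin t ht]; simp
        _ = B := by
            rw [integral_const_mul, integral_sub_left_eq_self (fun t => ‖k t‖) μ p, k6, mul_one]
    have b2 : ‖mo μ g2 k p‖ ≤ Q * C1 * √(∫ x, ‖k x‖ ^ 2 ∂μ) * ε := by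
      have hkL : MemLp (fun t => k (p - t)) 2 μ :=
        (refl_contDiff k1 p).continuous.memLp_of_hasCompactSupport (refl_hcs k2 p)
      refine (cs_L2 μ hkL hg2L).trans ?_
      rw [integral_sub_left_eq_self (fun t => ‖k t‖ ^ 2) μ p]
      have : √(∫ x, ‖g2 x‖ ^ 2 ∂μ) ≤ Q * (C1 * ε) := by
        apply Real.sqrt_le_iff.2 ⟨by positivity, ?_⟩
        calc ∫ x, ‖g2 x‖ ^ 2 ∂μ ≤ ∫ x, Q ^ 2 * ‖v x‖ ^ 2 ∂μ := by
              apply integral_mono hg2L.norm.integrable_sq (v1.norm.integrable_sq.const_mul _)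
              intro x
              have := hg2b x
              simp only
              rw [← mul_pow]
              gcongr
          _ ≤ Q ^ 2 * (C1 * ε) ^ 2 := by
              rw [integral_const_mul]; gcongr
          _ = _ := by ring
      calc _ ≤ Q * (C1 * ε) * √(∫ x, ‖k x‖ ^ 2 ∂μ) := by gcongr
        _ = _ := by ring
    have := norm_sub_le (mo μ g1 k p - H p) (mo μ g2 k p)
    rw [show mo μ g1 k p - mo μ g2 k p - H p = mo μ g1 k p - H p - mo μ g2 k p by ring]
    linarith

end Approx
end SC

namespace SC
open MeasureTheory Filter
open scoped ContDiff ComplexConjugate ENNReal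
set_option linter.unusedSectionVars false
set_option linter.style.haveILetI false

section Wrap
variable {E : Type*} [NormedAddCommGroup E] [NormedSpace ℂ E] [FiniteDimensional ℂ E]

lemma approx_main {r : E → ℝ} (hr : ContDiff ℝ ∞ r) (hrc : IsCompact {x | r x ≤ 1})
    {c0 : ℝ} (hc0 : 0 < c0) (hlevi : ∀ x, r x < 1 → ∀ v, c0 * ‖v‖ ^ 2 ≤ levi r x v)
    {A : Set E} (hA : IsCompact A) {κ : ℝ} (hκ : 0 < κ)
    (hAκ : Metric.cthickening (2 * κ) A ⊆ {x | r x < 1}) :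
    ∃ C : ℝ, 0 ≤ C ∧ ∀ G : E → ℂ, ContDiff ℝ ∞ G → ∀ ε : ℝ, 0 ≤ ε →
      (∀ x, r x < 1 → ∀ v, ‖db v G x‖ ≤ ε * ‖v‖) →
      ∃ F : E → ℂ, DifferentiableOn ℂ F (Metric.thickening κ A) ∧
        ∀ p ∈ A, ∀ (H : E → ℂ) (B : ℝ), DifferentiableOn ℂ H (Metric.ball p κ) →
          (∀ x ∈ Metric.ball p κ, ‖G x - H x‖ ≤ B) → ‖F p - H p‖ ≤ C * ε + B := by
  have : FiniteDimensional ℝ E := FiniteDimensional.complexToReal E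
  letI : MeasurableSpace E := borel E
  have : BorelSpace E := ⟨rfl⟩
  set e := Module.finBasis ℂ E with he
  set L := (LinearMap.toContinuousLinearMap e.equivFun.toLinearMap) with hL
  have hLb : ∀ c : Fin (Module.finrank ℂ E) → ℂ, ∑ j, ‖c j‖ ^ 2 ≤
      (∑ _j : Fin (Module.finrank ℂ E), ‖L‖ ^ 2) * ‖∑ j, c j • e j‖ ^ 2 := by
    intro c
    rw [Finset.sum_mul]
    refine Finset.sum_le_sum fun j _ => ?_
    rw [← mul_pow]
    have h1 : L (∑ j, c j • e j) = c := by
      have := e.equivFun.apply_symm_apply c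
      rw [Module.Basis.equivFun_symm_apply] at this
      exact this
    have h2 := L.le_opNorm (∑ j, c j • e j)
    rw [h1] at h2
    gcongr
    exact (norm_le_pi_norm c j).trans h2
  set D := ∑ _j : Fin (Module.finrank ℂ E), ‖L‖ ^ 2 with hD
  have hD0 : 0 ≤ D := by positivity
  set φ : E → ℝ := fun x => 8 * (4 * (∑ j, ‖dd (e j) (fun y => (r y : ℂ)) x‖ ^ 2) + 1) with hφ
  have hrC : ContDiff ℝ ∞ (fun y => (r y : ℂ)) := Complex.ofRealCLM.contDiff.comp hr
  have hφc : Continuous φ := by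
    have : ∀ j, Continuous (dd (e j) (fun y => (r y : ℂ))) := fun j => (contDiff_dd hrC _).continuous
    fun_prop
  obtain ⟨M0, hM0⟩ := hrc.exists_bound_of_continuousOn hφc.continuousOn
  set M := max M0 0 with hM
  set K := M * D / c0 + 1 with hKd
  have hK : 0 < K := by positivity
  obtain ⟨C, hC, h⟩ := dbar_approx Measure.addHaar hr hrc e hK (by
    intro x hx c
    have h1 : φ x ≤ M := ((le_abs_self _).trans (hM0 x hx.le)).trans (le_max_left _ _)
    have h2 := hlevi x hx (∑ j, c j • e j)
    have h3 : (0:ℝ) ≤ M := le_max_right _ _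
    have h4 : 0 ≤ levi r x (∑ j, c j • e j) := le_trans (by positivity) h2
    calc φ x * ∑ j, ‖c j‖ ^ 2 ≤ M * ∑ j, ‖c j‖ ^ 2 := by gcongr
      _ ≤ M * (D * ‖∑ j, c j • e j‖ ^ 2) := by gcongr; exact hLb c
      _ = M * D / c0 * (c0 * ‖∑ j, c j • e j‖ ^ 2) := by field_simp
      _ ≤ M * D / c0 * levi r x (∑ j, c j • e j) := by gcongr
      _ ≤ K * levi r x (∑ j, c j • e j) := by gcongr; linarith) hA hκ hAκ
  set T := ∑ j, ‖e j‖ with hT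
  refine ⟨C * T, by positivity, ?_⟩
  intro G hG ε hε hGε
  obtain ⟨F, hF1, hF2⟩ := h G hG (ε * T) (by positivity) (by
    intro x hx j
    refine (hGε x hx (e j)).trans ?_
    gcongr
    exact Finset.single_le_sum (f := fun j => ‖e j‖) (fun _ _ => norm_nonneg _) (Finset.mem_univ j))
  refine ⟨F, hF1, fun p hp H B h1 h2 => (hF2 p hp H B h1 h2).trans (le_of_eq (by ring))⟩

lemma holo_contDiffOn {f : E → ℂ} {D : Set E} (hD : IsOpen D) (hf : DifferentiableOn ℂ f D) :
    ContDiffOn ℝ ∞ f D := by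
  have : FiniteDimensional ℝ E := FiniteDimensional.complexToReal E
  have : ProperSpace E := FiniteDimensional.proper ℝ E
  letI : MeasurableSpace E := borel E
  have : BorelSpace E := ⟨rfl⟩
  intro p hp
  obtain ⟨ρ, hρ, hρD⟩ := Metric.isOpen_iff.1 hD p hp
  have hκ : 0 < ρ / 2 := by positivity
  obtain ⟨k, k1, k2, k3, k4, k5, k6⟩ := exists_kernel Measure.addHaar hκ (E := E)
  set Q := Metric.closedBall p (3 * ρ / 4) with hQ
  have hQD : Q ⊆ D := (Metric.closedBall_subset_ball (by linarith)).trans hρD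
  have hQc : IsCompact Q := isCompact_closedBall _ _
  set g := Q.indicator f with hg
  have hgi : Integrable g Measure.addHaar :=
    (integrable_indicator_iff hQc.measurableSet).2
      ((hf.continuousOn.mono hQD).integrableOn_compact hQc)
  have heq : f =ᶠ[𝓝 p] mo Measure.addHaar g k := by
    filter_upwards [Metric.ball_mem_nhds p hκ] with x hx
    have hb : Metric.ball x (ρ / 2) ⊆ D := by
      refine (Metric.ball_subset_ball' ?_).trans hρD
      rw [Metric.mem_ball] at hx; linarith
    have := kernel_mean Measure.addHaar k1.continuous (κ' := ρ / 2 / 2) (by linarith) k3 k4 (hf.mono hb)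
    rw [k5, mul_one] at this
    rw [← this, mo]
    congr 1; ext t
    by_cases ht : t ∈ Q
    · simp [hg, ht]
    · have : k (x - t) = 0 := by
        apply k3
        rw [hQ, Metric.mem_closedBall, not_le] at ht
        rw [Metric.mem_ball] at hx
        rw [← dist_eq_norm]
        have := dist_triangle t x p
        rw [dist_comm t x] at this
        linarith
      rw [this]; simp
  exact ((mo_contDiff _ hgi.locallyIntegrable k1 k2).contDiffAt.congr_of_eventuallyEq heq).contDiffWithinAt

lemma exists_cutoff {K O : Set E} (hK : IsCompact K) (hO : IsOpen O) (hKO : K ⊆ O) :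
    ∃ θ : E → ℝ, ContDiff ℝ ∞ θ ∧ (∀ x, 0 ≤ θ x ∧ θ x ≤ 1) ∧
      (∃ O1, IsOpen O1 ∧ K ⊆ O1 ∧ O1 ⊆ O ∧ ∀ x ∈ O1, θ x = 1) ∧ tsupport θ ⊆ O := by
  have : FiniteDimensional ℝ E := FiniteDimensional.complexToReal E
  have : ProperSpace E := FiniteDimensional.proper ℝ E
  obtain ⟨K1, hK1, h1, h2⟩ := exists_compact_between hK hO hKO
  obtain ⟨K2, hK2, h3, h4⟩ := exists_compact_between hK1 hO h2
  obtain ⟨f, f1, f2, f3⟩ := exists_contMDiffMap_zero_one_of_isClosed (modelWithCornersSelf ℝ E) (n := ⊤)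
    (s := (interior K2)ᶜ) (t := K1) isOpen_interior.isClosed_compl hK1.isClosed
    (disjoint_compl_left_iff_subset.2 h3)
  refine ⟨f, f.contMDiff.contDiff, fun x => f3 x, ⟨interior K1, isOpen_interior, h1,
    interior_subset.trans h2, fun x hx => f2 (interior_subset hx)⟩, ?_⟩
  refine (closure_minimal ?_ hK2.isClosed).trans h4
  intro x hx
  by_contra hh
  exact hx (f1 (fun h => hh (interior_subset h)))

lemma globalize {K O : Set E} (hK : IsCompact K) (hO : IsOpen O) (hKO : K ⊆ O) {h : E → ℂ}
    (hh : ContDiffOn ℝ ∞ h O) : ∃ h' : E → ℂ, ContDiff ℝ ∞ h' ∧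
      ∃ O1, IsOpen O1 ∧ K ⊆ O1 ∧ O1 ⊆ O ∧ ∀ x ∈ O1, h' x = h x := by
  obtain ⟨θ, t1, t2, ⟨O1, o1, o2, o3, o4⟩, t4⟩ := exists_cutoff hK hO hKO
  refine ⟨fun x => (θ x : ℂ) * h x, ?_, O1, o1, o2, o3, fun x hx => by simp [o4 x hx]⟩
  rw [contDiff_iff_contDiffAt]
  intro x
  by_cases hx : x ∈ tsupport θ
  · exact (Complex.ofRealCLM.contDiff.comp t1).contDiffAt.mul
      (hh.contDiffAt (hO.mem_nhds (t4 hx)))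
  · apply contDiffAt_const (c := (0:ℂ)).congr_of_eventuallyEq
    have := (isClosed_tsupport θ).isOpen_compl.mem_nhds hx
    filter_upwards [this] with y hy
    rw [image_eq_zero_of_notMem_tsupport hy]; simp

lemma compact_big {X : Type*} [TopologicalSpace X] {Q : Set X} (hQ : IsCompact Q)
    {T N : X → ℝ} (hT : ContinuousOn T Q) (hN : ContinuousOn N Q) (hN0 : ∀ q ∈ Q, 0 ≤ N q)
    (h : ∀ q ∈ Q, N q = 0 → 0 < T q) : ∃ C0 c : ℝ, 0 ≤ C0 ∧ 0 < c ∧ ∀ C, C0 ≤ C → ∀ q ∈ Q,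
      c ≤ T q + C * N q := by
  have key : ∃ C0 : ℝ, 0 ≤ C0 ∧ ∀ q ∈ Q, 0 < T q + C0 * N q := by
    have hQ1 : IsCompact (Q ∩ T ⁻¹' Iic 0) := by
      rw [isCompact_iff_compactSpace] at hQ ⊢
      have h1 : IsClosed {q : Q | T q ≤ 0} :=
        isClosed_le (continuousOn_iff_continuous_domRestrict.1 hT) continuous_const
      have h2 := h1.isCompact.image continuous_subtype_val
      have h3 : Q ∩ T ⁻¹' Iic 0 = Subtype.val '' {q : Q | T q ≤ 0} := by
        ext x; simp; exact and_comm
      rw [h3]; exact isCompact_iff_compactSpace.1 h2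
    rcases (Q ∩ T ⁻¹' Iic 0).eq_empty_or_nonempty with he | hne
    · refine ⟨0, le_rfl, fun q hq => ?_⟩
      by_contra hh
      have : q ∈ Q ∩ T ⁻¹' Iic 0 := ⟨hq, by simpa using hh⟩
      rw [he] at this; exact this
    · obtain ⟨a, ha, hamin⟩ := hQ1.exists_isMinOn hne (hN.mono inter_subset_left)
      obtain ⟨b, hb, hbmin⟩ := hQ1.exists_isMinOn hne (hT.mono inter_subset_left)
      have hNa : 0 < N a := by
        rcases (hN0 a ha.1).eq_or_lt with h0 | h0
        · exact absurd (h a ha.1 h0.symm) (not_lt.2 ha.2)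
        · exact h0
      have hTb : T b ≤ 0 := hb.2
      refine ⟨(-T b + 1) / N a, div_nonneg (by linarith) hNa.le, fun q hq => ?_⟩
      by_cases hq1 : T q ≤ 0
      · have h1 : N a ≤ N q := hamin ⟨hq, hq1⟩
        have h2 : T b ≤ T q := hbmin ⟨hq, hq1⟩
        have h3 : -T b + 1 ≤ (-T b + 1) / N a * N q := by
          rw [div_mul_eq_mul_div, le_div_iff₀ hNa]
          exact mul_le_mul_of_nonneg_left h1 (by linarith)
        linarith
      · push Not at hq1
        have : 0 ≤ (-T b + 1) / N a * N q :=
          mul_nonneg (div_nonneg (by linarith) hNa.le) (hN0 q hq)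
        linarith
  obtain ⟨C0, hC0, hk⟩ := key
  rcases Q.eq_empty_or_nonempty with he | hne
  · exact ⟨C0, 1, hC0, one_pos, fun C _ q hq => by simp [he] at hq⟩
  obtain ⟨a, ha, hmin⟩ := hQ.exists_isMinOn hne (hT.add (hN.const_smul C0))
  refine ⟨C0, T a + C0 * N a, hC0, hk a ha, fun C hC q hq => ?_⟩
  have h1 : T a + C0 * N a ≤ T q + C0 * N q := hmin hq
  have := mul_le_mul_of_nonneg_right hC (hN0 q hq)
  linarith

end Wrap
end SC

namespace SC
open MeasureTheory Filter
open scoped ContDiff ComplexConjugate ENNReal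
set_option linter.unusedSectionVars false
set_option linter.style.haveILetI false

section LeviCalc
variable {E : Type*} [NormedAddCommGroup E] [NormedSpace ℂ E]

lemma levi_congr {φ ψ : E → ℝ} {x : E} (h : φ =ᶠ[𝓝 x] ψ) (v : E) : levi φ x v = levi ψ x v := by
  have : fderiv ℝ φ =ᶠ[𝓝 x] fderiv ℝ ψ := h.fderiv
  simp only [levi, this.fderiv_eq]

lemma contDiff_fderiv' {φ : E → ℝ} (h : ContDiff ℝ ∞ φ) : ContDiff ℝ ∞ (fderiv ℝ φ) :=
  h.fderiv_right (m := ∞) (by simp)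

lemma levi_add {φ ψ : E → ℝ} (h1 : ContDiff ℝ ∞ φ) (h2 : ContDiff ℝ ∞ ψ) (x v : E) :
    levi (fun y => φ y + ψ y) x v = levi φ x v + levi ψ x v := by
  have e : fderiv ℝ (fun y => φ y + ψ y) = fun y => fderiv ℝ φ y + fderiv ℝ ψ y := by
    funext y
    exact fderiv_fun_add (h1.differentiable (by simp) y) (h2.differentiable (by simp) y)
  have e2 := fderiv_fun_add ((contDiff_fderiv' h1).differentiable (by simp) x)
    ((contDiff_fderiv' h2).differentiable (by simp) x)
  simp only [levi, e, e2, add_apply]; ring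

lemma levi_const_mul {φ : E → ℝ} (h1 : ContDiff ℝ ∞ φ) (c : ℝ) (x v : E) :
    levi (fun y => c * φ y) x v = c * levi φ x v := by
  have e : fderiv ℝ (fun y => c * φ y) = fun y => c • fderiv ℝ φ y := by
    funext y
    exact fderiv_const_mul (h1.differentiable (by simp) y) c
  have e2 := fderiv_fun_const_smul ((contDiff_fderiv' h1).differentiable (by simp) x) c
  simp only [levi, e, e2, smul_apply, smul_eq_mul]; ring

lemma levi_zero (x v : E) : levi (fun _ => (0:ℝ)) x v = 0 := by
  have : fderiv ℝ (fun _ : E => (0:ℝ)) = fun _ => 0 := by funext y; simp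
  simp [levi, this]

lemma levi_finset_sum {ι : Type*} (s : Finset ι) {φ : ι → E → ℝ} (h : ∀ i, ContDiff ℝ ∞ (φ i))
    (x v : E) : levi (fun y => ∑ i ∈ s, φ i y) x v = ∑ i ∈ s, levi (φ i) x v := by
  classical
  induction s using Finset.induction_on with
  | empty => simp [levi_zero]
  | insert a s ha ih =>
    simp only [Finset.sum_insert ha]
    rw [levi_add (h a) (ContDiff.sum fun i _ => h i), ih]

lemma levi_smul_real {φ : E → ℝ} (x v : E) (t : ℝ) : levi φ x (t • v) = t ^ 2 * levi φ x v := by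
  have : Complex.I • t • v = t • Complex.I • v := smul_comm _ _ _
  simp only [levi, this, map_smul, smul_apply, smul_eq_mul]; ring

lemma levi_continuous {φ : E → ℝ} (h : ContDiff ℝ ∞ φ) :
    Continuous (fun q : E × E => levi φ q.1 q.2) := by
  have h2 : Continuous (fderiv ℝ (fderiv ℝ φ)) := (contDiff_fderiv' h).continuous_fderiv (by simp)
  unfold levi
  fun_prop

lemma levi_sq_linear (l : E →L[ℝ] ℝ) (x v : E) :
    levi (fun y => (l y) ^ 2) x v = 2 * ((l v) ^ 2 + (l (Complex.I • v)) ^ 2) := by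
  have e : fderiv ℝ (fun y => (l y) ^ 2) = fun y => (2 * l y) • l := by
    funext y
    have := (l.hasFDerivAt (x := y)).pow 2
    rw [this.fderiv]; ext; simp
  have e2 : fderiv ℝ (fun y => (2 * l y) • l) x = ((2:ℝ) • l).smulRight l := by
    have h := (((l.hasFDerivAt (x := x)).const_mul 2).smul_const l)
    rw [h.fderiv]
  simp only [levi, e, e2]
  simp; ring

lemma levi_normSq_nonneg {h : E → ℂ} (hh : ContDiff ℝ ∞ h) {x v : E}
    (hz : ∀ᶠ y in 𝓝 x, db v h y = 0) : 0 ≤ levi (fun y => ‖h y‖ ^ 2) x v := by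
  have hd : ∀ y, DifferentiableAt ℝ h y := hh.differentiable (by simp)
  have hcc : ContDiff ℝ ∞ (fun y => conj (h y)) :=
    Complex.conjCLE.toContinuousLinearMap.contDiff.comp hh
  have hdc : ∀ y, DifferentiableAt ℝ (fun y => conj (h y)) y := hcc.differentiable (by simp)
  have hs : ContDiff ℝ ∞ (fun y => ‖h y‖ ^ 2) := hh.norm_sq ℝ
  have e1 : (fun y => ((‖h y‖ ^ 2 : ℝ) : ℂ)) = fun y => h y * conj (h y) := by
    funext y; rw [Complex.mul_conj, Complex.normSq_eq_norm_sq]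
  have key := levi_sum (ι := Unit) hs x (fun _ => 1) (fun _ => v)
  simp only [Finset.univ_unique, Finset.sum_const, Finset.card_singleton, one_smul, mul_one,
    map_one, e1] at key
  have e2 : dd v (fun y => h y * conj (h y)) =ᶠ[𝓝 x] fun y => dd v h y * conj (h y) := by
    filter_upwards [hz] with y hy
    rw [dd_mul (hd y) (hdc y), dd_conj (hd y), hy]; simp
  have e3 : db v (dd v h) x = 0 := by
    rw [db_dd_comm hh]
    have : db v h =ᶠ[𝓝 x] fun _ => 0 := hz
    rw [dd_congr this]; simp [dd]
  rw [db_congr e2, db_mul ((contDiff_dd hh v).differentiable (by simp) x) (hdc x), db_conj (hd x),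
    e3, zero_mul, add_zero, Complex.mul_conj, Complex.ofReal_inj] at key
  have := Complex.normSq_nonneg (dd v h x)
  linarith
end LeviCalc
end SC

namespace SC
open MeasureTheory Filter
open scoped ContDiff ComplexConjugate ENNReal
set_option linter.unusedSectionVars false
set_option linter.style.haveILetI false

section Geo
variable {n m : ℕ}

abbrev VV (n : ℕ) := EuclideanSpace ℂ (Fin n)
abbrev EE (n m : ℕ) := VV n × VV m

/-- coordinatewise real part -/
def RR (n : ℕ) : VV n →L[ℝ] VV n :=
  haveI : FiniteDimensional ℝ (VV n) := FiniteDimensional.complexToReal _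
  LinearMap.toContinuousLinearMap
  { toFun := fun x => WithLp.toLp 2 (fun i => ((x i).re : ℂ))
    map_add' := fun x y => by ext i; simp
    map_smul' := fun c x => by ext i; simp }

lemma RR_apply (x : VV n) (i : Fin n) : RR n x i = ((x i).re : ℂ) := rfl

lemma RR_mem (x : VV n) : RR n x ∈ realSlice n := by
  intro i; rw [RR_apply]; simp

lemma mem_realSlice_iff {x : VV n} : x ∈ realSlice n ↔ RR n x = x := by
  constructor
  · intro h; ext i; rw [RR_apply]; apply Complex.ext <;> simp [h i]
  · intro h; rw [← h]; exact RR_mem x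

def yy (x : EE n m) : ℝ := ∑ i, ((x.1 i).im) ^ 2

def qq (a : VV n) (x : EE n m) : ℂ := ∑ i, (x.1 i - a i) ^ 2

lemma yy_nonneg (x : EE n m) : 0 ≤ yy x := Finset.sum_nonneg fun i _ => sq_nonneg _

lemma yy_eq_zero {x : EE n m} : yy x = 0 ↔ RR n x.1 = x.1 := by
  rw [← mem_realSlice_iff, yy, Finset.sum_eq_zero_iff_of_nonneg (fun i _ => sq_nonneg _)]
  simp [realSlice]

lemma re_qq {a : VV n} (ha : a ∈ realSlice n) (x : EE n m) :
    (qq a x).re = ‖RR n x.1 - a‖ ^ 2 - yy x := by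
  rw [EuclideanSpace.norm_sq_eq, qq, yy, ← Finset.sum_sub_distrib, Complex.re_sum]
  refine Finset.sum_congr rfl fun i _ => ?_
  rw [PiLp.sub_apply, RR_apply, ← Complex.normSq_eq_norm_sq, Complex.normSq_apply, sq,
    Complex.mul_re]
  simp [ha i]; ring

lemma norm_exp_qq {a : VV n} (ha : a ∈ realSlice n) (l : ℝ) (x : EE n m) :
    ‖Complex.exp (-(l * qq a x))‖ = Real.exp (-(l * (‖RR n x.1 - a‖ ^ 2 - yy x))) := by
  rw [Complex.norm_exp, Complex.neg_re, Complex.re_ofReal_mul, re_qq ha]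

lemma norm_RR_le (x : VV n) : ‖RR n x‖ ≤ ‖x‖ := by
  rw [EuclideanSpace.norm_eq, EuclideanSpace.norm_eq]
  apply Real.sqrt_le_sqrt
  refine Finset.sum_le_sum fun i _ => ?_
  rw [RR_apply]
  gcongr
  simpa using Complex.abs_re_le_norm (x i)

lemma coord_diff (i : Fin n) : Differentiable ℂ (fun x : EE n m => x.1 i) := by
  fun_prop

lemma qq_diff (a : VV n) : Differentiable ℂ (qq (m := m) a) := by
  unfold qq
  fun_prop

lemma exp_qq_diff (a : VV n) (l : ℝ) :
    Differentiable ℂ (fun x : EE n m => Complex.exp (-(l * qq a x))) := by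
  have := qq_diff (m := m) a
  fun_prop

/-- real coordinate functionals -/
def imc (i : Fin n) : EE n m →L[ℝ] ℝ :=
  Complex.imCLM.comp ((((EuclideanSpace.proj i : VV n →L[ℂ] ℂ).comp
    (ContinuousLinearMap.fst ℂ (VV n) (VV m))).restrictScalars ℝ))
def rec' (i : Fin n) : EE n m →L[ℝ] ℝ :=
  Complex.reCLM.comp ((((EuclideanSpace.proj i : VV n →L[ℂ] ℂ).comp
    (ContinuousLinearMap.fst ℂ (VV n) (VV m))).restrictScalars ℝ))
def imz (i : Fin m) : EE n m →L[ℝ] ℝ :=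
  Complex.imCLM.comp ((((EuclideanSpace.proj i : VV m →L[ℂ] ℂ).comp
    (ContinuousLinearMap.snd ℂ (VV n) (VV m))).restrictScalars ℝ))
def rez (i : Fin m) : EE n m →L[ℝ] ℝ :=
  Complex.reCLM.comp ((((EuclideanSpace.proj i : VV m →L[ℂ] ℂ).comp
    (ContinuousLinearMap.snd ℂ (VV n) (VV m))).restrictScalars ℝ))

lemma imc_apply (i : Fin n) (x : EE n m) : imc i x = (x.1 i).im := rfl
lemma rec_apply (i : Fin n) (x : EE n m) : rec' i x = (x.1 i).re := rfl
lemma imz_apply (i : Fin m) (x : EE n m) : imz i x = (x.2 i).im := rfl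
lemma rez_apply (i : Fin m) (x : EE n m) : rez i x = (x.2 i).re := rfl

def nn (x : EE n m) : ℝ := ∑ i, ((rec' i x) ^ 2 + (imc i x) ^ 2) +
  ∑ j, ((rez j x) ^ 2 + (imz j x) ^ 2)

lemma nn_nonneg (x : EE n m) : 0 ≤ nn x := by unfold nn; positivity

lemma sqlin_contDiff (l : EE n m →L[ℝ] ℝ) : ContDiff ℝ ∞ (fun x => (l x) ^ 2) := by fun_prop

lemma nn_contDiff : ContDiff ℝ ∞ (nn (n := n) (m := m)) := by unfold nn; fun_prop

lemma yy_eq : (yy (n := n) (m := m)) = fun x => ∑ i, (imc i x) ^ 2 := rfl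

lemma yy_contDiff : ContDiff ℝ ∞ (yy (n := n) (m := m)) := by rw [yy_eq]; fun_prop

lemma levi_yy (x v : EE n m) : levi (yy (n := n) (m := m)) x v = 2 * ‖v.1‖ ^ 2 := by
  rw [yy_eq, levi_finset_sum _ (fun i => sqlin_contDiff _), EuclideanSpace.norm_sq_eq,
    Finset.mul_sum]
  refine Finset.sum_congr rfl fun i _ => ?_
  rw [levi_sq_linear, imc_apply, imc_apply, ← Complex.normSq_eq_norm_sq, Complex.normSq_apply]
  simp; ring

lemma levi_nn (x v : EE n m) : levi (nn (n := n) (m := m)) x v =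
    4 * (‖v.1‖ ^ 2 + ‖v.2‖ ^ 2) := by
  unfold nn
  have c1 : ∀ i : Fin n, ContDiff ℝ ∞ (fun x : EE n m => (rec' i x) ^ 2 + (imc i x) ^ 2) :=
    fun i => (sqlin_contDiff _).add (sqlin_contDiff _)
  have c2 : ∀ i : Fin m, ContDiff ℝ ∞ (fun x : EE n m => (rez i x) ^ 2 + (imz i x) ^ 2) :=
    fun i => (sqlin_contDiff _).add (sqlin_contDiff _)
  rw [levi_add (ContDiff.sum fun i _ => c1 i) (ContDiff.sum fun i _ => c2 i),
    levi_finset_sum _ c1, levi_finset_sum _ c2, EuclideanSpace.norm_sq_eq,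
    EuclideanSpace.norm_sq_eq, mul_add, Finset.mul_sum, Finset.mul_sum]
  congr 1
  · refine Finset.sum_congr rfl fun i _ => ?_
    rw [levi_add (sqlin_contDiff _) (sqlin_contDiff _), levi_sq_linear, levi_sq_linear]
    rw [← Complex.normSq_eq_norm_sq, Complex.normSq_apply]
    simp only [imc_apply, rec_apply]; simp; ring
  · refine Finset.sum_congr rfl fun i _ => ?_
    rw [levi_add (sqlin_contDiff _) (sqlin_contDiff _), levi_sq_linear, levi_sq_linear]
    rw [← Complex.normSq_eq_norm_sq, Complex.normSq_apply]
    simp only [imz_apply, rez_apply]; simp; ring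

lemma db_holo {E : Type*} [NormedAddCommGroup E] [NormedSpace ℂ E] {h : E → ℂ} {x : E}
    (hh : DifferentiableAt ℂ h x) (v : E) : db v h x = 0 := by
  have := (hh.hasFDerivAt.restrictScalars ℝ).fderiv
  simp only [db, this, ContinuousLinearMap.coe_restrictScalars', map_smul, smul_eq_mul]
  rw [← mul_assoc, Complex.I_mul_I]; ring

lemma exists_chi (a : VV n) {ρ1 ρ2 : ℝ} (h1 : 0 < ρ1) (h2 : ρ1 < ρ2) :
    ∃ χ : EE n m → ℝ, ContDiff ℝ ∞ χ ∧ (∀ x, 0 ≤ χ x ∧ χ x ≤ 1) ∧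
      (∀ x, ‖RR n x.1 - a‖ ≤ ρ1 → χ x = 1) ∧ (∀ x, ρ2 ≤ ‖RR n x.1 - a‖ → χ x = 0) ∧
      (∀ x v, v.1 = 0 → db v (fun y => (χ y : ℂ)) x = 0) ∧
      (∀ x v, ‖RR n x.1 - a‖ < ρ1 → db v (fun y => (χ y : ℂ)) x = 0) ∧
      ∃ M, 0 ≤ M ∧ ∀ x v, ‖db v (fun y => (χ y : ℂ)) x‖ ≤ M * ‖v‖ := by
  have : FiniteDimensional ℝ (VV n) := FiniteDimensional.complexToReal _
  let b : ContDiffBump a := ⟨ρ1, ρ2, h1, h2⟩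
  have hb : ContDiff ℝ ∞ b := b.contDiff
  let P : EE n m →L[ℝ] VV n := (RR n).comp (ContinuousLinearMap.fst ℝ (VV n) (VV m))
  have hP : ∀ x, P x = RR n x.1 := fun x => rfl
  have hχ : ContDiff ℝ ∞ (fun x : EE n m => b (P x)) := hb.comp P.contDiff
  have hd : ∀ x v, fderiv ℝ (fun x : EE n m => ((b (P x) : ℝ) : ℂ)) x v =
      (fderiv ℝ b (P x) (P v) : ℂ) := by
    intro x v
    rw [fderiv_ofReal (hχ.differentiable (by simp) x)]
    have := ((hb.differentiable (by simp) (P x)).hasFDerivAt.comp x P.hasFDerivAt).fderiv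
    change ((fderiv ℝ (b ∘ P) x v : ℝ) : ℂ) = _
    rw [this]; rfl
  refine ⟨fun x => b (P x), hχ, fun x => ⟨b.nonneg, b.le_one⟩, fun x hx => ?_, fun x hx => ?_,
    fun x v hv => ?_, fun x v hx => ?_, ?_⟩
  · apply b.one_of_mem_closedBall; rw [mem_closedBall_iff_norm]; exact hx
  · apply b.zero_of_le_dist; rw [dist_eq_norm]; exact hx
  · have e1 : P v = 0 := by rw [hP, hv, map_zero]
    have e2 : P (Complex.I • v) = 0 := by rw [hP, Prod.smul_fst, hv, smul_zero, map_zero]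
    simp only [db, hd, e1, e2]; simp
  · have : (fun y => ((b (P y) : ℝ) : ℂ)) =ᶠ[𝓝 x] fun _ => 1 := by
      have ho : IsOpen {y : EE n m | ‖P y - a‖ < ρ1} :=
        isOpen_lt (by fun_prop) continuous_const
      filter_upwards [ho.mem_nhds hx] with y hy
      rw [b.one_of_mem_closedBall]; · simp
      rw [mem_closedBall_iff_norm]; exact le_of_lt hy
    rw [db_congr this]; simp [db]
  · have hcs : HasCompactSupport (fderiv ℝ b) := b.hasCompactSupport.fderiv ℝ
    obtain ⟨M, hM⟩ := hcs.exists_bound_of_continuous (hb.continuous_fderiv (by simp))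
    have hM0 : 0 ≤ M := (norm_nonneg _).trans (hM a)
    refine ⟨M * ‖P‖, by positivity, fun x v => ?_⟩
    have k : ∀ w, ‖((fderiv ℝ b (P x) (P w) : ℝ) : ℂ)‖ ≤ M * ‖P‖ * ‖w‖ := by
      intro w
      rw [Complex.norm_real, mul_assoc]
      refine ((fderiv ℝ b (P x)).le_opNorm _).trans ?_
      exact mul_le_mul (hM _) (P.le_opNorm w) (norm_nonneg _) hM0
    simp only [db, hd]
    rw [norm_div, div_le_iff₀ (by simp)]
    refine (norm_add_le _ _).trans ?_
    have := k v
    have k2 := k (Complex.I • v)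
    rw [norm_mul, Complex.norm_I, one_mul]
    rw [norm_smul, Complex.norm_I, one_mul] at k2
    simp only [Complex.norm_ofNat]
    linarith

lemma block {a : VV n} {ρ2 : ℝ} {χ : EE n m → ℝ} (hχ : ContDiff ℝ ∞ χ)
    (hχ0 : ∀ x, ρ2 ≤ ‖RR n x.1 - a‖ → χ x = 0) {O : Set (EE n m)} (hO : IsOpen O)
    {D : Set (VV m)} (hD : IsOpen D) (hOD : ∀ x ∈ O, ρ2 < ‖RR n x.1 - a‖ ∨ x.2 ∈ D)
    {f : VV m → ℂ} (hf : DifferentiableOn ℂ f D) {g : EE n m → ℂ} (hg : Differentiable ℂ g) :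
    ContDiffOn ℝ ∞ (fun x => (χ x : ℂ) * (f x.2 * g x)) O ∧
    ∀ x ∈ O, ∀ v, db v (fun x => (χ x : ℂ) * (f x.2 * g x)) x =
      db v (fun y => (χ y : ℂ)) x * (f x.2 * g x) := by
  have hχc : ContDiff ℝ ∞ (fun x => (χ x : ℂ)) := Complex.ofRealCLM.contDiff.comp hχ
  have hcase : ∀ x : EE n m, ρ2 < ‖RR n x.1 - a‖ → ∀ᶠ y in 𝓝 x, χ y = 0 := by
    intro x hx
    have ho : IsOpen {y : EE n m | ρ2 < ‖RR n y.1 - a‖} :=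
      isOpen_lt continuous_const (by fun_prop)
    filter_upwards [ho.mem_nhds hx] with y hy
    exact hχ0 y (le_of_lt hy)
  have hD2 : IsOpen {x : EE n m | x.2 ∈ D} := hD.preimage continuous_snd
  have hol : DifferentiableOn ℂ (fun x : EE n m => f x.2 * g x) {x : EE n m | x.2 ∈ D} := by
    refine DifferentiableOn.mul ?_ hg.differentiableOn
    exact hf.comp differentiable_snd.differentiableOn (fun x hx => hx)
  have hsm := holo_contDiffOn hD2 hol
  constructor
  · intro x hx
    apply ContDiffAt.contDiffWithinAt
    rcases hOD x hx with h | h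
    · refine contDiffAt_const (c := (0:ℂ)).congr_of_eventuallyEq ?_
      filter_upwards [hcase x h] with y hy
      simp [hy]
    · exact hχc.contDiffAt.mul (hsm.contDiffAt (hD2.mem_nhds h))
  · intro x hx v
    rcases hOD x hx with h | h
    · have e1 : (fun x : EE n m => (χ x : ℂ) * (f x.2 * g x)) =ᶠ[𝓝 x] fun _ => 0 := by
        filter_upwards [hcase x h] with y hy
        simp [hy]
      have e2 : (fun x : EE n m => (χ x : ℂ)) =ᶠ[𝓝 x] fun _ => 0 := by
        filter_upwards [hcase x h] with y hy
        simp [hy]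
      rw [db_congr e1, db_congr e2]; simp [db]
    · rw [db_mul (hχc.differentiable (by simp) x)
        ((hsm.contDiffAt (hD2.mem_nhds h)).differentiableAt (by simp)),
        db_holo (hol.differentiableAt (hD2.mem_nhds h))]
      ring
end Geo
end SC

namespace SC
open MeasureTheory Filter
open scoped ContDiff ComplexConjugate ENNReal
set_option linter.unusedSectionVars false
set_option linter.style.haveILetI false

section Cover
variable {n m : ℕ}

lemma le_bisup {E : Type*} [TopologicalSpace E] {K : Set E} (hK : IsCompact K) {g : E → ℂ}
    (hg : ContinuousOn g K) {w : E} (hw : w ∈ K) : ‖g w‖ ≤ ⨆ w ∈ K, ‖g w‖ := by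
  obtain ⟨C, hC⟩ := hK.exists_bound_of_continuousOn hg
  have hC0 : 0 ≤ C := (norm_nonneg _).trans (hC w hw)
  have hb : BddAbove (range fun w => ⨆ (_ : w ∈ K), ‖g w‖) := by
    refine ⟨C, ?_⟩
    rintro _ ⟨y, rfl⟩
    exact Real.iSup_le (fun hy => hC y hy) hC0
  refine le_trans ?_ (le_ciSup hb w)
  simp [hw]

lemma bisup_le {E : Type*} {K : Set E} {g : E → ℂ} {c : ℝ} (hc : 0 ≤ c)
    (h : ∀ w ∈ K, ‖g w‖ ≤ c) : ⨆ w ∈ K, ‖g w‖ ≤ c :=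
  Real.iSup_le (fun w => Real.iSup_le (fun hw => h w hw) hc) hc

lemma bisup_nonneg {E : Type*} {K : Set E} {g : E → ℂ} : 0 ≤ ⨆ w ∈ K, ‖g w‖ :=
  Real.iSup_nonneg fun w => Real.iSup_nonneg fun _ => norm_nonneg _

structure CoverData (S : Set (EE n m)) (t : Finset (VV n)) (δ : VV n → ℝ)
    (D : VV n → Set (VV m)) : Prop where
  cpt : IsCompact S
  sreal : ∀ s ∈ S, RR n s.1 = s.1
  pos : ∀ u ∈ t, 0 < δ u
  opn : ∀ u ∈ t, IsOpen (D u)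
  conv : ∀ u ∈ t, ∀ s ∈ S, ‖u - s.1‖ ≤ δ u →
    fiberOf S s.1 ⊆ D u ∧ hullO (D u) (fiberOf S s.1) = fiberOf S s.1
  cover : ∀ s ∈ S, ∃ u ∈ t, ‖s.1 - u‖ < δ u / 2

/-- the good neighborhood -/
def OO (W : Set (EE n m)) (t : Finset (VV n)) (δ : VV n → ℝ)
    (D : VV n → Set (VV m)) : Set (EE n m) :=
  {p | p ∈ W ∧ (∃ u ∈ t, ‖RR n p.1 - u‖ < δ u / 2) ∧ ∀ u ∈ t, δ u < ‖RR n p.1 - u‖ ∨ p.2 ∈ D u}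

variable {S : Set (EE n m)} {t : Finset (VV n)} {δ : VV n → ℝ} {D : VV n → Set (VV m)}
  {W : Set (EE n m)}

lemma OO_open (h : CoverData S t δ D) (hW : IsOpen W) : IsOpen (OO W t δ D) := by
  have e : OO W t δ D = W ∩ ((⋃ u ∈ t, {p : EE n m | ‖RR n p.1 - u‖ < δ u / 2}) ∩
      ⋂ u ∈ t, ({p : EE n m | δ u < ‖RR n p.1 - u‖} ∪ Prod.snd ⁻¹' (D u))) := by
    ext p; simp [OO]; tauto
  rw [e]
  refine hW.inter (IsOpen.inter ?_ ?_)
  · exact isOpen_biUnion fun u _ => isOpen_lt (by fun_prop) continuous_const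
  · refine isOpen_biInter_finset fun u hu => ?_
    exact (isOpen_lt continuous_const (by fun_prop)).union ((h.opn u hu).preimage continuous_snd)

lemma subset_OO (h : CoverData S t δ D) (hSW : S ⊆ W) : S ⊆ OO W t δ D := by
  intro s hs
  refine ⟨hSW hs, ?_, fun u hu => ?_⟩
  · rw [h.sreal s hs]; exact h.cover s hs
  · rw [h.sreal s hs]
    by_cases hc : δ u < ‖s.1 - u‖
    · exact Or.inl hc
    · right
      rw [not_lt, norm_sub_rev] at hc
      exact (h.conv u hu s hs hc).1 hs

lemma OO_block {p : EE n m} {u : VV n} (hu : u ∈ t) (hpu : ‖p.1 - u‖ < δ u / 2) {τ : ℝ}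
    (hτ : τ ≤ δ u / 2) : ∀ x ∈ OO W t δ D, τ < ‖RR n x.1 - p.1‖ ∨ x.2 ∈ D u := by
  intro x hx
  by_cases hc : τ < ‖RR n x.1 - p.1‖
  · exact Or.inl hc
  · right
    rcases hx.2.2 u hu with h1 | h1
    · exfalso
      have := norm_sub_le_norm_sub_add_norm_sub (RR n x.1) p.1 u
      linarith
    · exact h1

lemma sep_f (h : CoverData S t δ D) (hSW : S ⊆ W) {p : EE n m} (hp : p ∈ OO W t δ D)
    (hpr : RR n p.1 = p.1) (hpS : p ∉ S) : ∃ u ∈ t, ‖p.1 - u‖ < δ u / 2 ∧ ∃ f : VV m → ℂ,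
      DifferentiableOn ℂ f (D u) ∧ ∃ τ, 0 < τ ∧ τ ≤ δ u / 2 ∧ 1 < ‖f p.2‖ ∧
        ∀ s ∈ S, ‖s.1 - p.1‖ ≤ τ → ‖f s.2‖ < 1 / 2 := by
  obtain ⟨hpW, ⟨u, hu, hpu⟩, hpD⟩ := hp
  rw [hpr] at hpu
  have hδ := h.pos u hu
  have hpDu : p.2 ∈ D u := by
    rcases hpD u hu with h1 | h1
    · rw [hpr] at h1; linarith
    · exact h1
  refine ⟨u, hu, hpu, ?_⟩
  have key : ∃ f : VV m → ℂ, DifferentiableOn ℂ f (D u) ∧ 1 < ‖f p.2‖ ∧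
      ∀ s ∈ S, s.1 = p.1 → ‖f s.2‖ < 1 / 2 := by
    by_cases hX : ∃ s ∈ S, s.1 = p.1
    · obtain ⟨s, hs, hsp⟩ := hX
      have hc := h.conv u hu s hs (by rw [hsp, norm_sub_rev]; linarith)
      rw [hsp] at hc
      have hcl : IsCompact (fiberOf S p.1) := by
        have : fiberOf S p.1 = Prod.snd '' (S ∩ Prod.fst ⁻¹' {p.1}) := by
          ext z; simp only [fiberOf, mem_ofPred_eq, mem_image, mem_inter_iff, mem_preimage,
            mem_singleton_iff]
          constructor
          · intro hz; exact ⟨(p.1, z), ⟨hz, rfl⟩, rfl⟩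
          · rintro ⟨x, ⟨hx, hx1⟩, rfl⟩; rw [← hx1]; exact hx
        rw [this]
        exact (h.cpt.inter_right (isClosed_singleton.preimage continuous_fst)).image continuous_snd
      have hnot : p.2 ∉ hullO (D u) (fiberOf S p.1) := by rw [hc.2]; exact hpS
      have : ∃ g : VV m → ℂ, DifferentiableOn ℂ g (D u) ∧
          (⨆ w ∈ fiberOf S p.1, ‖g w‖) < ‖g p.2‖ := by
        by_contra hcon
        push Not at hcon
        exact hnot ⟨hpDu, hcon⟩
      obtain ⟨g, hg, hlt⟩ := this
      set M := ⨆ w ∈ fiberOf S p.1, ‖g w‖ with hM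
      have hM0 : 0 ≤ M := bisup_nonneg
      obtain ⟨c, hc1, hc2⟩ := exists_between hlt
      have hc0 : 0 < c := by linarith
      have hMc : M / c < 1 := by rw [div_lt_one hc0]; exact hc1
      obtain ⟨k, hk⟩ := exists_pow_lt_of_lt_one (y := M / c) (x := (1/2 : ℝ)) (by norm_num) hMc
      refine ⟨fun z => (g z / c) ^ (k + 1), by
        simp only [div_eq_mul_inv]; exact (hg.mul_const _).pow _, ?_, fun s' hs' hsp' => ?_⟩
      · rw [norm_pow, norm_div, Complex.norm_real, Real.norm_of_nonneg hc0.le]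
        apply one_lt_pow₀ _ (by omega)
        rw [one_lt_div hc0]; exact hc2
      · rw [norm_pow, norm_div, Complex.norm_real, Real.norm_of_nonneg hc0.le]
        have hmem : s'.2 ∈ fiberOf S p.1 := by rw [← hsp']; exact hs'
        have h1 : ‖g s'.2‖ ≤ M := le_bisup hcl (hg.continuousOn.mono hc.1) hmem
        calc (‖g s'.2‖ / c) ^ (k + 1) ≤ (M / c) ^ (k + 1) := by gcongr
          _ ≤ (M / c) ^ k := pow_le_pow_of_le_one (by positivity) hMc.le (by omega)
          _ < 1 / 2 := hk
    · refine ⟨fun _ => 2, differentiableOn_const _, by norm_num, fun s hs hsp => ?_⟩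
      exact absurd ⟨s, hs, hsp⟩ hX
  obtain ⟨f, hf, hfp, hfS⟩ := key
  refine ⟨f, hf, ?_⟩
  have hQ : IsCompact (S ∩ {s : EE n m | ‖s.1 - p.1‖ ≤ δ u / 2}) :=
    h.cpt.inter_right (isClosed_le (by fun_prop) continuous_const)
  have hmaps : ∀ s ∈ S ∩ {s : EE n m | ‖s.1 - p.1‖ ≤ δ u / 2}, s.2 ∈ D u := by
    rintro s ⟨hs, hs2⟩
    rw [mem_ofPred_eq] at hs2
    rcases OO_block (W := W) (δ := δ) (D := D) hu hpu le_rfl s (subset_OO h hSW hs) with h1 | h1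
    · rw [h.sreal s hs] at h1; linarith
    · exact h1
  have hcT : ContinuousOn (fun s : EE n m => 1 / 2 - ‖f s.2‖)
      (S ∩ {s : EE n m | ‖s.1 - p.1‖ ≤ δ u / 2}) :=
    continuousOn_const.sub (hf.continuousOn.comp continuous_snd.continuousOn hmaps).norm
  obtain ⟨C0, c, hC0, hc, hb⟩ := compact_big hQ hcT
    (N := fun s : EE n m => ‖s.1 - p.1‖) (by fun_prop) (fun _ _ => norm_nonneg _)
    (fun s hs h0 => by
      have : s.1 = p.1 := sub_eq_zero.1 (norm_eq_zero.1 h0)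
      have := hfS s hs.1 this
      linarith)
  refine ⟨min (δ u / 2) (c / (C0 + 1)), lt_min (by linarith) (by positivity), min_le_left _ _, hfp,
    fun s hs hsτ => ?_⟩
  have h1 := hb C0 le_rfl s ⟨hs, hsτ.trans (min_le_left _ _)⟩
  have h2 : ‖s.1 - p.1‖ * (C0 + 1) ≤ c := by
    rw [← le_div_iff₀ (by positivity)]; exact hsτ.trans (min_le_right _ _)
  rcases (norm_nonneg (s.1 - p.1)).eq_or_lt with h3 | h3
  · rw [← h3] at h1; linarith
  · nlinarith

end Cover
end SC

namespace SC
open MeasureTheory Filter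
open scoped ContDiff ComplexConjugate ENNReal
set_option linter.unusedSectionVars false
set_option linter.style.haveILetI false

section R0
variable {n m : ℕ}
variable {S : Set (EE n m)} {t : Finset (VV n)} {δ : VV n → ℝ} {D : VV n → Set (VV m)}
  {W : Set (EE n m)}

lemma db_pow_zero {E : Type*} [NormedAddCommGroup E] [NormedSpace ℂ E] {h : E → ℂ}
    (hh : ContDiff ℝ ∞ h) {v x : E} (hz : db v h x = 0) (k : ℕ) :
    db v (fun y => h y ^ k) x = 0 := by
  induction k with
  | zero => simp [db]
  | succ k ih =>
    simp only [pow_succ]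
    rw [db_mul ((hh.pow k).differentiable (by simp) x) (hh.differentiable (by simp) x), hz, ih]
    simp

lemma exists_block (h : CoverData S t δ D) (hW : IsOpen W) (hSW : S ⊆ W) {K : Set (EE n m)}
    (hK : IsCompact K) (hKO : K ⊆ OO W t δ D) (hSK : S ⊆ K) {p : EE n m} (hp : p ∈ K)
    (hpr : RR n p.1 = p.1) (hpS : p ∉ S) : ∃ b : EE n m → ℂ, ContDiff ℝ ∞ b ∧ 1 < ‖b p‖ ∧
      (∀ s ∈ S, ‖b s‖ < 1 / 2) ∧
      ∀ x ∈ K, ∀ v : EE n m, v.1 = 0 → ∀ᶠ y in 𝓝 x, db v b y = 0 := by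
  obtain ⟨u, hu, hpu, f, hf, τ, hτ, hτδ, hfp, hfS⟩ := sep_f h hSW (hKO hp) hpr hpS
  obtain ⟨χ, c1, c2, c3, c4, c5, -⟩ := exists_chi (m := m) p.1 (ρ1 := τ / 2) (ρ2 := τ) (by linarith)
    (by linarith)
  have hO := OO_open h hW
  obtain ⟨g1, g2⟩ := block c1 c4 hO (h.opn u hu) (OO_block hu hpu hτδ) hf
    (differentiable_const (1:ℂ))
  obtain ⟨b, b1, O1, o1, o2, o3, o4⟩ := globalize hK hO hKO g1
  refine ⟨b, b1, ?_, fun s hs => ?_, fun x hx v hv => ?_⟩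
  · rw [o4 p (o2 hp), c3 p (by rw [hpr]; simp; linarith)]
    simpa using hfp
  · rw [o4 s (o2 (hSK hs))]
    by_cases hc : ‖s.1 - p.1‖ ≤ τ
    · have := hfS s hs hc
      rw [norm_mul, mul_one, Complex.norm_real, Real.norm_of_nonneg (c2 s).1]
      have := (c2 s).2
      nlinarith [norm_nonneg (f s.2)]
    · rw [c4 s (by rw [h.sreal s hs]; linarith)]; simp
  · filter_upwards [o1.mem_nhds (o2 hx)] with y hy
    have : b =ᶠ[𝓝 y] fun x => (χ x : ℂ) * (f x.2 * 1) := by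
      filter_upwards [o1.mem_nhds hy] with z hz using o4 z hz
    rw [db_congr this, g2 y (o3 hy), c5 y v hv, zero_mul]

lemma exists_r0 (h : CoverData S t δ D) (hW : IsOpen W) (hSW : S ⊆ W) {K : Set (EE n m)}
    (hK : IsCompact K) (hKO : K ⊆ OO W t δ D) (hSK : S ⊆ interior K) :
    ∃ r0 : EE n m → ℝ, ContDiff ℝ ∞ r0 ∧ (∀ x, 0 ≤ r0 x) ∧ (∀ s ∈ S, r0 s < 1 / 2) ∧
      (∀ p ∈ K \ interior K, RR n p.1 = p.1 → 1 < r0 p) ∧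
      ∀ x ∈ K, ∀ v : EE n m, v.1 = 0 → 0 ≤ levi r0 x v := by
  classical
  set B0 : Set (EE n m) := (K \ interior K) ∩ {p | RR n p.1 = p.1} with hB0
  have hB0c : IsCompact B0 :=
    (hK.diff isOpen_interior).inter_right (isClosed_eq (by fun_prop) (by fun_prop))
  have hex : ∀ p : EE n m, ∃ b : EE n m → ℂ, p ∈ B0 → (ContDiff ℝ ∞ b ∧ 1 < ‖b p‖ ∧
      (∀ s ∈ S, ‖b s‖ < 1 / 2) ∧
      ∀ x ∈ K, ∀ v : EE n m, v.1 = 0 → ∀ᶠ y in 𝓝 x, db v b y = 0) := by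
    intro p
    by_cases hp : p ∈ B0
    · obtain ⟨b, hb⟩ := exists_block h hW hSW hK hKO (hSK.trans interior_subset) hp.1.1 hp.2
        (fun hpS => hp.1.2 (hSK hpS))
      exact ⟨b, fun _ => hb⟩
    · exact ⟨0, fun h => absurd h hp⟩
  choose b hb using hex
  obtain ⟨F, hF1, hF2⟩ := hB0c.elim_nhds_subcover (fun p => {x | 1 < ‖b p x‖}) (fun p hp =>
    (isOpen_lt continuous_const (hb p hp).1.continuous.norm).mem_nhds (hb p hp).2.1)
  obtain ⟨k, hk⟩ := exists_pow_lt_of_lt_one (y := (1/2:ℝ)) (x := 1 / (2 * (F.card + 1 : ℝ)))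
    (by positivity) (by norm_num)
  have hbc : ∀ p ∈ F, ContDiff ℝ ∞ (fun x => ‖b p x ^ (k+1)‖ ^ 2) := fun p hp =>
    ((hb p (hF1 p hp)).1.pow _).norm_sq ℝ
  set ψ : EE n m → EE n m → ℝ := fun p => if p ∈ F then (fun x => ‖b p x ^ (k+1)‖ ^ 2) else 0
    with hψ
  have hψc : ∀ p, ContDiff ℝ ∞ (ψ p) := by
    intro p
    by_cases hp : p ∈ F
    · simp only [hψ, hp, if_true]; exact hbc p hp
    · simp only [hψ, hp, if_false]; exact contDiff_const
  have hψe : ∀ p ∈ F, ψ p = (fun x => ‖b p x ^ (k+1)‖ ^ 2) := fun p hp => by simp [hψ, hp]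
  have hψ0 : ∀ p ∈ F, ∀ x, 0 ≤ ψ p x := fun p hp x => by rw [hψe p hp]; positivity
  refine ⟨fun x => ∑ p ∈ F, ψ p x, ContDiff.sum fun p _ => hψc p,
    fun x => Finset.sum_nonneg fun p hp => hψ0 p hp x, fun s hs => ?_, fun p hp hpr => ?_,
    fun x hx v hv => ?_⟩
  · have : ∀ p ∈ F, ψ p s ≤ (1/2) ^ k := by
      intro p hp
      rw [hψe p hp]
      have h1 := (hb p (hF1 p hp)).2.2.1 s hs
      simp only [norm_pow]
      rw [← pow_mul]
      calc ‖b p s‖ ^ ((k+1)*2) ≤ (1/2) ^ ((k+1)*2) := by gcongr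
        _ ≤ (1/2) ^ k := pow_le_pow_of_le_one (by norm_num) (by norm_num) (by omega)
    calc ∑ p ∈ F, ψ p s ≤ ∑ p ∈ F, (1/2 : ℝ) ^ k := Finset.sum_le_sum this
      _ = F.card * (1/2 : ℝ) ^ k := by simp
      _ ≤ F.card * (1 / (2 * (F.card + 1 : ℝ))) := by gcongr
      _ < 1 / 2 := by
        rw [mul_one_div, div_lt_div_iff₀ (by positivity) (by positivity)]
        linarith
  · have hpB : p ∈ B0 := ⟨hp, hpr⟩
    obtain ⟨p', hp', hpp⟩ := mem_iUnion₂.1 (hF2 hpB)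
    have h1 : ψ p' p ≤ ∑ q ∈ F, ψ q p := Finset.single_le_sum (fun q hq => hψ0 q hq p) hp'
    refine lt_of_lt_of_le ?_ h1
    rw [hψe p' hp']
    simp only [norm_pow]
    rw [← pow_mul]
    exact one_lt_pow₀ hpp (by omega)
  · rw [levi_finset_sum _ hψc]
    refine Finset.sum_nonneg fun p hp => ?_
    rw [hψe p hp]
    apply levi_normSq_nonneg ((hb p (hF1 p hp)).1.pow _)
    filter_upwards [(hb p (hF1 p hp)).2.2.2 x hx v hv] with y hy
    exact db_pow_zero (hb p (hF1 p hp)).1 hy _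

end R0
end SC

namespace SC
open MeasureTheory Filter
open scoped ContDiff ComplexConjugate ENNReal
set_option linter.unusedSectionVars false
set_option linter.style.haveILetI false

section R1
variable {n m : ℕ}
variable {S : Set (EE n m)} {t : Finset (VV n)} {δ : VV n → ℝ} {D : VV n → Set (VV m)}
  {W : Set (EE n m)}

lemma exists_r (h : CoverData S t δ D) (hW : IsOpen W) (hSW : S ⊆ W) {K : Set (EE n m)}
    (hK : IsCompact K) (hKO : K ⊆ OO W t δ D) (hSK : S ⊆ interior K) {κ : ℝ} (hκ : 0 < κ) :
    ∃ r : EE n m → ℝ, ContDiff ℝ ∞ r ∧ IsCompact {x | r x ≤ 1} ∧ {x | r x ≤ 1} ⊆ K ∧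
      (∀ s ∈ S, r s < 1) ∧ (∃ c0, 0 < c0 ∧ ∀ x, r x < 1 → ∀ v, c0 * ‖v‖ ^ 2 ≤ levi r x v) ∧
      ∀ x, r x ≤ 1 → yy x ≤ κ ^ 2 / 8 := by
  obtain ⟨r0, r01, r02, r03, r04, r05⟩ := exists_r0 h hW hSW hK hKO hSK
  obtain ⟨B, hB⟩ := h.cpt.exists_bound_of_continuousOn
    (nn_contDiff (n := n) (m := m)).continuous.continuousOn
  set ε : ℝ := 1 / (2 * (|B| + 1)) with hε
  have hε0 : 0 < ε := by positivity
  have hSb : ∀ s ∈ S, ε * nn s < 1 / 2 := by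
    intro s hs
    have h1 : nn s ≤ |B| := (Real.le_norm_self _).trans ((hB s hs).trans (le_abs_self B))
    have : ε * (2 * (|B| + 1)) = 1 := by rw [hε]; field_simp
    nlinarith
  have hQ1 : IsCompact (K ×ˢ Metric.sphere (0 : EE n m) 1) := hK.prod (isCompact_sphere _ _)
  obtain ⟨C1, c1, hC1, hc1, hb1⟩ := compact_big hQ1
    (T := fun q => levi r0 q.1 q.2 + ε * (4 * (‖q.2.1‖ ^ 2 + ‖q.2.2‖ ^ 2)))
    (N := fun q => ‖q.2.1‖ ^ 2)
    (((levi_continuous r01).add (by fun_prop)).continuousOn) (by fun_prop)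
    (fun _ _ => by positivity) (by
      rintro ⟨x, v⟩ ⟨hx, hv⟩ h0
      have hv1 : v.1 = 0 := by simpa using h0
      have hv2 : v.2 ≠ 0 := by
        intro hv2
        have : v = 0 := Prod.ext hv1 hv2
        rw [this] at hv; simp at hv
      have := r05 x hx v hv1
      have h2 : 0 < ‖v.2‖ := norm_pos_iff.2 hv2
      simp only
      positivity)
  obtain ⟨C2, c2, hC2, hc2, hb2⟩ := compact_big (hK.diff isOpen_interior)
    (T := fun x => r0 x + ε * nn x - 1) (N := fun x => yy x)
    (((r01.continuous.add (continuous_const.mul nn_contDiff.continuous)).sub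
      continuous_const).continuousOn) (yy_contDiff.continuous.continuousOn)
    (fun x _ => yy_nonneg x) (by
      intro x hx h0
      have h1 := r04 x hx (yy_eq_zero.1 h0)
      have h2 := mul_nonneg hε0.le (nn_nonneg x)
      linarith)
  set C : ℝ := C1 + C2 + 8 / κ ^ 2 with hC
  have h8 : 0 < 8 / κ ^ 2 := by positivity
  have hC0 : 0 < C := by linarith
  set r1 : EE n m → ℝ := fun x => (r0 x + ε * nn x) + C * yy x with hr1
  have hr1c : ContDiff ℝ ∞ r1 :=
    (r01.add (contDiff_const.mul nn_contDiff)).add (contDiff_const.mul yy_contDiff)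
  have hlev : ∀ x v, levi r1 x v =
      levi r0 x v + ε * (4 * (‖v.1‖ ^ 2 + ‖v.2‖ ^ 2)) + C * (2 * ‖v.1‖ ^ 2) := by
    intro x v
    rw [hr1, levi_add (r01.add (contDiff_const.mul nn_contDiff)) (contDiff_const.mul yy_contDiff),
      levi_add r01 (contDiff_const.mul nn_contDiff), levi_const_mul nn_contDiff,
      levi_const_mul yy_contDiff, levi_nn, levi_yy]
  have hlow : ∀ x ∈ K, ∀ v, c1 * ‖v‖ ^ 2 ≤ levi r1 x v := by
    intro x hx v
    by_cases hv : v = 0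
    · subst hv; rw [hlev]
      have : levi r0 x 0 = 0 := by simp [levi]
      simp [this]
    · have hvn : 0 < ‖v‖ := norm_pos_iff.2 hv
      set w : EE n m := ‖v‖⁻¹ • v with hw
      have hwn : ‖w‖ = 1 := by
        rw [hw, norm_smul, norm_inv, norm_norm, inv_mul_cancel₀ hvn.ne']
      have hvw : v = ‖v‖ • w := by rw [hw, smul_smul, mul_inv_cancel₀ hvn.ne', one_smul]
      have h1 := hb1 C1 le_rfl (x, w) ⟨hx, by simpa using hwn⟩
      have h2 : c1 ≤ levi r1 x w := by
        rw [hlev]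
        have : C1 * ‖w.1‖ ^ 2 ≤ C * (2 * ‖w.1‖ ^ 2) := by
          have : C1 ≤ C := by linarith
          nlinarith [sq_nonneg ‖w.1‖]
        simp only at h1
        linarith
      rw [hvw, levi_smul_real, ← hvw]
      nlinarith [sq_nonneg ‖v‖]
  set L : Set (EE n m) := K ∩ {x | r1 x ≤ 1} with hL
  have hLc : IsCompact L := hK.inter_right (isClosed_le hr1c.continuous continuous_const)
  have hLi : L ⊆ interior K := by
    rintro x ⟨hx, hx1⟩
    by_contra hcon
    have h1 := hb2 C (by linarith) x ⟨hx, hcon⟩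
    have hx1' : r0 x + ε * nn x + C * yy x ≤ 1 := hx1
    linarith
  obtain ⟨θ, t1, t2, ⟨O1, o1, o2, o3, o4⟩, t4⟩ := exists_cutoff hLc isOpen_interior hLi
  set r : EE n m → ℝ := fun x => θ x * r1 x + 2 * (1 - θ x) with hr
  have hrL : ∀ x, r x ≤ 1 → x ∈ L := by
    intro x hx
    simp only [hr] at hx
    have hxi : x ∈ interior K := by
      by_contra hcon
      have : θ x = 0 := image_eq_zero_of_notMem_tsupport (fun hh => hcon (t4 hh))
      rw [this] at hx; linarith
    refine ⟨interior_subset hxi, ?_⟩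
    rw [mem_ofPred_eq]
    by_contra hcon
    push Not at hcon
    obtain ⟨h1, h2⟩ := t2 x
    rcases h1.eq_or_lt with h3 | h3
    · rw [← h3] at hx; linarith
    · nlinarith
  have hr1r : ∀ x ∈ O1, r x = r1 x := by
    intro x hx; simp [hr, o4 x hx]
  have hset : {x | r x ≤ 1} = L := by
    ext x; constructor
    · exact hrL x
    · intro hx; rw [mem_ofPred_eq, hr1r x (o2 hx)]; exact hx.2
  refine ⟨r, ?_, ?_, ?_, ?_, ⟨c1, hc1, ?_⟩, ?_⟩
  · exact (t1.mul hr1c).add (contDiff_const.mul (contDiff_const.sub t1))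
  · rw [hset]; exact hLc
  · rw [hset]; exact inter_subset_left
  · intro s hs
    have hy : yy s = 0 := yy_eq_zero.2 (h.sreal s hs)
    have hlt : r1 s < 1 := by
      have a1 := r03 s hs
      have a2 := hSb s hs
      simp only [hr1, hy]; linarith
    have hsL : s ∈ L := ⟨interior_subset (hSK hs), hlt.le⟩
    rw [hr1r s (o2 hsL)]; exact hlt
  · intro x hx v
    have hxL := hrL x hx.le
    have : r =ᶠ[𝓝 x] r1 := by
      filter_upwards [o1.mem_nhds (o2 hxL)] with y hy using hr1r y hy
    rw [levi_congr this]
    exact hlow x hxL.1 v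
  · intro x hx
    have hxL := hrL x hx
    have hx1' : r0 x + ε * nn x + C * yy x ≤ 1 := hxL.2
    have a1 := r02 x
    have a2 := mul_nonneg hε0.le (nn_nonneg x)
    have a3 : 8 / κ ^ 2 * yy x ≤ C * yy x :=
      mul_le_mul_of_nonneg_right (by linarith) (yy_nonneg x)
    have a4 : 8 / κ ^ 2 * yy x ≤ 1 := by linarith
    rw [div_mul_eq_mul_div, div_le_one (by positivity)] at a4
    linarith

end R1
end SC

namespace SC
open MeasureTheory Filter
open scoped ContDiff ComplexConjugate ENNReal
set_option linter.unusedSectionVars false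
set_option linter.style.haveILetI false

section Sep
variable {n m : ℕ}
variable {S : Set (EE n m)} {t : Finset (VV n)} {δ : VV n → ℝ} {D : VV n → Set (VV m)}
  {W : Set (EE n m)}

lemma exists_lam {Kc η σ : ℝ} (hK : 0 ≤ Kc) (hη : 0 < η) (hσ : 0 < σ) :
    ∃ l : ℝ, 0 ≤ l ∧ Kc * Real.exp (-(l * σ)) < η := by
  refine ⟨Kc / (η * σ), by positivity, ?_⟩
  have h1 : Kc / (η * σ) * σ = Kc / η := by field_simp
  rw [h1, Real.exp_neg, ← div_eq_mul_inv, div_lt_iff₀ (Real.exp_pos _)]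
  have h2 := Real.add_one_le_exp (Kc / η)
  have h3 : η * (Kc / η + 1) = Kc + η := by field_simp
  nlinarith

set_option maxHeartbeats 1600000 in
lemma separate (h : CoverData S t δ D) (hW : IsOpen W) (hSW : S ⊆ W) {κ0 : ℝ} (hκ0 : 0 < κ0)
    (hκδ : ∀ u ∈ t, κ0 ≤ δ u / 2) {r : EE n m → ℝ} (hr : ContDiff ℝ ∞ r)
    (hrc : IsCompact {x | r x ≤ 1}) (hrO : {x | r x ≤ 1} ⊆ OO W t δ D)
    {c0 : ℝ} (hc0 : 0 < c0) (hlevi : ∀ x, r x < 1 → ∀ v, c0 * ‖v‖ ^ 2 ≤ levi r x v)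
    (hyy : ∀ x, r x ≤ 1 → yy x ≤ κ0 ^ 2 / 128) {A : Set (EE n m)} (hA : IsCompact A)
    (hSA : S ⊆ A) {κ : ℝ} (hκ : 0 < κ) (hκκ : κ ≤ κ0 / 16)
    (hAκ : Metric.cthickening (2 * κ) A ⊆ {x | r x < 1}) {p0 : EE n m} (hp0 : p0 ∈ A)
    (hp0S : p0 ∉ S) : ∃ F : EE n m → ℂ, DifferentiableOn ℂ F (Metric.thickening κ A) ∧
      1 < ‖F p0‖ ∧ ∀ s ∈ S, ‖F s‖ < 1 := by
  have hball : ∀ p ∈ A, ∀ x ∈ Metric.ball p κ, r x < 1 := by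
    intro p hp x hx
    apply hAκ
    apply Metric.mem_cthickening_of_dist_le x p _ _ hp
    have := Metric.mem_ball.1 hx
    linarith
  have hA1 : ∀ p ∈ A, r p < 1 := fun p hp => hball p hp p (Metric.mem_ball_self hκ)
  by_cases hY : yy p0 = 0
  swap
  · have hYp : 0 < yy p0 := lt_of_le_of_ne (yy_nonneg p0) (Ne.symm hY)
    have ha := RR_mem p0.1
    refine ⟨fun x => (Real.exp (-(yy p0 / 2)) : ℂ) *
      Complex.exp (-((1:ℝ) * qq (RR n p0.1) x)), ?_, ?_, fun s hs => ?_⟩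
    · exact ((exp_qq_diff (RR n p0.1) 1).const_mul _).differentiableOn
    · rw [norm_mul, norm_exp_qq ha, Complex.norm_real,
        Real.norm_of_nonneg (Real.exp_pos _).le, ← Real.exp_add, Real.one_lt_exp_iff]
      simp; linarith
    · rw [norm_mul, norm_exp_qq ha, Complex.norm_real,
        Real.norm_of_nonneg (Real.exp_pos _).le, ← Real.exp_add, Real.exp_lt_one_iff,
        yy_eq_zero.2 (h.sreal s hs)]
      have := sq_nonneg ‖RR n s.1 - RR n p0.1‖
      linarith
  have hp0r : RR n p0.1 = p0.1 := yy_eq_zero.1 hY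
  have ha : p0.1 ∈ realSlice n := mem_realSlice_iff.2 hp0r
  obtain ⟨u, hu, hpu, f, hf, τ, hτ, hτδ, hfp, hfS⟩ :=
    sep_f h hSW (hrO (hA1 p0 hp0).le) hp0r hp0S
  have hO := OO_open h hW
  have hOb := OO_block (W := W) (D := D) hu hpu (hκδ u hu)
  obtain ⟨χ, c1, c2, c3, c4, -, c6, M, hM0, hM⟩ := exists_chi (m := m) p0.1 (ρ1 := κ0 / 2)
    (ρ2 := κ0) (by linarith) (by linarith)
  obtain ⟨C, hC0, hC⟩ := approx_main hr hrc hc0 hlevi hA hκ hAκ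
  have hDu : ∀ x, r x ≤ 1 → ‖RR n x.1 - p0.1‖ ≤ κ0 → x.2 ∈ D u := by
    intro x hx hx2
    rcases hOb x (hrO hx) with h1 | h1
    · linarith
    · exact h1
  obtain ⟨Mf, hMf0, hMf⟩ : ∃ Mf, 0 ≤ Mf ∧ ∀ x : EE n m, r x ≤ 1 → ‖RR n x.1 - p0.1‖ ≤ κ0 →
      ‖f x.2‖ ≤ Mf := by
    have hQ : IsCompact ({x : EE n m | r x ≤ 1} ∩ {x | ‖RR n x.1 - p0.1‖ ≤ κ0}) :=
      hrc.inter_right (isClosed_le (by fun_prop) continuous_const)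
    have hcont : ContinuousOn (fun x : EE n m => f x.2)
        ({x : EE n m | r x ≤ 1} ∩ {x | ‖RR n x.1 - p0.1‖ ≤ κ0}) :=
      hf.continuousOn.comp continuous_snd.continuousOn (fun x hx => hDu x hx.1 hx.2)
    obtain ⟨B, hB⟩ := hQ.exists_bound_of_continuousOn hcont
    exact ⟨|B|, abs_nonneg _, fun x h1 h2 => (hB x ⟨h1, h2⟩).trans (le_abs_self B)⟩
  set σ : ℝ := min (κ0 ^ 2 / 64) (τ ^ 2) with hσ
  have hσ0 : 0 < σ := lt_min (by positivity) (by positivity)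
  have hσ1 : σ ≤ κ0 ^ 2 / 64 := min_le_left _ _
  have hσ2 : σ ≤ τ ^ 2 := min_le_right _ _
  obtain ⟨l, hl0, hl⟩ := exists_lam (Kc := C * (M * Mf) + Mf) (η := min (1/2) (‖f p0.2‖ - 1))
    (σ := σ) (by positivity) (lt_min (by norm_num) (by linarith)) hσ0
  set ex := Real.exp (-(l * σ)) with hex
  have hex0 : 0 < ex := Real.exp_pos _
  have hl1 := hl.trans_le (min_le_left _ _)
  have hl2 := hl.trans_le (min_le_right _ _)
  have hexle : ∀ x : EE n m, σ ≤ ‖RR n x.1 - p0.1‖ ^ 2 - yy x →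
      ‖Complex.exp (-(l * qq p0.1 x))‖ ≤ ex := by
    intro x hx
    rw [norm_exp_qq ha, hex]
    apply Real.exp_le_exp.2
    have := mul_le_mul_of_nonneg_left hx hl0
    linarith
  obtain ⟨g1, g2⟩ := block c1 c4 hO (h.opn u hu) hOb hf (exp_qq_diff (m := m) p0.1 l)
  obtain ⟨G, b1, O1, o1, o2, o3, o4⟩ := globalize hrc hO hrO g1
  have hdb : ∀ x, r x < 1 → ∀ v, ‖db v G x‖ ≤ M * Mf * ex * ‖v‖ := by
    intro x hx v
    have hxO : x ∈ O1 := o2 hx.le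
    have e1 : G =ᶠ[𝓝 x] fun x => (χ x : ℂ) * (f x.2 * Complex.exp (-(l * qq p0.1 x))) := by
      filter_upwards [o1.mem_nhds hxO] with z hz using o4 z hz
    rw [db_congr e1, g2 x (o3 hxO)]
    have hnn : 0 ≤ M * Mf * ex * ‖v‖ := by positivity
    by_cases h1 : ‖RR n x.1 - p0.1‖ < κ0 / 2
    · rw [c6 x v h1, zero_mul, norm_zero]; exact hnn
    · push Not at h1
      by_cases h2 : ‖RR n x.1 - p0.1‖ ≤ κ0
      · have hy := hyy x hx.le
        have a1 : ‖Complex.exp (-(l * qq p0.1 x))‖ ≤ ex := by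
          apply hexle
          nlinarith
        have a2 := hMf x hx.le h2
        have a3 := hM x v
        rw [norm_mul, norm_mul]
        calc _ ≤ (M * ‖v‖) * (Mf * ex) := by gcongr
          _ = _ := by ring
      · push Not at h2
        have ho : IsOpen {y : EE n m | κ0 < ‖RR n y.1 - p0.1‖} :=
          isOpen_lt continuous_const (by fun_prop)
        have e2 : (fun x : EE n m => (χ x : ℂ)) =ᶠ[𝓝 x] fun _ => 0 := by
          filter_upwards [ho.mem_nhds h2] with y hy
          rw [c4 y (le_of_lt hy)]; simp
        rw [db_congr e2]
        simpa [db] using hnn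
  obtain ⟨F, hF1, hF2⟩ := hC G b1 (M * Mf * ex) (by positivity) hdb
  have hdist : ∀ p x : EE n m, x ∈ Metric.ball p κ → ‖RR n x.1 - RR n p.1‖ < κ := by
    intro p x hx
    rw [← map_sub]
    refine (norm_RR_le _).trans_lt ?_
    have h1 : ‖x - p‖ < κ := by rw [← dist_eq_norm]; exact hx
    exact (norm_fst_le (x - p)).trans_lt h1
  have hnear : ∀ p ∈ A, ‖RR n p.1 - p0.1‖ < κ0 / 4 →
      ‖F p - f p.2 * Complex.exp (-(l * qq p0.1 p))‖ ≤ C * (M * Mf * ex) + 0 := by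
    intro p hp hpn
    have hb : ∀ x ∈ Metric.ball p κ, ‖RR n x.1 - p0.1‖ ≤ κ0 / 2 := by
      intro x hx
      have := hdist p x hx
      have := norm_sub_le_norm_sub_add_norm_sub (RR n x.1) (RR n p.1) p0.1
      linarith
    apply hF2 p hp (fun x => f x.2 * Complex.exp (-(l * qq p0.1 x))) 0
    · refine DifferentiableOn.mul ?_ (exp_qq_diff (m := m) p0.1 l).differentiableOn
      refine hf.comp differentiable_snd.differentiableOn (fun x hx => ?_)
      exact hDu x (hball p hp x hx).le ((hb x hx).trans (by linarith))
    · intro x hx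
      rw [o4 x (o2 (hball p hp x hx).le), c3 x (hb x hx)]
      simp
  refine ⟨F, hF1, ?_, fun s hs => ?_⟩
  · have h1 := hnear p0 hp0 (by rw [hp0r, sub_self, norm_zero]; linarith)
    have hq : qq p0.1 p0 = 0 := by simp [qq]
    rw [hq, mul_zero, neg_zero, Complex.exp_zero, mul_one] at h1
    have h2 := norm_sub_norm_le (f p0.2) (F p0)
    rw [norm_sub_rev] at h2
    have h3 : 0 ≤ Mf * ex := by positivity
    nlinarith
  · have hsr := h.sreal s hs
    have hys : yy s = 0 := yy_eq_zero.2 hsr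
    by_cases hfar : ‖RR n s.1 - p0.1‖ < κ0 / 4
    · have h1 := hnear s (hSA hs) hfar
      have h2 := norm_sub_norm_le (F s) (f s.2 * Complex.exp (-(l * qq p0.1 s)))
      have h3 : ‖f s.2 * Complex.exp (-(l * qq p0.1 s))‖ ≤ 1 / 2 + Mf * ex := by
        have h4 : 0 ≤ Mf * ex := by positivity
        rw [norm_mul]
        by_cases hτs : ‖s.1 - p0.1‖ ≤ τ
        · have h5 := hfS s hs hτs
          have h6 : ‖Complex.exp (-(l * qq p0.1 s))‖ ≤ 1 := by
            rw [norm_exp_qq ha, Real.exp_le_one_iff, hys]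
            have := mul_nonneg hl0 (sq_nonneg ‖RR n s.1 - p0.1‖)
            linarith
          have := mul_le_mul h5.le h6 (norm_nonneg _) (by norm_num)
          linarith
        · push Not at hτs
          have h5 := hMf s (hA1 s (hSA hs)).le (by linarith)
          have h6 : ‖Complex.exp (-(l * qq p0.1 s))‖ ≤ ex := by
            apply hexle
            rw [hys, hsr]
            nlinarith
          have := mul_le_mul h5 h6 (norm_nonneg _) hMf0
          linarith
      nlinarith
    · push Not at hfar
      have h1 := hF2 s (hSA hs) (fun _ => 0) (Mf * ex) (differentiableOn_const _) (by
        intro x hx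
        have hrx := hball s (hSA hs) x hx
        rw [o4 x (o2 hrx.le), sub_zero, norm_mul, norm_mul, Complex.norm_real,
          Real.norm_of_nonneg (c2 x).1]
        by_cases hx2 : ‖RR n x.1 - p0.1‖ ≤ κ0
        · have a1 := hMf x hrx.le hx2
          have a2 : ‖Complex.exp (-(l * qq p0.1 x))‖ ≤ ex := by
            apply hexle
            have b2 := hdist s x hx
            rw [norm_sub_rev] at b2
            have b3 := norm_sub_le_norm_sub_add_norm_sub (RR n s.1) (RR n x.1) p0.1
            have b4 := hyy x hrx.le
            have b5 : 3 * κ0 / 16 ≤ ‖RR n x.1 - p0.1‖ := by linarith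
            have b6 : (3 * κ0 / 16) ^ 2 ≤ ‖RR n x.1 - p0.1‖ ^ 2 := by gcongr
            nlinarith
          calc _ ≤ 1 * (Mf * ex) := by
                gcongr
                exact (c2 x).2
            _ = _ := by ring
        · rw [c4 x (by linarith), zero_mul]; positivity)
      rw [sub_zero] at h1
      nlinarith

end Sep
end SC

namespace SC
open MeasureTheory Filter
open scoped ContDiff ComplexConjugate ENNReal
set_option linter.unusedSectionVars false
set_option linter.style.haveILetI false

section Final

lemma stein_of_polyhedron {E : Type*} [NormedAddCommGroup E] [NormedSpace ℂ E]
    {A T : Set E} (hA : IsCompact A) (hAT : A ⊆ T) {ι : Type*} (I : Finset ι)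
    (F : ι → E → ℂ) (hF : ∀ i ∈ I, DifferentiableOn ℂ (F i) T)
    (hb : ∀ p ∈ A \ interior A, ∃ i ∈ I, 1 < ‖F i p‖) :
    IsSteinOpen {x | x ∈ interior A ∧ ∀ i ∈ I, ‖F i x‖ < 1} := by
  set Ω : Set E := {x | x ∈ interior A ∧ ∀ i ∈ I, ‖F i x‖ < 1} with hΩ
  have hΩA : Ω ⊆ A := fun x hx => interior_subset hx.1
  constructor
  · have e : Ω = interior A ∩ ⋂ i ∈ I, (interior A ∩ (fun x => ‖F i x‖) ⁻¹' Iio 1) := by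
      ext x; simp only [hΩ, mem_ofPred_eq, mem_inter_iff, mem_iInter, mem_preimage, mem_Iio]
      constructor
      · rintro ⟨h1, h2⟩; exact ⟨h1, fun i hi => ⟨h1, h2 i hi⟩⟩
      · rintro ⟨h1, h2⟩; exact ⟨h1, fun i hi => (h2 i hi).2⟩
    rw [e]
    refine isOpen_interior.inter (isOpen_biInter_finset fun i hi => ?_)
    exact ((hF i hi).continuousOn.mono (interior_subset.trans hAT)).norm.isOpen_inter_preimage
      isOpen_interior isOpen_Iio
  · intro K hK hKc
    have hc : ∀ i, ∃ c : ℝ, 0 ≤ c ∧ c < 1 ∧ (i ∈ I → ∀ w ∈ K, ‖F i w‖ ≤ c) := by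
      intro i
      by_cases hi : i ∈ I
      · rcases K.eq_empty_or_nonempty with he | hne
        · exact ⟨0, le_rfl, one_pos, fun _ w hw => by simp [he] at hw⟩
        · obtain ⟨w, hw, hmax⟩ := hKc.exists_isMaxOn hne
            ((hF i hi).continuousOn.mono ((hK.trans hΩA).trans hAT)).norm
          exact ⟨‖F i w‖, norm_nonneg _, (hK hw).2 i hi, fun _ w' hw' => hmax hw'⟩
      · exact ⟨0, le_rfl, one_pos, fun h => absurd h hi⟩
    choose c hc0 hc1 hcb using hc
    set Q : Set E := A ∩ ⋂ i ∈ I, (A ∩ (fun x => ‖F i x‖) ⁻¹' Iic (c i)) with hQ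
    have hAcl := hA.isClosed
    have hQc : IsClosed Q := by
      refine hAcl.inter (isClosed_biInter fun i hi => ?_)
      exact ((hF i hi).continuousOn.mono hAT).norm.preimage_isClosed_of_isClosed hAcl isClosed_Iic
    have hQk : IsCompact Q := hA.of_isClosed_subset hQc inter_subset_left
    have hQΩ : Q ⊆ Ω := by
      rintro x ⟨hxA, hx⟩
      have hx' : ∀ i ∈ I, ‖F i x‖ ≤ c i := fun i hi => (mem_iInter₂.1 hx i hi).2
      refine ⟨?_, fun i hi => (hx' i hi).trans_lt (hc1 i)⟩
      by_contra hcon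
      obtain ⟨i, hi, h1⟩ := hb x ⟨hxA, hcon⟩
      have := hx' i hi
      have := hc1 i
      linarith
    have hsub : hullO Ω K ⊆ Q := by
      rintro x ⟨hx, hxf⟩
      refine ⟨hΩA hx, mem_iInter₂.2 fun i hi => ⟨hΩA hx, ?_⟩⟩
      exact (hxf (F i) ((hF i hi).mono (hΩA.trans hAT))).trans (bisup_le (hc0 i) (hcb i hi))
    have he : hullO Ω K = Q ∩ ⋂ (f : E → ℂ) (_ : DifferentiableOn ℂ f Ω),
        (Q ∩ (fun x => ‖f x‖) ⁻¹' Iic (⨆ w ∈ K, ‖f w‖)) := by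
      ext x
      constructor
      · intro hx
        exact ⟨hsub hx, mem_iInter₂.2 fun f hf => ⟨hsub hx, hx.2 f hf⟩⟩
      · rintro ⟨hx, hx2⟩
        exact ⟨hQΩ hx, fun f hf => (mem_iInter₂.1 hx2 f hf).2⟩
    refine hQk.of_isClosed_subset ?_ hsub
    rw [he]
    refine hQc.inter (isClosed_iInter fun f => isClosed_iInter fun hf => ?_)
    exact (hf.continuousOn.mono hQΩ).norm.preimage_isClosed_of_isClosed hQc isClosed_Iic

variable {n m : ℕ}
variable {S : Set (EE n m)} {t : Finset (VV n)} {δ : VV n → ℝ} {D : VV n → Set (VV m)}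

lemma stein_of_cover (h : CoverData S t δ D) : IsSteinCompactum S := by
  classical
  intro W hW hSW
  obtain ⟨κ0, hκ0, hκδ⟩ : ∃ κ0 : ℝ, 0 < κ0 ∧ ∀ u ∈ t, κ0 ≤ δ u / 2 := by
    rcases t.eq_empty_or_nonempty with he | hne
    · exact ⟨1, one_pos, fun u hu => by simp [he] at hu⟩
    · obtain ⟨u, hu, hmin⟩ := t.exists_min_image δ hne
      have := h.pos u hu
      exact ⟨δ u / 2, by linarith, fun u' hu' => by have := hmin u' hu'; linarith⟩
  obtain ⟨K, hK, hSK, hKO⟩ := exists_compact_between h.cpt (OO_open h hW) (subset_OO h hSW)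
  obtain ⟨r, r1, r2, r3, r4, ⟨c0, hc0, r5⟩, r6⟩ := exists_r h hW hSW hK hKO hSK
    (κ := κ0 / 4) (by linarith)
  have r6' : ∀ x, r x ≤ 1 → yy x ≤ κ0 ^ 2 / 128 := fun x hx => (r6 x hx).trans (by
    apply le_of_eq; ring)
  have hop : IsOpen {x | r x < 1} := isOpen_lt r1.continuous continuous_const
  obtain ⟨A, hA, hSA, hAr⟩ := exists_compact_between h.cpt hop r4
  obtain ⟨η, hη, hηA⟩ := hA.exists_cthickening_subset_open hop hAr
  set κ : ℝ := min (η / 2) (κ0 / 16) with hκ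
  have hκp : 0 < κ := lt_min (by linarith) (by linarith)
  have hκη : κ ≤ η / 2 := min_le_left _ _
  have hAκ : Metric.cthickening (2 * κ) A ⊆ {x | r x < 1} :=
    (Metric.cthickening_mono (by linarith) A).trans hηA
  have hex : ∀ p : EE n m, ∃ F : EE n m → ℂ, p ∈ A \ interior A →
      (DifferentiableOn ℂ F (Metric.thickening κ A) ∧ 1 < ‖F p‖ ∧ ∀ s ∈ S, ‖F s‖ < 1) := by
    intro p
    by_cases hp : p ∈ A \ interior A
    · obtain ⟨F, hF⟩ := separate h hW hSW hκ0 hκδ r1 r2 (r3.trans hKO) hc0 r5 r6' hA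
        (hSA.trans interior_subset) hκp (min_le_right _ _) hAκ hp.1 (fun hs => hp.2 (hSA hs))
      exact ⟨F, fun _ => hF⟩
    · exact ⟨0, fun hh => absurd hh hp⟩
  choose F hF using hex
  have hAT : A ⊆ Metric.thickening κ A := Metric.self_subset_thickening hκp A
  obtain ⟨I, hI1, hI2⟩ := (hA.diff isOpen_interior).elim_nhds_subcover
    (fun p => {x | 1 < ‖F p x‖}) (fun p hp => by
      have hc : ContinuousAt (fun x => ‖F p x‖) p :=
        ((hF p hp).1.continuousOn.continuousAt
          (Metric.isOpen_thickening.mem_nhds (hAT hp.1))).norm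
      exact hc.eventually (lt_mem_nhds (hF p hp).2.1))
  refine ⟨_, stein_of_polyhedron hA hAT I F (fun p hp => (hF p (hI1 p hp)).1) (fun p hp => ?_),
    fun s hs => ⟨hSA hs, fun p hp => (hF p (hI1 p hp)).2.2 s hs⟩, fun x hx => ?_⟩
  · obtain ⟨p', hp', hpp⟩ := mem_iUnion₂.1 (hI2 hp)
    exact ⟨p', hp', hpp⟩
  · have hx1 : r x < 1 := hAr (interior_subset hx.1)
    exact (hKO (r3 hx1.le)).1

end Final
end SC

/-- Corollary 1.4: if near every fiber of `S` there is a Stein neighborhood in which all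
nearby fibers are holomorphically convex, then `S` is a Stein compactum. -/
theorem stein_compactum_of_locally_uniform_fiber_convexity {n m : ℕ}
    (S : Set (EuclideanSpace ℂ (Fin n) × EuclideanSpace ℂ (Fin m)))
    (hS : IsCompact S) (hSreal : S ⊆ realSlice n ×ˢ (univ : Set (EuclideanSpace ℂ (Fin m))))
    (hyp : ∀ U, OpenInSlice U → S ⊆ U →
      ∀ u ∈ Prod.fst '' S, ∃ Ωu : Set (EuclideanSpace ℂ (Fin m)),
        IsSteinOpen Ωu ∧ fiberOf S u ⊆ Ωu ∧
        IsCompact (closure Ωu) ∧ closure Ωu ⊆ fiberOf U u ∧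
        ∃ δ : ℝ, 0 < δ ∧ ∀ u' ∈ Prod.fst '' S, ‖u - u'‖ ≤ δ →
          fiberOf S u' ⊆ Ωu ∧ hullO Ωu (fiberOf S u') = fiberOf S u') :
    IsSteinCompactum S := by
  classical
  have h1 : ∀ u : EuclideanSpace ℂ (Fin n), ∃ (D : Set (EuclideanSpace ℂ (Fin m))) (δ : ℝ),
      u ∈ Prod.fst '' S → (IsOpen D ∧ 0 < δ ∧ ∀ u' ∈ Prod.fst '' S, ‖u - u'‖ ≤ δ →
          fiberOf S u' ⊆ D ∧ hullO D (fiberOf S u') = fiberOf S u') := by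
    intro u
    by_cases hu : u ∈ Prod.fst '' S
    · obtain ⟨D, hD, -, -, -, δ, hδ, hc⟩ := hyp (univ ∩ (realSlice n ×ˢ univ))
        ⟨univ, isOpen_univ, rfl⟩ (by simpa using hSreal) u hu
      exact ⟨D, δ, fun _ => ⟨hD.1, hδ, hc⟩⟩
    · exact ⟨∅, 0, fun h => absurd h hu⟩
  choose D δ hDδ using h1
  obtain ⟨t, ht1, ht2⟩ := (hS.image continuous_fst).elim_nhds_subcover
    (fun u => Metric.ball u (δ u / 2))
    (fun u hu => Metric.ball_mem_nhds u (by have := (hDδ u hu).2.1; linarith))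
  refine SC.stein_of_cover (t := t) (δ := δ) (D := D) ⟨hS, ?_, ?_, ?_, ?_, ?_⟩
  · intro s hs
    exact SC.mem_realSlice_iff.1 (hSreal hs).1
  · exact fun u hu => (hDδ u (ht1 u hu)).2.1
  · exact fun u hu => (hDδ u (ht1 u hu)).1
  · exact fun u hu s hs hle => (hDδ u (ht1 u hu)).2.2 s.1 ⟨s, hs, rfl⟩ hle
  · intro s hs
    obtain ⟨u, hu, hsu⟩ := mem_iUnion₂.1 (ht2 ⟨s, hs, rfl⟩)
    exact ⟨u, hu, by rw [← dist_eq_norm]; exact hsu⟩
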